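/- arXiv:2405.04510 — 2 statements merged into one kernel-verified Lean document; each statement's English description precedes it below -/
import Mathlib

section
/- Let λ > 0, let P be a translation-invariant nearest-neighbour jump distribution on ℤ, let n ≥ 1, let η : V_n → ℕ with η ≠ 0, and set p = P_η(M_n = 0). Let λ' = p/(1−p) and let D be a nearest-neighbour jump distribution on ℤ with directed jumps towards the origin, i.e. D(x, x−1) = 1 and D(−x, −x+1) = 1 for every x ≥ 1. Then for every probability distribution ν on ℕ^ℤ there exists a coupling between ν_η ⊗ 𝒫_{λ,P} (the block model) and ν ⊗ 𝒫_{λ',D} (the coarse-grained model) such that, if (ξ, τ) and (ξ', τ') are coupled with these two respective distributions, then the event {m^{τ'}_{ξ'}(0) = 0} is contained in the event {m^τ_ξ(x) = 0 for all x ∈ B₀}; that is, if the origin is never visited in the coarse-grained model then the block of the origin is never visited in the block model. -/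
open MeasureTheory

noncomputable section

/-! ## Site-wise (Diaconis–Fulton) representation of Activated Random Walk -/

/-- An instruction: either a sleep instruction or a jump instruction to a site. -/
inductive Instr (Λ : Type*) where
  | sleep : Instr Λ
  | jump : Λ → Instr Λ

instance {Λ : Type*} : MeasurableSpace (Instr Λ) := ⊤

/-- The state of a site: either one sleeping particle (`𝔰`), or `k` active particles. -/
inductive SiteState where
  | sleeping : SiteState
  | act : ℕ → SiteState

instance : MeasurableSpace SiteState := ⊤

/-- Total number of particles on a site. -/
def SiteState.particles : SiteState → ℕ
  | sleeping => 1
  | act k => k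

/-- Number of active particles on a site. -/
def SiteState.activeCount : SiteState → ℕ
  | sleeping => 0
  | act k => k

/-- Remove one particle from a site (waking the site first if it was sleeping). -/
def SiteState.remove : SiteState → SiteState
  | sleeping => act 0
  | act k => act (k - 1)

/-- Add one active particle to a site, waking any sleeping particle there. -/
def SiteState.add (s : SiteState) : SiteState := act (s.particles + 1)

/-- A configuration `η : Λ → ℕ ∪ {𝔰}` of the activated random walk. -/
abbrev Config (Λ : Type*) := Λ → SiteState

variable {Λ : Type*} [DecidableEq Λ]

/-- The effect of the instruction `ι` applied at the site `x`: a sleep instruction puts the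
particle at `x` to sleep if it is alone (otherwise nothing happens); a jump instruction to `y`
moves one particle from `x` to `y`, waking any sleeping particle at `y`.  (For an acceptable
but not legal toppling, the sleeping particle at `x` is first woken up.) -/
def applyInstr (ι : Instr Λ) (x : Λ) (η : Config Λ) : Config Λ :=
  match ι with
  | .sleep => Function.update η x (if (η x).particles = 1 then .sleeping else η x)
  | .jump y =>
      let η₁ := Function.update η x (η x).remove
      Function.update η₁ y (η₁ y).add

/-- A state of the site-wise representation: a configuration together with the odometer
counting the number of instructions already used at each site. -/
abbrev SWState (Λ : Type*) := Config Λ × (Λ → ℕ)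

/-- Toppling the site `x`: apply the next unused instruction at `x` (instructions being
numbered from `0`) and increment the odometer at `x`.  This is the operator `Φ^τ_x`. -/
def topple (τ : Λ → ℕ → Instr Λ) (x : Λ) (s : SWState Λ) : SWState Λ :=
  (applyInstr (τ x (s.2 x)) x s.1, Function.update s.2 x (s.2 x + 1))

/-- `Φ^τ_α` for a toppling sequence `α`. -/
def toppleSeq (τ : Λ → ℕ → Instr Λ) (α : List Λ) (s : SWState Λ) : SWState Λ :=
  α.foldl (fun s x => topple τ x s) s

/-- A toppling at `x` is legal if `x` holds at least one active particle. -/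
def IsLegal (s : SWState Λ) (x : Λ) : Prop := 0 < (s.1 x).activeCount

/-- A toppling at `x` is acceptable if `x` holds at least one particle. -/
def IsAcceptable (s : SWState Λ) (x : Λ) : Prop := 0 < (s.1 x).particles

/-- A `τ`-legal sequence of topplings starting from the state `s`. -/
def LegalSeq (τ : Λ → ℕ → Instr Λ) : List Λ → SWState Λ → Prop
  | [], _ => True
  | x :: rest, s => IsLegal s x ∧ LegalSeq τ rest (topple τ x s)

/-- A `τ`-acceptable sequence of topplings starting from the state `s`. -/
def AcceptableSeq (τ : Λ → ℕ → Instr Λ) : List Λ → SWState Λ → Prop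
  | [], _ => True
  | x :: rest, s => IsAcceptable s x ∧ AcceptableSeq τ rest (topple τ x s)

/-- The initial state associated with a configuration: zero odometer. -/
def init (η : Config Λ) : SWState Λ := (η, fun _ => 0)

/-- `α` stabilizes `η` in `V`: after applying `α`, no site of `V` holds an active particle. -/
def StabilizesIn (τ : Λ → ℕ → Instr Λ) (α : List Λ) (η : Config Λ) (V : Set Λ) : Prop :=
  ∀ x ∈ V, ((toppleSeq τ α (init η)).1 x).activeCount = 0

/-- The odometer `m_α` of a toppling sequence `α`: the number of occurrences of each site. -/
def seqOdometer (α : List Λ) (x : Λ) : ℕ := α.count x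

/-- `m^τ_{V,η}`: the supremum of `m_α` over `τ`-legal toppling sequences `α` contained in `V`,
started from `η` with zero odometer. -/
def mV (τ : Λ → ℕ → Instr Λ) (V : Set Λ) (η : Config Λ) (x : Λ) : ℕ∞ :=
  ⨆ α : {α : List Λ // (∀ y ∈ α, y ∈ V) ∧ LegalSeq τ α (init η)}, (seqOdometer α.1 x : ℕ∞)

/-- The total stabilization odometer `m^τ_η`. -/
def mTot (τ : Λ → ℕ → Instr Λ) (η : Config Λ) (x : Λ) : ℕ∞ :=
  ⨆ α : {α : List Λ // LegalSeq τ α (init η)}, (seqOdometer α.1 x : ℕ∞)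

end

noncomputable section

open scoped ENNReal

variable {Λ : Type*} [DecidableEq Λ]

/-- The law of a single instruction above the site `x`: a sleep instruction with probability
`λ/(1+λ)` and a jump instruction to `y` with probability `P(x,y)/(1+λ)`. -/
def instrLaw (lam : ℝ) (P : Λ → Λ → ℝ) (x : Λ) : Measure (Instr Λ) :=
  ENNReal.ofReal (lam / (1 + lam)) • Measure.dirac Instr.sleep
    + Measure.sum fun y : Λ => ENNReal.ofReal (P x y / (1 + lam)) • Measure.dirac (Instr.jump y)

/-- `Pr` is the law `Pr_{λ,P}` of the array of instructions `(τ_{x,i})_{x ∈ Λ, i ∈ ℕ}`: all the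
instructions are independent, each `τ_{x,i}` being a sleep instruction with probability
`λ/(1+λ)` and a jump instruction to `y` with probability `P(x,y)/(1+λ)`.  (The law is
characterized through its finite-dimensional marginals.) -/
def IsInstrLaw (lam : ℝ) (P : Λ → Λ → ℝ) (Pr : Measure (Λ → ℕ → Instr Λ)) : Prop :=
  IsProbabilityMeasure Pr ∧
    ∀ s : Finset (Λ × ℕ),
      Pr.map (fun τ (q : s) => τ q.1.1 q.1.2) = Measure.pi fun q : s => instrLaw lam P q.1.1

/-- The configuration with `η x` active particles at each site `x` (all particles active). -/
def toCfg (η : Λ → ℕ) : Config Λ := fun x => SiteState.act (η x)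

/-- `V_n = (−n/2, n/2] ∩ ℤ`. -/
def Vseg (n : ℕ) : Finset ℤ :=
  (Finset.Icc (-(n : ℤ)) (n : ℤ)).filter fun x => -(n : ℤ) < 2 * x ∧ 2 * x ≤ (n : ℤ)

/-- The restriction of `η` to `V`, all particles active. -/
def restrictCfg (V : Finset ℤ) (η : ℤ → ℕ) : Config ℤ :=
  fun x => SiteState.act (if x ∈ V then η x else 0)

open Classical in
/-- The number of particles which jump out of `V` during the (legal) stabilization of the
configuration `η` in `V`, particles being killed when they jump out of `V`: this is the number
of jump instructions pointing out of `V` which are used during the stabilization, i.e. among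
the first `m^τ_{V,η}(x)` instructions at each site `x ∈ V`. -/
def exitCount (τ : ℤ → ℕ → Instr ℤ) (V : Finset ℤ) (η : Config ℤ) : ℕ∞ :=
  ∑' x : V, ∑' i : ℕ,
    if (i : ℕ∞) < mV τ (V : Set ℤ) η x ∧ ∃ y, y ∉ V ∧ τ x i = Instr.jump y then 1 else 0

/-- `M_n`: the number of particles which jump out of `V_n` during the stabilization of the
configuration `η` restricted to `V_n` (all particles initially active), particles being killed
when they jump out of `V_n`. -/
def Mval (τ : ℤ → ℕ → Instr ℤ) (n : ℕ) (η : ℤ → ℕ) : ℕ∞ :=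
  exitCount τ (Vseg n) (restrictCfg (Vseg n) η)

/-- `ν` is an i.i.d. distribution on configurations with site marginal `μ`. -/
def IsIID (ν : Measure (ℤ → ℕ)) (μ : Measure ℕ) : Prop :=
  IsProbabilityMeasure μ ∧
    ∀ s : Finset ℤ, ν.map (fun η (x : s) => η x) = Measure.pi fun _ : s => μ

end

noncomputable section

/-- The index `k` of the block `B_k = V_n + kn` containing the site `x`. -/
def blockIdx (n : ℕ) (x : ℤ) : ℤ := (2 * x + n - 1).fdiv (2 * n)

/-- The map `φ_η : ℕ^ℤ → ℕ^ℤ` of the block construction: for `x ∈ B_k`,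
`φ_η(ξ)(x) = ξ(k) · η(x − kn)`. -/
def phiEta (n : ℕ) (η : ℤ → ℕ) (ξ : ℤ → ℕ) : ℤ → ℕ :=
  fun x => ξ (blockIdx n x) * η (x - blockIdx n x * n)

namespace ARW

/-! ## Deterministic properties of legal toppling sequences -/

section Deterministic

variable {Λ : Type*}

/-- The rank of a site state in the order `0 < 𝔰 < 1 < 2 < ⋯`. -/
def rank : SiteState → ℕ
  | .sleeping => 1
  | .act 0 => 0
  | .act (k + 1) => k + 2

lemma activeCount_pos_iff {s : SiteState} : 0 < s.activeCount ↔ 2 ≤ rank s := by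
  rcases s with _ | _ | k <;> simp [SiteState.activeCount, rank]

lemma activeCount_pos_mono {s t : SiteState} (h : rank s ≤ rank t) (hs : 0 < s.activeCount) :
    0 < t.activeCount := by
  rw [activeCount_pos_iff] at *
  omega

lemma rank_add_mono {s t : SiteState} (h : rank s ≤ rank t) : rank s.add ≤ rank t.add := by
  rcases s with _ | _ | k <;> rcases t with _ | _ | l <;>
    simp_all [rank, SiteState.add, SiteState.particles]

lemma rank_le_add (s : SiteState) : rank s ≤ rank s.add := by
  rcases s with _ | _ | k <;> simp [rank, SiteState.add, SiteState.particles]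

lemma rank_remove_mono {s t : SiteState} (hs : 0 < s.activeCount) (h : rank s ≤ rank t) :
    rank s.remove ≤ rank t.remove := by
  rcases s with _ | _ | k <;> rcases t with _ | _ | l <;>
    simp_all [SiteState.remove, SiteState.activeCount, rank]
  rcases k with _ | k <;> rcases l with _ | l <;> simp_all

lemma rank_sleep_mono {s t : SiteState} (hs : 0 < s.activeCount) (h : rank s ≤ rank t) :
    rank (if s.particles = 1 then .sleeping else s) ≤
      rank (if t.particles = 1 then .sleeping else t) := by
  rcases s with _ | _ | k <;> rcases t with _ | _ | l <;>
    simp_all [rank, SiteState.particles, SiteState.activeCount]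
  split_ifs <;> simp_all

/-- `s'` has at least as many particles as `s` on `V`, and the same odometer. -/
def Dominated (V : Set Λ) (s s' : SWState Λ) : Prop :=
  s.2 = s'.2 ∧ ∀ x ∈ V, rank (s.1 x) ≤ rank (s'.1 x)

lemma Dominated.isLegal {V : Set Λ} {s s' : SWState Λ} (h : Dominated V s s') {x : Λ}
    (hx : x ∈ V) (hl : IsLegal s x) : IsLegal s' x :=
  activeCount_pos_mono (h.2 x hx) hl

variable [DecidableEq Λ]

lemma applyInstr_mono {V : Set Λ} {c c' : Config Λ} (h : ∀ x ∈ V, rank (c x) ≤ rank (c' x))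
    {x : Λ} (hx : x ∈ V) (hl : 0 < (c x).activeCount) (ι : Instr Λ) :
    ∀ y ∈ V, rank (applyInstr ι x c y) ≤ rank (applyInstr ι x c' y) := by
  intro y hy
  cases ι with
  | sleep =>
    by_cases hyx : y = x
    · subst hyx
      simpa [applyInstr] using rank_sleep_mono hl (h y hy)
    · simpa [applyInstr, hyx] using h y hy
  | jump z =>
    have key : ∀ w ∈ V, rank (Function.update c x (c x).remove w) ≤
        rank (Function.update c' x (c' x).remove w) := by
      intro w hw
      by_cases hwx : w = x
      · subst hwx
        simpa using rank_remove_mono hl (h w hw)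
      · simpa [hwx] using h w hw
    by_cases hyz : y = z
    · subst hyz
      simpa [applyInstr] using rank_add_mono (key y hy)
    · simpa [applyInstr, hyz] using key y hy

lemma Dominated.topple {V : Set Λ} {s s' : SWState Λ} (h : Dominated V s s') {x : Λ}
    (hx : x ∈ V) (hl : IsLegal s x) (τ : Λ → ℕ → Instr Λ) :
    Dominated V (topple τ x s) (topple τ x s') := by
  refine ⟨by simp [_root_.topple, h.1], ?_⟩
  simp only [_root_.topple, ← h.1]
  exact applyInstr_mono h.2 hx hl _

lemma Dominated.legalSeq {V : Set Λ} (τ : Λ → ℕ → Instr Λ) {α : List Λ} :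
    ∀ {s s' : SWState Λ}, Dominated V s s' → (∀ y ∈ α, y ∈ V) → LegalSeq τ α s →
      LegalSeq τ α s' := by
  induction α with
  | nil => simp [LegalSeq]
  | cons x α ih =>
    intro s s' h hV hl
    simp only [List.mem_cons, forall_eq_or_imp] at hV
    exact ⟨h.isLegal hV.1 hl.1, ih (h.topple hV.1 hl.1 τ) hV.2 hl.2⟩

lemma applyInstr_sleep (x : Λ) (c : Config Λ) (z : Λ) : applyInstr .sleep x c z =
    if z = x then (if (c z).particles = 1 then .sleeping else c z) else c z := by
  by_cases h : z = x
  · subst h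
    simp [applyInstr]
  · simp [applyInstr, h]

lemma applyInstr_jump (x y : Λ) (c : Config Λ) (z : Λ) : applyInstr (.jump y) x c z =
    if z = y then (if z = x then (c z).remove else c z).add
    else if z = x then (c z).remove else c z := by
  by_cases h : z = x <;> by_cases h' : z = y <;>
    simp_all [applyInstr, Function.update_apply]

lemma applyInstr_comm {x y : Λ} (hxy : x ≠ y) (ι κ : Instr Λ) (c : Config Λ)
    (hx : 0 < (c x).activeCount) (hy : 0 < (c y).activeCount) :
    applyInstr ι x (applyInstr κ y c) = applyInstr κ y (applyInstr ι x c) := by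
  have e1 : ∀ s : SiteState, 0 < s.activeCount → ∃ k, s = .act (k + 1) := by
    rintro (_ | _ | k) h <;> simp_all [SiteState.activeCount]
  obtain ⟨k, hk⟩ := e1 _ hx
  obtain ⟨l, hl⟩ := e1 _ hy
  funext z
  have h0 : z ≠ x ∨ z ≠ y := by
    by_contra! h
    exact hxy (h.1.symm.trans h.2)
  have hzx : z = x → c z = .act (k + 1) := fun h => h ▸ hk
  have hzy : z = y → c z = .act (l + 1) := fun h => h ▸ hl
  cases ι <;> cases κ <;> simp only [applyInstr_sleep, applyInstr_jump] <;>
    split_ifs <;> simp_all [SiteState.add, SiteState.remove, SiteState.particles]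

lemma topple_comm (τ : Λ → ℕ → Instr Λ) {x y : Λ} (hxy : x ≠ y) {s : SWState Λ}
    (hx : IsLegal s x) (hy : IsLegal s y) :
    topple τ x (topple τ y s) = topple τ y (topple τ x s) := by
  simp only [topple, Function.update_of_ne hxy, Function.update_of_ne hxy.symm]
  rw [applyInstr_comm hxy _ _ _ hx hy, Function.update_comm hxy]

lemma le_applyInstr (ι : Instr Λ) {x z : Λ} (hz : z ≠ x) (c : Config Λ) :
    rank (c z) ≤ rank (applyInstr ι x c z) := by
  cases ι with
  | sleep => simp [applyInstr, hz]
  | jump y =>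
    by_cases hzy : z = y
    · subst hzy
      simpa [applyInstr, hz] using rank_le_add (c z)
    · simp [applyInstr, hz, hzy]

lemma isLegal_topple_of_ne {s : SWState Λ} {x y : Λ} (hy : IsLegal s y) (hxy : y ≠ x)
    (τ : Λ → ℕ → Instr Λ) : IsLegal (topple τ x s) y :=
  activeCount_pos_mono (le_applyInstr _ hxy _) hy

/-- Starting with a given legal toppling does not decrease the odometer of a legal sequence. -/
lemma exists_legalSeq_topple (τ : Λ → ℕ → Instr Λ) {x : Λ} {α : List Λ} :
    ∀ {s : SWState Λ}, IsLegal s x → LegalSeq τ α s →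
      ∃ β, LegalSeq τ β (topple τ x s) ∧ (∀ y ∈ β, y ∈ α) ∧
        ∀ z, α.count z ≤ (x :: β).count z := by
  induction α with
  | nil => exact fun _ _ => ⟨[], by simp [LegalSeq]⟩
  | cons y α ih =>
    intro s hx hl
    by_cases hyx : y = x
    · subst hyx
      exact ⟨α, hl.2, fun z hz => List.mem_cons_of_mem _ hz, fun z => le_rfl⟩
    · obtain ⟨β, hβ, hsub, hcount⟩ := ih (isLegal_topple_of_ne hx (Ne.symm hyx) τ) hl.2
      refine ⟨y :: β, ⟨isLegal_topple_of_ne hl.1 hyx τ, ?_⟩, ?_, ?_⟩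
      · rwa [topple_comm τ hyx hl.1 hx]
      · simp only [List.mem_cons, forall_eq_or_imp, true_or, true_and]
        exact fun z hz => Or.inr (hsub z hz)
      · intro z
        have := hcount z
        simp only [List.count_cons] at *
        omega

/-- The array of instructions obtained by deleting the first instruction at `x`. -/
def dropInstr (x : Λ) (τ : Λ → ℕ → Instr Λ) : Λ → ℕ → Instr Λ :=
  Function.update τ x fun i => τ x (i + 1)

lemma dropInstr_self (x : Λ) (τ : Λ → ℕ → Instr Λ) (i : ℕ) :
    dropInstr x τ x i = τ x (i + 1) := by
  simp [dropInstr]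

lemma dropInstr_of_ne {x y : Λ} (h : y ≠ x) (τ : Λ → ℕ → Instr Λ) :
    dropInstr x τ y = τ y := by
  simp [dropInstr, h]

lemma legalSeq_dropInstr (τ : Λ → ℕ → Instr Λ) (x : Λ) (α : List Λ) :
    ∀ (c : Config Λ) (o : Λ → ℕ), LegalSeq τ α (c, Function.update o x (o x + 1)) ↔
      LegalSeq (dropInstr x τ) α (c, o) := by
  induction α with
  | nil => simp [LegalSeq]
  | cons y α ih =>
    intro c o
    refine and_congr Iff.rfl ?_
    by_cases h : y = x
    · subst h
      simpa [topple, dropInstr_self] using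
        ih (applyInstr (τ y (o y + 1)) y c) (Function.update o y (o y + 1))
    · have := ih (applyInstr (τ y (o y)) y c) (Function.update o y (o y + 1))
      simpa [topple, h, dropInstr_of_ne h, Ne.symm h, Function.update_comm h] using this

lemma legalSeq_topple_init (τ : Λ → ℕ → Instr Λ) (x : Λ) (α : List Λ) (c : Config Λ) :
    LegalSeq τ α (topple τ x (init c)) ↔
      LegalSeq (dropInstr x τ) α (init (applyInstr (τ x 0) x c)) :=
  legalSeq_dropInstr τ x α (applyInstr (τ x 0) x c) fun _ => 0

/-- No legal sequence contained in `V` topples a site of `B`. -/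
def Avoids (τ : Λ → ℕ → Instr Λ) (V B : Set Λ) (c : Config Λ) : Prop :=
  ∀ α : List Λ, (∀ y ∈ α, y ∈ V) → LegalSeq τ α (init c) → ∀ y ∈ α, y ∉ B

lemma Avoids.mono {τ : Λ → ℕ → Instr Λ} {V B : Set Λ} {c c' : Config Λ}
    (h : ∀ x ∈ V, rank (c x) ≤ rank (c' x)) (hc' : Avoids τ V B c') : Avoids τ V B c :=
  fun α hV hl => hc' α hV
    (Dominated.legalSeq (s := init c) (s' := init c') τ ⟨rfl, h⟩ hV hl)

lemma Avoids.step {τ : Λ → ℕ → Instr Λ} {V B : Set Λ} {c : Config Λ} {x : Λ} (hx : x ∈ V)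
    (hl : 0 < (c x).activeCount) (h : Avoids τ V B c) :
    Avoids (dropInstr x τ) V B (applyInstr (τ x 0) x c) := by
  intro α hV hα y hy
  refine h (x :: α) (by simpa [hx] using hV) ⟨hl, ?_⟩ y (List.mem_cons_of_mem _ hy)
  rwa [legalSeq_topple_init]

lemma Avoids.of_step {τ : Λ → ℕ → Instr Λ} {V B : Set Λ} {c : Config Λ} {x : Λ}
    (hxB : x ∉ B) (hl : 0 < (c x).activeCount)
    (h : Avoids (dropInstr x τ) V B (applyInstr (τ x 0) x c)) : Avoids τ V B c := by
  intro α hV hα y hy hyB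
  obtain ⟨β, hβ, hsub, hcount⟩ := exists_legalSeq_topple τ (show IsLegal (init c) x from hl) hα
  rw [legalSeq_topple_init] at hβ
  have h1 : y ∈ x :: β := List.count_pos_iff.1 ((List.count_pos_iff.2 hy).trans_le (hcount y))
  rcases List.mem_cons.1 h1 with rfl | h1
  · exact hxB hyB
  · exact h β (fun z hz => hV z (hsub z hz)) hβ y h1 hyB

/-- No particle leaves `V` during the legal stabilization of `c` in `V`. -/
def Confined (τ : Λ → ℕ → Instr Λ) (V : Set Λ) (c : Config Λ) : Prop :=
  ∀ α : List Λ, (∀ y ∈ α, y ∈ V) → LegalSeq τ α (init c) →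
    ∀ x i, i < α.count x → ∀ y, y ∉ V → τ x i ≠ .jump y

lemma confined_step {τ : Λ → ℕ → Instr Λ} {V : Set Λ} {c : Config Λ} {x : Λ} (hx : x ∈ V)
    (hl : 0 < (c x).activeCount) :
    Confined τ V c ↔ (∀ y, y ∉ V → τ x 0 ≠ .jump y) ∧
      Confined (dropInstr x τ) V (applyInstr (τ x 0) x c) := by
  refine ⟨fun h => ⟨?_, ?_⟩, fun ⟨h0, h⟩ => ?_⟩
  · exact h [x] (by simpa using hx) ⟨hl, trivial⟩ x 0 (by simp)
  · intro α hV hα z i hi y hy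
    have := h (x :: α) (by simpa [hx] using hV) ⟨hl, by rwa [legalSeq_topple_init]⟩ z
    by_cases hz : z = x
    · subst hz
      rw [dropInstr_self]
      exact this (i + 1) (by simpa using hi) y hy
    · rw [dropInstr_of_ne hz]
      exact this i (by simpa [List.count_cons, Ne.symm hz] using hi) y hy
  · intro α hV hα z i hi y hy
    obtain ⟨β, hβ, hsub, hcount⟩ := exists_legalSeq_topple τ (show IsLegal (init c) x from hl) hα
    rw [legalSeq_topple_init] at hβ
    have hc := hi.trans_le (hcount z)
    have := h β (fun z hz => hV z (hsub z hz)) hβ z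
    by_cases hz : z = x
    · subst hz
      cases i with
      | zero => exact h0 y hy
      | succ j =>
        rw [← dropInstr_self z τ j]
        exact this j (by simpa using hc) y hy
    · rw [dropInstr_of_ne hz] at this
      exact this i (by simpa [List.count_cons, Ne.symm hz] using hc) y hy

lemma legalSeq_eq_nil {τ : Λ → ℕ → Instr Λ} {V : Set Λ} {c : Config Λ} {α : List Λ}
    (hc : ∀ x ∈ V, (c x).activeCount = 0) (hV : ∀ y ∈ α, y ∈ V) (hα : LegalSeq τ α (init c)) :
    α = [] := by
  cases α with
  | nil => rfl
  | cons x α =>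
    have h1 : 0 < (c x).activeCount := hα.1
    have h2 := hc x (hV x List.mem_cons_self)
    omega

lemma avoids_of_stable (τ : Λ → ℕ → Instr Λ) {V : Set Λ} (B : Set Λ) {c : Config Λ}
    (hc : ∀ x ∈ V, (c x).activeCount = 0) : Avoids τ V B c := by
  intro α hV hα
  simp [legalSeq_eq_nil hc hV hα]

lemma confined_of_stable (τ : Λ → ℕ → Instr Λ) {V : Set Λ} {c : Config Λ}
    (hc : ∀ x ∈ V, (c x).activeCount = 0) : Confined τ V c := by
  intro α hV hα
  simp [legalSeq_eq_nil hc hV hα]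

lemma not_avoids {τ : Λ → ℕ → Instr Λ} {V B : Set Λ} {c : Config Λ} {x : Λ} (hx : x ∈ V)
    (hxB : x ∈ B) (hl : 0 < (c x).activeCount) : ¬ Avoids τ V B c := fun h =>
  h [x] (by simpa using hx) ⟨hl, trivial⟩ x (by simp) hxB

lemma mTot_eq_zero_iff {τ : Λ → ℕ → Instr Λ} {c : Config Λ} {x : Λ} :
    mTot τ c x = 0 ↔ ∀ α, LegalSeq τ α (init c) → x ∉ α := by
  simp [mTot, seqOdometer, List.count_eq_zero]

end Deterministic

/-! ## The law of the array of instructions -/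

/-- The data of a nearest-neighbour model on `ℤ`. -/
structure IsModel (lam : ℝ) (P : ℤ → ℤ → ℝ) (Pr : Measure (ℤ → ℕ → Instr ℤ)) : Prop where
  lam_nonneg : 0 ≤ lam
  nonneg : ∀ x y, 0 ≤ P x y
  rowsum : ∀ x, ∑' y, P x y = 1
  nearest : ∀ x y, P x y ≠ 0 → y = x + 1 ∨ y = x - 1
  law : IsInstrLaw lam P Pr

instance : Countable (Instr ℤ) :=
  Function.Injective.countable (β := Option ℤ)
    (f := fun ι => match ι with | .sleep => none | .jump y => some y) (by
      rintro (_ | a) (_ | b) h <;> simp_all)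

instance : DiscreteMeasurableSpace (Instr ℤ) := ⟨fun _ => trivial⟩

instance : DiscreteMeasurableSpace SiteState := ⟨fun _ => trivial⟩

/-- The array of instructions obtained by inserting `ι` as a new first instruction at `x`. -/
def consInstr (x : ℤ) (ι : Instr ℤ) (τ : ℤ → ℕ → Instr ℤ) : ℤ → ℕ → Instr ℤ :=
  Function.update τ x fun i => Nat.casesOn i ι (τ x)

lemma consInstr_zero (x : ℤ) (ι : Instr ℤ) (τ : ℤ → ℕ → Instr ℤ) : consInstr x ι τ x 0 = ι := by
  simp [consInstr]

lemma consInstr_succ (x : ℤ) (ι : Instr ℤ) (τ : ℤ → ℕ → Instr ℤ) (i : ℕ) :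
    consInstr x ι τ x (i + 1) = τ x i := by
  simp [consInstr]

lemma consInstr_of_ne {x y : ℤ} (h : y ≠ x) (ι : Instr ℤ) (τ : ℤ → ℕ → Instr ℤ) :
    consInstr x ι τ y = τ y := by
  simp [consInstr, h]

lemma dropInstr_consInstr (x : ℤ) (ι : Instr ℤ) (τ : ℤ → ℕ → Instr ℤ) :
    dropInstr x (consInstr x ι τ) = τ := by
  funext y
  by_cases h : y = x
  · subst h
    funext i
    rw [dropInstr_self, consInstr_succ]
  · rw [dropInstr_of_ne h, consInstr_of_ne h]

lemma measurable_consInstr (x : ℤ) :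
    Measurable fun q : Instr ℤ × (ℤ → ℕ → Instr ℤ) => consInstr x q.1 q.2 := by
  refine measurable_pi_iff.2 fun y => measurable_pi_iff.2 fun i => ?_
  by_cases h : y = x
  · subst h
    cases i with
    | zero => simpa only [consInstr_zero] using measurable_fst
    | succ i => simp only [consInstr_succ]; fun_prop
  · simp only [consInstr_of_ne h]; fun_prop

namespace IsModel

variable {lam : ℝ} {P : ℤ → ℤ → ℝ} {Pr : Measure (ℤ → ℕ → Instr ℤ)}

lemma sum_neighbours (M : IsModel lam P Pr) (x : ℤ) : P x (x + 1) + P x (x - 1) = 1 := by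
  rw [← M.rowsum x, tsum_eq_sum (s := {x + 1, x - 1}), Finset.sum_pair (by omega)]
  intro y hy
  by_contra h
  exact hy (by simpa using M.nearest x y h)

lemma instrLaw_eq (M : IsModel lam P Pr) (x : ℤ) : instrLaw lam P x =
    ENNReal.ofReal (lam / (1 + lam)) • Measure.dirac Instr.sleep +
      (ENNReal.ofReal (P x (x + 1) / (1 + lam)) • Measure.dirac (Instr.jump (x + 1)) +
      ENNReal.ofReal (P x (x - 1) / (1 + lam)) • Measure.dirac (Instr.jump (x - 1))) := by
  rw [instrLaw]
  congr 1
  ext A hA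
  rw [Measure.sum_apply _ hA, tsum_eq_sum (s := {x + 1, x - 1}), Finset.sum_pair (by omega)]
  · simp
  · intro y hy
    have : P x y = 0 := by
      by_contra h
      exact hy (by simpa using M.nearest x y h)
    simp [this]

lemma isProbabilityMeasure_instrLaw (M : IsModel lam P Pr) (x : ℤ) :
    IsProbabilityMeasure (instrLaw lam P x) := by
  have h0 := M.lam_nonneg
  constructor
  rw [M.instrLaw_eq]
  simp only [Measure.add_apply, Measure.smul_apply, measure_univ, smul_eq_mul, mul_one]
  have h1 := M.nonneg x (x + 1)
  have h2 := M.nonneg x (x - 1)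
  rw [← ENNReal.ofReal_add (by positivity) (by positivity),
    ← ENNReal.ofReal_add (by positivity) (by positivity), ← ENNReal.ofReal_one]
  congr 1
  have := M.sum_neighbours x
  field_simp
  linarith

lemma isProbabilityMeasure (M : IsModel lam P Pr) : IsProbabilityMeasure Pr := M.law.1

lemma measure_box (M : IsModel lam P Pr) (s : Finset (ℤ × ℕ)) (t : ℤ × ℕ → Set (Instr ℤ)) :
    Pr {τ | ∀ q ∈ s, τ q.1 q.2 ∈ t q} = ∏ q ∈ s, instrLaw lam P q.1 (t q) := by
  have := M.isProbabilityMeasure_instrLaw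
  have h := congrArg (fun m => m (Set.univ.pi fun q : s => t q)) (M.law.2 s)
  rw [Measure.pi_pi, Measure.map_apply (by fun_prop)
    (MeasurableSet.univ_pi fun _ => MeasurableSet.of_discrete)] at h
  rw [← Finset.prod_attach, ← Finset.univ_eq_attach, ← h]
  congr 1
  ext τ
  simp

/-- The law of the array of instructions is determined by its values on rectangular boxes. -/
lemma eq_of_box (M : IsModel lam P Pr) (x : ℤ) {Pr' : Measure (ℤ → ℕ → Instr ℤ)}
    (h : ∀ (S : Finset ℤ) (m : ℕ) (t : ℤ → ℕ → Set (Instr ℤ)), x ∈ S →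
      Pr' {τ | ∀ y ∈ S, ∀ i < m + 1, τ y i ∈ t y i} =
        ∏ y ∈ S, ∏ i ∈ Finset.range (m + 1), instrLaw lam P y (t y i)) : Pr' = Pr := by
  have := M.isProbabilityMeasure_instrLaw
  have huncurry : Measurable fun (τ : ℤ → ℕ → Instr ℤ) (q : ℤ × ℕ) => τ q.1 q.2 := by fun_prop
  have hcurry : Measurable fun (τ : ℤ × ℕ → Instr ℤ) (y : ℤ) (i : ℕ) => τ (y, i) := by fun_prop
  have key : ∀ m : Measure (ℤ → ℕ → Instr ℤ), (m.map fun τ (q : ℤ × ℕ) => τ q.1 q.2).map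
      (fun τ y i => τ (y, i)) = m := by
    intro m
    rw [Measure.map_map hcurry huncurry]
    exact Measure.map_id
  rw [← key Pr', ← key Pr]
  congr 1
  trans Measure.infinitePi fun q : ℤ × ℕ => instrLaw lam P q.1
  · refine Measure.eq_infinitePi _ fun s t ht => ?_
    classical
    rw [Measure.map_apply huncurry (MeasurableSet.pi s.countable_toSet fun i _ => ht i)]
    set S : Finset ℤ := insert x (s.image Prod.fst) with hS
    set m : ℕ := s.sup Prod.snd with hm
    have hs : s ⊆ S ×ˢ Finset.range (m + 1) := by
      intro q hq
      rw [Finset.mem_product]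
      refine ⟨Finset.mem_insert_of_mem (Finset.mem_image_of_mem _ hq), ?_⟩
      exact Finset.mem_range.2 (Nat.lt_succ_of_le (Finset.le_sup (f := Prod.snd) hq))
    have h1 := h S m (fun y i => if (y, i) ∈ s then t (y, i) else Set.univ)
      (Finset.mem_insert_self _ _)
    rw [← Finset.prod_product' (f := fun y i =>
      instrLaw lam P y (if (y, i) ∈ s then t (y, i) else Set.univ)),
      ← Finset.prod_subset hs] at h1
    · calc _ = _ := ?_
        _ = _ := h1
        _ = _ := Finset.prod_congr rfl fun q hq => by simp [hq]
      congr 1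
      ext τ
      simp only [Set.mem_preimage, Set.mem_pi, Set.mem_ofPred_eq, Finset.mem_coe]
      refine ⟨fun H y _ i _ => ?_, fun H q hq => ?_⟩
      · split_ifs with hq
        · exact H _ hq
        · trivial
      · have h2 := Finset.mem_product.1 (hs hq)
        simpa [hq] using H q.1 h2.1 q.2 (Finset.mem_range.1 h2.2)
    · intro q _ hq
      simp [hq]
  · refine (Measure.eq_infinitePi _ fun s t ht => ?_).symm
    rw [Measure.map_apply huncurry (MeasurableSet.pi s.countable_toSet fun i _ => ht i),
      ← M.measure_box]
    congr 1

lemma map_consInstr (M : IsModel lam P Pr) (x : ℤ) :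
    ((instrLaw lam P x).prod Pr).map (fun q => consInstr x q.1 q.2) = Pr := by
  have := M.isProbabilityMeasure_instrLaw
  have := M.isProbabilityMeasure
  refine M.eq_of_box x fun S m t hx => ?_
  classical
  set t' : ℤ × ℕ → Set (Instr ℤ) := fun q =>
    if q.1 = x then (if q.2 < m then t x (q.2 + 1) else Set.univ) else t q.1 q.2 with ht'
  rw [Measure.map_apply (measurable_consInstr x)]
  swap
  · have : {τ : ℤ → ℕ → Instr ℤ | ∀ y ∈ S, ∀ i < m + 1, τ y i ∈ t y i} =
        ⋂ y ∈ S, ⋂ i, ⋂ (_ : i < m + 1), (fun τ => τ y i) ⁻¹' t y i := by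
      ext; simp
    rw [this]
    refine Finset.measurableSet_biInter _ fun y _ => MeasurableSet.iInter fun i =>
      MeasurableSet.iInter fun _ => ?_
    exact (by fun_prop : Measurable fun τ : ℤ → ℕ → Instr ℤ => τ y i) trivial
  have hpre : (fun q : Instr ℤ × (ℤ → ℕ → Instr ℤ) => consInstr x q.1 q.2) ⁻¹'
      {τ | ∀ y ∈ S, ∀ i < m + 1, τ y i ∈ t y i} =
      t x 0 ×ˢ {τ | ∀ q ∈ S ×ˢ Finset.range (m + 1), τ q.1 q.2 ∈ t' q} := by
    ext ⟨ι, τ⟩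
    simp only [Set.mem_preimage, Set.mem_ofPred_eq, Set.mem_prod, Finset.mem_product,
      Finset.mem_range, Prod.forall, ht']
    refine ⟨fun H => ⟨by simpa [consInstr_zero] using H x hx 0 (by omega), ?_⟩, ?_⟩
    · rintro y i ⟨hy, hi⟩
      by_cases hyx : y = x
      · subst hyx
        by_cases him : i < m
        · simpa [him, consInstr_succ] using H y hy (i + 1) (by omega)
        · simp [him]
      · simpa [hyx, consInstr_of_ne hyx] using H y hy i hi
    · rintro ⟨h0, H⟩ y hy i hi
      by_cases hyx : y = x
      · subst hyx
        cases i with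
        | zero => simpa [consInstr_zero] using h0
        | succ i =>
          rw [consInstr_succ]
          simpa [show i < m by omega] using H y i ⟨hy, by omega⟩
      · simpa [hyx, consInstr_of_ne hyx] using H y i ⟨hy, hi⟩
  rw [hpre, Measure.prod_prod, M.measure_box, Finset.prod_product, ← Finset.mul_prod_erase _ _ hx,
    ← Finset.mul_prod_erase _ _ hx, ← mul_assoc]
  congr 1
  · rw [Finset.prod_range_succ, Finset.prod_range_succ' (fun i => instrLaw lam P x (t x i)),
      mul_comm]
    congr 1
    have : instrLaw lam P x (t' (x, m)) = 1 := by simp [ht']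
    rw [this, mul_one]
    exact Finset.prod_congr rfl fun i hi => by simp [ht', Finset.mem_range.1 hi]
  · refine Finset.prod_congr rfl fun y hy => Finset.prod_congr rfl fun i _ => ?_
    simp [ht', Finset.ne_of_mem_erase hy]

/-- Decomposition according to the first instruction at `x`. -/
lemma real_step (M : IsModel lam P Pr) (x : ℤ) (E : Instr ℤ → Set (ℤ → ℕ → Instr ℤ))
    (hE : MeasurableSet {τ | dropInstr x τ ∈ E (τ x 0)}) :
    Pr.real {τ | dropInstr x τ ∈ E (τ x 0)} = lam / (1 + lam) * Pr.real (E .sleep) +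
      (P x (x + 1) / (1 + lam) * Pr.real (E (.jump (x + 1))) +
      P x (x - 1) / (1 + lam) * Pr.real (E (.jump (x - 1)))) := by
  have := M.isProbabilityMeasure_instrLaw
  have := M.isProbabilityMeasure
  have h0 := M.lam_nonneg
  have h1 := M.nonneg x (x + 1)
  have h2 := M.nonneg x (x - 1)
  have hm := measurable_consInstr x hE
  have key : Pr {τ | dropInstr x τ ∈ E (τ x 0)} =
      ENNReal.ofReal (lam / (1 + lam)) * Pr (E .sleep) +
      (ENNReal.ofReal (P x (x + 1) / (1 + lam)) * Pr (E (.jump (x + 1))) +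
      ENNReal.ofReal (P x (x - 1) / (1 + lam)) * Pr (E (.jump (x - 1)))) := by
    conv_lhs => rw [← M.map_consInstr x]
    rw [Measure.map_apply (measurable_consInstr x) hE, Measure.prod_apply hm]
    have : ∀ ι, Prod.mk ι ⁻¹' ((fun q : Instr ℤ × (ℤ → ℕ → Instr ℤ) => consInstr x q.1 q.2) ⁻¹'
        {τ | dropInstr x τ ∈ E (τ x 0)}) = E ι := by
      intro ι
      ext τ
      simp [dropInstr_consInstr, consInstr_zero]
    simp only [this]
    rw [M.instrLaw_eq]
    simp
  rw [measureReal_def, key, ENNReal.toReal_add (by finiteness) (by finiteness),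
    ENNReal.toReal_add (by finiteness) (by finiteness)]
  simp only [ENNReal.toReal_mul, measureReal_def]
  rw [ENNReal.toReal_ofReal (by positivity), ENNReal.toReal_ofReal (by positivity),
    ENNReal.toReal_ofReal (by positivity)]

end IsModel

/-! ## Measurability -/

lemma measurable_applyInstr (x : ℤ) :
    Measurable fun q : Instr ℤ × Config ℤ => applyInstr q.1 x q.2 := by
  refine measurable_from_prod_countable_right fun ι => measurable_pi_iff.2 fun z => ?_
  have hz : Measurable fun c : Config ℤ => c z := measurable_pi_apply z
  cases ι with
  | sleep =>
    simp only [applyInstr_sleep]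
    exact (Measurable.of_discrete (f := fun s : SiteState =>
      if z = x then (if s.particles = 1 then .sleeping else s) else s)).comp hz
  | jump y =>
    simp only [applyInstr_jump]
    exact (Measurable.of_discrete (f := fun s : SiteState =>
      if z = y then (if z = x then s.remove else s).add
        else if z = x then s.remove else s)).comp hz

lemma measurable_topple (x : ℤ) :
    Measurable fun q : (ℤ → ℕ → Instr ℤ) × SWState ℤ => (q.1, topple q.1 x q.2) := by
  have h1 : Measurable fun q : (ℤ → ℕ → Instr ℤ) × SWState ℤ => q.2.2 x :=
    (measurable_pi_apply x).comp (measurable_snd.comp measurable_snd)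
  have h2 : Measurable fun q : (ℤ → ℕ → Instr ℤ) × SWState ℤ => q.1 x (q.2.2 x) := by
    have h3 : Measurable fun p : (ℤ → ℕ → Instr ℤ) × ℕ => p.1 x p.2 :=
      measurable_from_prod_countable_left fun i =>
        (by fun_prop : Measurable fun τ : ℤ → ℕ → Instr ℤ => τ x i)
    exact h3.comp (measurable_fst.prodMk h1)
  refine measurable_fst.prodMk (Measurable.prodMk ?_ (measurable_pi_iff.2 fun z => ?_))
  · exact (measurable_applyInstr x).comp (h2.prodMk (measurable_fst.comp measurable_snd))
  · by_cases h : z = x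
    · subst h
      simpa using h1.add_const 1
    · simp only [Function.update_of_ne h]
      exact (measurable_pi_apply z).comp (measurable_snd.comp measurable_snd)

lemma measurableSet_legalSeq (α : List ℤ) :
    MeasurableSet {q : (ℤ → ℕ → Instr ℤ) × SWState ℤ | LegalSeq q.1 α q.2} := by
  induction α with
  | nil => simp [LegalSeq]
  | cons x α ih =>
    refine MeasurableSet.inter ?_ (measurable_topple x ih)
    have h : Measurable fun q : (ℤ → ℕ → Instr ℤ) × SWState ℤ => q.2.1 x :=
      (measurable_pi_apply x).comp (measurable_fst.comp measurable_snd)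
    exact h (MeasurableSet.of_discrete (s := {s : SiteState | 0 < s.activeCount}))

lemma measurableSet_avoids (V B : Set ℤ) :
    MeasurableSet {q : (ℤ → ℕ → Instr ℤ) × Config ℤ | Avoids q.1 V B q.2} := by
  have h : Measurable fun q : (ℤ → ℕ → Instr ℤ) × Config ℤ => (q.1, init q.2) :=
    measurable_fst.prodMk (measurable_snd.prodMk measurable_const)
  have : {q : (ℤ → ℕ → Instr ℤ) × Config ℤ | Avoids q.1 V B q.2} =
      ⋂ (α : List ℤ) (_ : ∀ y ∈ α, y ∈ V) (_ : ¬ ∀ y ∈ α, y ∉ B),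
        ((fun q : (ℤ → ℕ → Instr ℤ) × Config ℤ => (q.1, init q.2)) ⁻¹'
          {q | LegalSeq q.1 α q.2})ᶜ := by
    ext q
    simp only [Avoids, Set.mem_ofPred_eq, Set.mem_iInter, Set.mem_compl_iff, Set.mem_preimage]
    exact forall_congr' fun α => forall_congr' fun _ => not_imp_not.symm
  rw [this]
  exact MeasurableSet.iInter fun α => MeasurableSet.iInter fun _ => MeasurableSet.iInter fun _ =>
    (h (measurableSet_legalSeq α)).compl

lemma measurableSet_avoids_left (V B : Set ℤ) (c : Config ℤ) :
    MeasurableSet {τ : ℤ → ℕ → Instr ℤ | Avoids τ V B c} :=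
  (measurable_id.prodMk measurable_const) (measurableSet_avoids V B)

lemma measurableSet_confined (V : Set ℤ) (c : Config ℤ) :
    MeasurableSet {τ : ℤ → ℕ → Instr ℤ | Confined τ V c} := by
  have h : Measurable fun τ : ℤ → ℕ → Instr ℤ => (τ, init c) :=
    measurable_id.prodMk measurable_const
  have : {τ : ℤ → ℕ → Instr ℤ | Confined τ V c} =
      ⋂ (α : List ℤ) (_ : ∀ y ∈ α, y ∈ V),
        ((fun τ : ℤ → ℕ → Instr ℤ => (τ, init c)) ⁻¹' {q | LegalSeq q.1 α q.2})ᶜ ∪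
          ⋂ (x : ℤ) (i : ℕ) (_ : i < α.count x) (y : ℤ) (_ : y ∉ V),
            ((fun τ : ℤ → ℕ → Instr ℤ => τ x i) ⁻¹' {.jump y})ᶜ := by
    ext τ
    simp only [Confined, Set.mem_ofPred_eq, Set.mem_iInter, Set.mem_union, Set.mem_compl_iff,
      Set.mem_preimage, Set.mem_singleton_iff, ← imp_iff_not_or]
  rw [this]
  refine MeasurableSet.iInter fun α => MeasurableSet.iInter fun _ =>
    (h (measurableSet_legalSeq α)).compl.union <| MeasurableSet.iInter fun x =>
    MeasurableSet.iInter fun i => MeasurableSet.iInter fun _ => MeasurableSet.iInter fun y =>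
    MeasurableSet.iInter fun _ => ?_
  have hm : Measurable fun τ : ℤ → ℕ → Instr ℤ => τ x i := by fun_prop
  exact (hm (MeasurableSet.singleton _)).compl

lemma measurable_dropInstr (x : ℤ) : Measurable (dropInstr x) := by
  refine measurable_pi_iff.2 fun y => measurable_pi_iff.2 fun i => ?_
  by_cases h : y = x
  · subst h
    simp only [dropInstr_self]; fun_prop
  · simp only [dropInstr_of_ne h]; fun_prop

lemma measurableSet_dropInstr (x : ℤ) {E : Instr ℤ → Set (ℤ → ℕ → Instr ℤ)}
    (hE : ∀ ι, MeasurableSet (E ι)) : MeasurableSet {τ | dropInstr x τ ∈ E (τ x 0)} := by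
  have h : Measurable fun τ : ℤ → ℕ → Instr ℤ => (τ x 0, dropInstr x τ) :=
    (by fun_prop : Measurable fun τ : ℤ → ℕ → Instr ℤ => τ x 0).prodMk (measurable_dropInstr x)
  refine h (t := {q | q.2 ∈ E q.1}) ?_
  have : {q : Instr ℤ × (ℤ → ℕ → Instr ℤ) | q.2 ∈ E q.1} =
      ⋃ ι, (Prod.fst ⁻¹' {ι}) ∩ Prod.snd ⁻¹' E ι := by
    ext q
    simp
  rw [this]
  exact MeasurableSet.iUnion fun ι =>
    (measurable_fst (MeasurableSet.singleton ι)).inter (measurable_snd (hE ι))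

/-! ## One-step inequalities -/

/-- The probability that no site of `B` is toppled when stabilizing `c` in `V`. -/
def avoidProb (Pr : Measure (ℤ → ℕ → Instr ℤ)) (V B : Set ℤ) (c : Config ℤ) : ℝ :=
  Pr.real {τ | Avoids τ V B c}

/-- The probability that no particle leaves `V` when stabilizing `c` in `V`. -/
def confineProb (Pr : Measure (ℤ → ℕ → Instr ℤ)) (V : Set ℤ) (c : Config ℤ) : ℝ :=
  Pr.real {τ | Confined τ V c}

lemma avoidProb_nonneg (Pr : Measure (ℤ → ℕ → Instr ℤ)) (V B : Set ℤ) (c : Config ℤ) :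
    0 ≤ avoidProb Pr V B c := measureReal_nonneg

lemma avoidProb_eq_zero (Pr : Measure (ℤ → ℕ → Instr ℤ)) {V B : Set ℤ} {c : Config ℤ} {x : ℤ}
    (hx : x ∈ V) (hxB : x ∈ B) (hl : 0 < (c x).activeCount) : avoidProb Pr V B c = 0 := by
  simp [avoidProb, not_avoids hx hxB hl]

lemma confineProb_nonneg (Pr : Measure (ℤ → ℕ → Instr ℤ)) (V : Set ℤ) (c : Config ℤ) :
    0 ≤ confineProb Pr V c := measureReal_nonneg

namespace IsModel

variable {lam : ℝ} {P : ℤ → ℤ → ℝ} {Pr : Measure (ℤ → ℕ → Instr ℤ)}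

lemma avoidProb_le_one (M : IsModel lam P Pr) (V B : Set ℤ) (c : Config ℤ) :
    avoidProb Pr V B c ≤ 1 :=
  have := M.isProbabilityMeasure
  measureReal_le_one

lemma confineProb_le_one (M : IsModel lam P Pr) (V : Set ℤ) (c : Config ℤ) :
    confineProb Pr V c ≤ 1 :=
  have := M.isProbabilityMeasure
  measureReal_le_one

lemma avoidProb_of_stable (M : IsModel lam P Pr) {V : Set ℤ} (B : Set ℤ) {c : Config ℤ}
    (hc : ∀ x ∈ V, (c x).activeCount = 0) : avoidProb Pr V B c = 1 := by
  have := M.isProbabilityMeasure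
  simp [avoidProb, avoids_of_stable _ B hc]

lemma confineProb_of_stable (M : IsModel lam P Pr) {V : Set ℤ} {c : Config ℤ}
    (hc : ∀ x ∈ V, (c x).activeCount = 0) : confineProb Pr V c = 1 := by
  have := M.isProbabilityMeasure
  simp [confineProb, confined_of_stable _ hc]

lemma avoidProb_mono (M : IsModel lam P Pr) {V B : Set ℤ} {c c' : Config ℤ}
    (h : ∀ x ∈ V, rank (c x) ≤ rank (c' x)) : avoidProb Pr V B c' ≤ avoidProb Pr V B c :=
  have := M.isProbabilityMeasure
  measureReal_mono fun _ hτ => Avoids.mono h hτ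

lemma avoidProb_congr (M : IsModel lam P Pr) {V B : Set ℤ} {c c' : Config ℤ}
    (h : ∀ x ∈ V, rank (c x) = rank (c' x)) : avoidProb Pr V B c = avoidProb Pr V B c' :=
  le_antisymm (M.avoidProb_mono fun x hx => (h x hx).ge) (M.avoidProb_mono fun x hx => (h x hx).le)

lemma avoidProb_step (M : IsModel lam P Pr) {V B : Set ℤ} {c : Config ℤ} {x : ℤ} (hx : x ∈ V)
    (hxB : x ∉ B) (hl : 0 < (c x).activeCount) :
    avoidProb Pr V B c = lam / (1 + lam) * avoidProb Pr V B (applyInstr .sleep x c) +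
      (P x (x + 1) / (1 + lam) * avoidProb Pr V B (applyInstr (.jump (x + 1)) x c) +
      P x (x - 1) / (1 + lam) * avoidProb Pr V B (applyInstr (.jump (x - 1)) x c)) := by
  have h := M.real_step x (fun ι => {τ | Avoids τ V B (applyInstr ι x c)})
    (measurableSet_dropInstr x fun ι => measurableSet_avoids_left V B (applyInstr ι x c))
  simp only [avoidProb]
  rw [← h]
  congr 1
  ext τ
  exact ⟨fun H => Avoids.step hx hl H, fun H => Avoids.of_step hxB hl H⟩

open Classical in
lemma confineProb_step (M : IsModel lam P Pr) {V : Set ℤ} {c : Config ℤ} {x : ℤ} (hx : x ∈ V)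
    (hl : 0 < (c x).activeCount) :
    confineProb Pr V c = lam / (1 + lam) * confineProb Pr V (applyInstr .sleep x c) +
      (P x (x + 1) / (1 + lam) *
        (if x + 1 ∈ V then confineProb Pr V (applyInstr (.jump (x + 1)) x c) else 0) +
      P x (x - 1) / (1 + lam) *
        (if x - 1 ∈ V then confineProb Pr V (applyInstr (.jump (x - 1)) x c) else 0)) := by
  have h := M.real_step x
    (fun ι => {τ | (∀ y, y ∉ V → ι ≠ .jump y) ∧ Confined τ V (applyInstr ι x c)})
    (measurableSet_dropInstr x fun ι =>
      (MeasurableSet.const (∀ y, y ∉ V → ι ≠ .jump y)).inter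
        (measurableSet_confined V (applyInstr ι x c)))
  have h1 : {τ | Confined τ V c} = {τ | dropInstr x τ ∈
      {τ' | (∀ y, y ∉ V → τ x 0 ≠ .jump y) ∧ Confined τ' V (applyInstr (τ x 0) x c)}} := by
    ext τ
    exact confined_step hx hl
  have h2 : ∀ y, Pr.real {τ | (∀ z, z ∉ V → (Instr.jump y : Instr ℤ) ≠ .jump z) ∧
      Confined τ V (applyInstr (.jump y) x c)} =
      if y ∈ V then confineProb Pr V (applyInstr (.jump y) x c) else 0 := by
    intro y
    split_ifs with hy
    · have : ∀ z, z ∉ V → (Instr.jump y : Instr ℤ) ≠ .jump z := by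
        rintro z hz h
        exact hz (Instr.jump.inj h ▸ hy)
      simp only [confineProb]
      congr 1
      ext τ
      exact and_iff_right this
    · have : ¬ ∀ z, z ∉ V → (Instr.jump y : Instr ℤ) ≠ .jump z := fun H => H y hy rfl
      rw [← measureReal_empty (μ := Pr)]
      congr 1
      ext τ
      exact iff_of_false (fun h => this h.1) (Set.notMem_empty τ)
  rw [confineProb, h1, h, h2, h2]
  simp [confineProb]

end IsModel

lemma enat_tsum_eq_zero_iff {ι : Type*} (f : ι → ℕ∞) : ∑' i, f i = 0 ↔ ∀ i, f i = 0 := by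
  have h : HasSum f (⨆ s : Finset ι, ∑ a ∈ s, f a) :=
    tendsto_atTop_iSup fun _ _ => Finset.sum_le_sum_of_subset
  exact Summable.tsum_eq_zero_iff ⟨_, h⟩

lemma mval_eq_zero_iff {τ : ℤ → ℕ → Instr ℤ} {n : ℕ} {η : ℤ → ℕ}
    (hη : ∀ x, x ∉ Vseg n → η x = 0) :
    Mval τ n η = 0 ↔ Confined τ (Vseg n : Set ℤ) (toCfg η) := by
  classical
  have hcfg : restrictCfg (Vseg n) η = toCfg η := by
    funext x
    by_cases hx : x ∈ Vseg n <;> simp [restrictCfg, toCfg, hx, hη]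
  have hlt : ∀ x (i : ℕ), (i : ℕ∞) < mV τ (Vseg n : Set ℤ) (toCfg η) x ↔
      ∃ α : List ℤ, (∀ y ∈ α, y ∈ (Vseg n : Set ℤ)) ∧ LegalSeq τ α (init (toCfg η)) ∧
        i < α.count x := by
    intro x i
    simp [mV, lt_iSup_iff, seqOdometer, and_assoc]
  have hmem : ∀ {α : List ℤ} {x : ℤ} {i : ℕ}, i < α.count x → x ∈ α := fun h =>
    List.count_pos_iff.1 (Nat.zero_lt_of_lt h)
  simp only [Mval, exitCount, hcfg, enat_tsum_eq_zero_iff, hlt]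
  constructor
  · intro H α hV hα x i hi y hy hτ
    have := H ⟨x, hV x (hmem hi)⟩ i
    rw [if_pos ⟨⟨α, hV, hα, hi⟩, y, hy, hτ⟩] at this
    exact one_ne_zero this
  · rintro H x i
    refine if_neg ?_
    rintro ⟨⟨α, hV, hα, hi⟩, y, hy, hτ⟩
    exact H α hV hα x i hi y hy hτ

/-! ## Reduction of the coupling to finite-volume inequalities -/

open scoped ENNReal in
lemma exists_coupling {X Y : Type*} [MeasurableSpace X] [MeasurableSpace Y] (μ : Measure X)
    (μ' : Measure Y) [IsProbabilityMeasure μ] [IsProbabilityMeasure μ'] {A : Set X} {A' : Set Y}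
    (hA : MeasurableSet A) (hA' : MeasurableSet A') (h : μ' A' ≤ μ A) :
    ∃ κ : Measure (X × Y), IsProbabilityMeasure κ ∧ κ.map Prod.fst = μ ∧ κ.map Prod.snd = μ' ∧
      ∀ᵐ ω ∂κ, ω.2 ∈ A' → ω.1 ∈ A := by
  suffices H : ∃ κ : Measure (X × Y), κ.map Prod.fst = μ ∧ κ.map Prod.snd = μ' ∧
      ∀ᵐ ω ∂κ, ω.2 ∈ A' → ω.1 ∈ A by
    obtain ⟨κ, h1, h2⟩ := H
    refine ⟨κ, ?_, h1, h2⟩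
    have : IsProbabilityMeasure (κ.map Prod.fst) := h1 ▸ inferInstance
    exact Measure.isProbabilityMeasure_of_map Prod.fst
  by_cases h0 : μ' A' = 0
  · refine ⟨μ.prod μ', by simp, by simp, ?_⟩
    have : ∀ᵐ y ∂μ', y ∉ A' := by simpa [ae_iff] using h0
    filter_upwards [Measure.quasiMeasurePreserving_snd.ae this] with ω h1 h2
    exact absurd h2 h1
  by_cases h1 : μ' A' = 1
  · refine ⟨μ.prod μ', by simp, by simp, ?_⟩
    have h2 : μ A = 1 := le_antisymm prob_le_one (h1 ▸ h)
    have : ∀ᵐ x ∂μ, x ∈ A := (mem_ae_iff_prob_eq_one hA).2 h2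
    filter_upwards [Measure.quasiMeasurePreserving_fst.ae this] with ω h1 _
    exact h1
  set a := μ A with ha
  set a' := μ' A' with ha'
  have hatop : a ≠ ∞ := measure_ne_top μ A
  have hatop' : a' ≠ ∞ := measure_ne_top μ' A'
  have hapos : a ≠ 0 := fun h2 => h0 (le_antisymm (h2 ▸ h) bot_le)
  have hlt : a' < 1 := lt_of_le_of_ne prob_le_one h1
  have hsub : (1 : ℝ≥0∞) - a' ≠ 0 := (tsub_pos_of_lt hlt).ne'
  have hsubtop : (1 : ℝ≥0∞) - a' ≠ ∞ := ENNReal.sub_ne_top ENNReal.one_ne_top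
  set c := a⁻¹ * a' with hc
  have hc1 : c ≤ 1 := by
    rw [hc, ← ENNReal.inv_mul_cancel hapos hatop]
    gcongr
  have hca : c * a = a' := by
    rw [hc, mul_right_comm, ENNReal.inv_mul_cancel hapos hatop, one_mul]
  set ρ := μ.restrict Aᶜ + (1 - c) • μ.restrict A with hρ
  have hρm : ρ Set.univ = 1 - a' := by
    have h3 : a' + ρ Set.univ = 1 := by
      rw [hρ]
      simp only [Measure.coe_add, Pi.add_apply, Measure.smul_apply, Measure.restrict_apply_univ,
        smul_eq_mul, ← ha]
      rw [add_left_comm, ← hca, ← add_mul, add_tsub_cancel_of_le hc1, one_mul, add_comm]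
      exact prob_add_prob_compl hA
    exact (ENNReal.sub_eq_of_eq_add hatop' (by rw [← h3, add_comm])).symm
  have : IsFiniteMeasure ρ := ⟨hρm ▸ hsubtop.lt_top⟩
  refine ⟨a⁻¹ • (μ.restrict A).prod (μ'.restrict A') +
    (1 - a')⁻¹ • ρ.prod (μ'.restrict A'ᶜ), ?_, ?_, ?_⟩
  · rw [Measure.map_add _ _ measurable_fst, Measure.map_smul, Measure.map_smul,
      Measure.map_fst_prod, Measure.map_fst_prod, Measure.restrict_apply_univ,
      Measure.restrict_apply_univ, prob_compl_eq_one_sub hA', ← ha', smul_smul, smul_smul,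
      ENNReal.inv_mul_cancel hsub hsubtop, one_smul, ← hc, hρ, add_left_comm, ← add_smul,
      add_tsub_cancel_of_le hc1, one_smul, add_comm]
    exact Measure.restrict_add_restrict_compl hA
  · rw [Measure.map_add _ _ measurable_snd, Measure.map_smul, Measure.map_smul,
      Measure.map_snd_prod, Measure.map_snd_prod, Measure.restrict_apply_univ, hρm, ← ha,
      smul_smul, smul_smul, ENNReal.inv_mul_cancel hsub hsubtop,
      ENNReal.inv_mul_cancel hapos hatop, one_smul, one_smul]
    exact Measure.restrict_add_restrict_compl hA'
  · rw [ae_add_measure_iff]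
    constructor
    · refine Measure.ae_smul_measure ?_ _
      have : ∀ᵐ x ∂μ.restrict A, x ∈ A := ae_restrict_mem hA
      filter_upwards [Measure.quasiMeasurePreserving_fst.ae this] with ω h1 _
      exact h1
    · refine Measure.ae_smul_measure ?_ _
      have : ∀ᵐ y ∂μ'.restrict A'ᶜ, y ∈ A'ᶜ := ae_restrict_mem hA'.compl
      filter_upwards [Measure.quasiMeasurePreserving_snd.ae this] with ω h1 h2
      exact absurd h2 h1

lemma measurable_toCfg : Measurable (toCfg : (ℤ → ℕ) → Config ℤ) :=
  measurable_pi_iff.2 fun x =>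
    (Measurable.of_discrete (f := SiteState.act)).comp (measurable_pi_apply x)

lemma measurable_phiEta (n : ℕ) (η : ℤ → ℕ) : Measurable (phiEta n η) :=
  measurable_pi_iff.2 fun x =>
    (Measurable.of_discrete (f := fun k : ℕ => k * η (x - blockIdx n x * n))).comp
      (measurable_pi_apply (blockIdx n x))

lemma measurableSet_avoids_toCfg (V B : Set ℤ) :
    MeasurableSet {q : (ℤ → ℕ) × (ℤ → ℕ → Instr ℤ) | Avoids q.2 V B (toCfg q.1)} :=
  (measurable_snd.prodMk (measurable_toCfg.comp measurable_fst)) (measurableSet_avoids V B)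

lemma forall_mTot_eq_zero_iff {τ : ℤ → ℕ → Instr ℤ} {c : Config ℤ} {B : Set ℤ} :
    (∀ x ∈ B, mTot τ c x = 0) ↔ Avoids τ Set.univ B c := by
  simp only [mTot_eq_zero_iff, Avoids, Set.mem_univ, implies_true, forall_const]
  exact ⟨fun H α hα y hy hyB => H y hyB α hα hy, fun H x hx α hα hxα => H α hα x hxα hx⟩

lemma Avoids.anti {τ : ℤ → ℕ → Instr ℤ} {V W B : Set ℤ} {c : Config ℤ} (hVW : V ⊆ W)
    (h : Avoids τ W B c) : Avoids τ V B c :=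
  fun α hα => h α fun y hy => hVW (hα y hy)

lemma avoids_univ_iff {τ : ℤ → ℕ → Instr ℤ} {V : ℕ → Set ℤ} {B : Set ℤ} {c : Config ℤ}
    (hV : Monotone V) (hU : ⋃ N, V N = Set.univ) :
    Avoids τ Set.univ B c ↔ ∀ N, Avoids τ (V N) B c := by
  refine ⟨fun h N => h.anti (Set.subset_univ _), fun h α _ hα => ?_⟩
  have : ∃ N, ∀ y ∈ α, y ∈ V N := by
    clear hα
    induction α with
    | nil => exact ⟨0, by simp⟩
    | cons x α ih =>
      obtain ⟨N, hN⟩ := ih fun y hy => Set.mem_univ y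
      obtain ⟨M, hM⟩ := Set.mem_iUnion.1 (hU ▸ Set.mem_univ x : x ∈ ⋃ N, V N)
      refine ⟨max N M, fun y hy => ?_⟩
      rcases List.mem_cons.1 hy with rfl | hy
      · exact hV (le_max_right N M) hM
      · exact hV (le_max_left N M) (hN y hy)
  obtain ⟨N, hN⟩ := this
  exact h N α hN hα

/-- The union of the blocks with index in `[-N, N]`. -/
def blockRegion (n N : ℕ) : Set ℤ := {x | |blockIdx n x| ≤ N}

/-- The sites `[-N, N]` of the coarse-grained model. -/
def coarseRegion (N : ℕ) : Set ℤ := {k | |k| ≤ N}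

lemma exists_coupling_of_avoidProb_le {Pr Pr' : Measure (ℤ → ℕ → Instr ℤ)}
    [IsProbabilityMeasure Pr] [IsProbabilityMeasure Pr'] (n : ℕ) (η : ℤ → ℕ)
    (ν : Measure (ℤ → ℕ)) [IsProbabilityMeasure ν]
    (h : ∀ (N : ℕ) (ξ : ℤ → ℕ), avoidProb Pr' (coarseRegion N) {0} (toCfg ξ) ≤
      avoidProb Pr (blockRegion n N) (Vseg n : Set ℤ) (toCfg (phiEta n η ξ))) :
    ∃ κ : Measure (((ℤ → ℕ) × (ℤ → ℕ → Instr ℤ)) × ((ℤ → ℕ) × (ℤ → ℕ → Instr ℤ))),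
      IsProbabilityMeasure κ ∧
      κ.map Prod.fst = (ν.map (phiEta n η)).prod Pr ∧
      κ.map Prod.snd = ν.prod Pr' ∧
      ∀ᵐ ω ∂κ, mTot ω.2.2 (toCfg ω.2.1) 0 = 0 →
        ∀ x ∈ Vseg n, mTot ω.1.2 (toCfg ω.1.1) x = 0 := by
  have hφ := measurable_phiEta n η
  have : IsProbabilityMeasure (ν.map (phiEta n η)) :=
    Measure.isProbabilityMeasure_map hφ.aemeasurable
  suffices hle : (ν.prod Pr') {q | Avoids q.2 Set.univ {0} (toCfg q.1)} ≤
      ((ν.map (phiEta n η)).prod Pr)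
        {q | Avoids q.2 Set.univ (Vseg n : Set ℤ) (toCfg q.1)} by
    obtain ⟨κ, h1, h2, h3, h4⟩ := exists_coupling _ _
      (measurableSet_avoids_toCfg Set.univ (Vseg n : Set ℤ))
      (measurableSet_avoids_toCfg Set.univ {0}) hle
    refine ⟨κ, h1, h2, h3, ?_⟩
    filter_upwards [h4] with ω hω h0
    exact forall_mTot_eq_zero_iff.2 (hω (forall_mTot_eq_zero_iff.1 (by simpa using h0)))
  have hmono : Monotone (blockRegion n) := fun N M hNM x hx =>
    show |blockIdx n x| ≤ (M : ℤ) from le_trans hx (Int.ofNat_le.2 hNM)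
  have hU : ⋃ N, blockRegion n N = Set.univ := by
    refine Set.eq_univ_of_forall fun x => Set.mem_iUnion.2 ⟨(blockIdx n x).natAbs, ?_⟩
    simp [blockRegion]
  have hint : {q : (ℤ → ℕ) × (ℤ → ℕ → Instr ℤ) |
      Avoids q.2 Set.univ (Vseg n : Set ℤ) (toCfg q.1)} =
      ⋂ N, {q | Avoids q.2 (blockRegion n N) (Vseg n : Set ℤ) (toCfg q.1)} := by
    ext q
    simp only [Set.mem_iInter, Set.mem_ofPred_eq]
    exact avoids_univ_iff hmono hU
  have hanti : Antitone fun N => {q : (ℤ → ℕ) × (ℤ → ℕ → Instr ℤ) |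
      Avoids q.2 (blockRegion n N) (Vseg n : Set ℤ) (toCfg q.1)} :=
    fun N M hNM q hq => Avoids.anti (hmono hNM) hq
  rw [hint, hanti.measure_iInter
    (fun N => (measurableSet_avoids_toCfg _ _).nullMeasurableSet) ⟨0, measure_ne_top _ _⟩]
  refine le_iInf fun N => ?_
  calc _ ≤ (ν.prod Pr') {q | Avoids q.2 (coarseRegion N) {0} (toCfg q.1)} :=
        measure_mono fun q hq => Avoids.anti (Set.subset_univ _) hq
    _ ≤ _ := by
      rw [Measure.prod_apply (measurableSet_avoids_toCfg _ _),
        Measure.prod_apply (measurableSet_avoids_toCfg _ _),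
        lintegral_map (measurable_measure_prodMk_left (measurableSet_avoids_toCfg _ _)) hφ]
      refine lintegral_mono fun ξ => ?_
      exact (ENNReal.toReal_le_toReal (measure_ne_top _ _) (measure_ne_top _ _)).1 (h N ξ)

/-! ## Configurations given by sleeping and active particles -/

/-- The state of a site holding `a` active particles, on top of a sleeping particle when `b = 1`
(which is then woken up if `a ≠ 0`). -/
def mix (b a : ℕ) : SiteState :=
  if a = 0 then (if b = 0 then .act 0 else .sleeping) else .act (a + b)

lemma rank_mix {b : ℕ} (hb : b ≤ 1) (a : ℕ) :
    rank (mix b a) = if a = 0 then b else a + b + 1 := by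
  obtain rfl | rfl : b = 0 ∨ b = 1 := by omega
  all_goals
    unfold mix
    rcases a with _ | a <;> simp [rank]

lemma mix_zero (a : ℕ) : mix 0 a = .act a := by
  unfold mix
  split_ifs <;> simp_all

lemma mix_add {b : ℕ} (hb : b ≤ 1) (a : ℕ) : (mix b a).add = mix b (a + 1) := by
  unfold mix SiteState.add SiteState.particles
  split_ifs <;> simp_all <;> omega

/-- The configuration with a sleeping particle at each site of `S` and an active particle at
each element of `c`, sleeping particles being woken up when they meet active ones. -/
def mixCfg (S : Finset ℤ) (c : Multiset ℤ) : Config ℤ :=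
  fun x => mix (if x ∈ S then 1 else 0) (c.count x)

lemma mixCfg_of_notMem {S : Finset ℤ} {x : ℤ} (hx : x ∉ S) (c : Multiset ℤ) :
    mixCfg S c x = .act (c.count x) := by
  simp [mixCfg, hx, mix_zero]

lemma rank_mixCfg (S : Finset ℤ) (c : Multiset ℤ) (x : ℤ) : rank (mixCfg S c x) =
    if c.count x = 0 then (if x ∈ S then 1 else 0) else c.count x + (if x ∈ S then 1 else 0) + 1 :=
  rank_mix (by split_ifs <;> simp) _

lemma mixCfg_jump {S : Finset ℤ} {x y : ℤ} (hx : x ∉ S) (hxy : y ≠ x) (c : Multiset ℤ) :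
    applyInstr (.jump y) x (mixCfg S (x ::ₘ c)) = mixCfg S (y ::ₘ c) := by
  funext z
  rw [applyInstr_jump]
  by_cases hzy : z = y
  · subst hzy
    rw [if_pos rfl, if_neg hxy, mixCfg, mixCfg, Multiset.count_cons_of_ne hxy,
      Multiset.count_cons_self, mix_add (by split_ifs <;> simp)]
  · rw [if_neg hzy]
    by_cases hzx : z = x
    · subst hzx
      rw [if_pos rfl, mixCfg_of_notMem hx, mixCfg_of_notMem hx, Multiset.count_cons_self,
        Multiset.count_cons_of_ne hzy]
      simp [SiteState.remove]
    · rw [if_neg hzx, mixCfg, mixCfg, Multiset.count_cons_of_ne hzx, Multiset.count_cons_of_ne hzy]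

lemma mixCfg_sleep {S : Finset ℤ} {x : ℤ} (hx : x ∉ S) {c : Multiset ℤ} (hc : c.count x = 0) :
    applyInstr .sleep x (mixCfg S (x ::ₘ c)) = mixCfg (insert x S) c := by
  funext z
  rw [applyInstr_sleep]
  by_cases hzx : z = x
  · subst hzx
    rw [if_pos rfl, mixCfg_of_notMem hx, Multiset.count_cons_self, hc]
    simp [SiteState.particles, mixCfg, hc, mix]
  · rw [if_neg hzx, mixCfg, mixCfg, Multiset.count_cons_of_ne hzx]
    simp [hzx]

lemma mixCfg_sleep_of_pos {S : Finset ℤ} {x : ℤ} (hx : x ∉ S) {c : Multiset ℤ}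
    (hc : c.count x ≠ 0) :
    applyInstr .sleep x (mixCfg S (x ::ₘ c)) = mixCfg S (x ::ₘ c) := by
  funext z
  rw [applyInstr_sleep]
  split_ifs with hzx h
  · subst hzx
    rw [mixCfg_of_notMem hx, Multiset.count_cons_self] at h
    simp only [SiteState.particles] at h
    omega
  · rfl
  · rfl

lemma rank_mixCfg_insert_le (S : Finset ℤ) (x : ℤ) (c : Multiset ℤ) (z : ℤ) :
    rank (mixCfg (insert x S) c z) ≤ rank (mixCfg S (x ::ₘ c) z) := by
  rw [rank_mixCfg, rank_mixCfg, Multiset.count_cons]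
  by_cases hzx : z = x
  · subst hzx
    by_cases hc : c.count z = 0 <;> by_cases hS : z ∈ S <;> simp [hc, hS]
  · simp [hzx]

lemma rank_mixCfg_le_cons (S : Finset ℤ) (x : ℤ) (c : Multiset ℤ) (z : ℤ) :
    rank (mixCfg S c z) ≤ rank (mixCfg S (x ::ₘ c) z) := by
  rw [rank_mixCfg, rank_mixCfg, Multiset.count_cons]
  by_cases hzx : z = x
  · subst hzx
    by_cases hc : c.count z = 0 <;> by_cases hS : z ∈ S <;> simp [hc, hS]
  · simp [hzx]

namespace IsModel

variable {lam : ℝ} {P : ℤ → ℤ → ℝ} {Pr : Measure (ℤ → ℕ → Instr ℤ)}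

lemma avoidProb_cons_le (M : IsModel lam P Pr) (V B : Set ℤ) (S : Finset ℤ) (x : ℤ)
    (c : Multiset ℤ) : avoidProb Pr V B (mixCfg S (x ::ₘ c)) ≤ avoidProb Pr V B (mixCfg S c) :=
  M.avoidProb_mono fun z _ => rank_mixCfg_le_cons S x c z

lemma avoidProb_cons_of_notMem (M : IsModel lam P Pr) {V : Set ℤ} (B : Set ℤ) (S : Finset ℤ)
    {x : ℤ} (hx : x ∉ V) (c : Multiset ℤ) :
    avoidProb Pr V B (mixCfg S (x ::ₘ c)) = avoidProb Pr V B (mixCfg S c) :=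
  M.avoidProb_congr fun z hz => by
    rw [mixCfg, mixCfg, Multiset.count_cons_of_ne (by rintro rfl; exact hx hz)]

lemma avoidProb_cons_le_insert (M : IsModel lam P Pr) (V B : Set ℤ) (S : Finset ℤ) (x : ℤ)
    (c : Multiset ℤ) :
    avoidProb Pr V B (mixCfg S (x ::ₘ c)) ≤ avoidProb Pr V B (mixCfg (insert x S) c) :=
  M.avoidProb_mono fun z _ => rank_mixCfg_insert_le S x c z

lemma avoidProb_add_le_union (M : IsModel lam P Pr) (V B : Set ℤ) (S T : Finset ℤ)
    (c : Multiset ℤ) :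
    avoidProb Pr V B (mixCfg S (c + T.val)) ≤ avoidProb Pr V B (mixCfg (S ∪ T) c) := by
  induction T using Finset.induction_on generalizing S with
  | empty => simp
  | insert x T hx ih =>
    rw [Finset.insert_val_of_notMem hx, Multiset.add_cons, Finset.union_insert,
      ← Finset.insert_union]
    exact (M.avoidProb_cons_le_insert V B S x (c + T.val)).trans (ih (insert x S))

lemma avoidProb_cons_step (M : IsModel lam P Pr) {V B : Set ℤ} {S : Finset ℤ} {x : ℤ} (hx : x ∈ V)
    (hxB : x ∉ B) (hxS : x ∉ S) (c : Multiset ℤ) {ε : ℤ} (hε : ε = 1 ∨ ε = -1) :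
    avoidProb Pr V B (mixCfg S (x ::ₘ c)) =
      lam / (1 + lam) * (if c.count x = 0 then avoidProb Pr V B (mixCfg (insert x S) c)
        else avoidProb Pr V B (mixCfg S (x ::ₘ c))) +
      (P x (x + ε) / (1 + lam) * avoidProb Pr V B (mixCfg S ((x + ε) ::ₘ c)) +
      P x (x - ε) / (1 + lam) * avoidProb Pr V B (mixCfg S ((x - ε) ::ₘ c))) := by
  have h := M.avoidProb_step (c := mixCfg S (x ::ₘ c)) hx hxB
    (by simp [mixCfg_of_notMem hxS, SiteState.activeCount])
  rw [mixCfg_jump hxS (by omega), mixCfg_jump hxS (by omega)] at h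
  have hs : avoidProb Pr V B (applyInstr .sleep x (mixCfg S (x ::ₘ c))) =
      if c.count x = 0 then avoidProb Pr V B (mixCfg (insert x S) c)
        else avoidProb Pr V B (mixCfg S (x ::ₘ c)) := by
    split_ifs with hc
    · rw [mixCfg_sleep hxS hc]
    · rw [mixCfg_sleep_of_pos hxS hc]
  rw [hs] at h
  refine h.trans ?_
  rcases hε with rfl | rfl
  · rfl
  · rw [← sub_eq_add_neg, sub_neg_eq_add]
    ring

lemma sum_neighbours_sign (M : IsModel lam P Pr) (x : ℤ) {ε : ℤ} (hε : ε = 1 ∨ ε = -1) :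
    P x (x + ε) + P x (x - ε) = 1 := by
  have h := M.sum_neighbours x
  rcases hε with rfl | rfl
  · exact h
  · rw [← sub_eq_add_neg, sub_neg_eq_add, add_comm]
    exact h

lemma avoidProb_superharmonic (M : IsModel lam P Pr) {V B : Set ℤ} {S : Finset ℤ} {x : ℤ}
    (hxB : x ∉ B) (hxS : x ∉ S) (c : Multiset ℤ) {ε : ℤ} (hε : ε = 1 ∨ ε = -1) :
    P x (x + ε) * avoidProb Pr V B (mixCfg S ((x + ε) ::ₘ c)) +
      P x (x - ε) * avoidProb Pr V B (mixCfg S ((x - ε) ::ₘ c)) ≤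
      avoidProb Pr V B (mixCfg S (x ::ₘ c)) := by
  have hsum := M.sum_neighbours_sign x hε
  by_cases hx : x ∈ V
  · have h := M.avoidProb_cons_step hx hxB hxS c hε
    set g := avoidProb Pr V B (mixCfg S (x ::ₘ c)) with hg
    set s := if c.count x = 0 then avoidProb Pr V B (mixCfg (insert x S) c) else g with hs
    have hle : g ≤ s := by
      rw [hs]
      split_ifs
      · exact M.avoidProb_cons_le_insert V B S x c
      · exact le_rfl
    have hlam := M.lam_nonneg
    have hpos : 0 < 1 + lam := by linarith
    field_simp at h
    nlinarith
  · rw [M.avoidProb_cons_of_notMem B S hx]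
    have h1 := M.avoidProb_cons_le V B S (x + ε) c
    have h2 := M.avoidProb_cons_le V B S (x - ε) c
    calc _ ≤ P x (x + ε) * avoidProb Pr V B (mixCfg S c) +
          P x (x - ε) * avoidProb Pr V B (mixCfg S c) :=
        add_le_add (mul_le_mul_of_nonneg_left h1 (M.nonneg _ _))
          (mul_le_mul_of_nonneg_left h2 (M.nonneg _ _))
      _ = _ := by rw [← add_mul, hsum, one_mul]

end IsModel

/-- A one-dimensional minimum principle. -/
lemma le_of_superharmonic {h : ℕ → ℝ} {q q' : ℝ} (hq : 0 ≤ q) (hq' : 0 ≤ q') (hqq : q + q' = 1)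
    (hs : ∀ j, q * h (j + 2) + q' * h j ≤ h (j + 1)) {R : ℕ} (hR : ∀ j, R ≤ j → h 0 ≤ h j)
    (j : ℕ) : h 0 ≤ h j := by
  classical
  by_contra! hj
  have hex : ∃ j, h j < h 0 := ⟨j, hj⟩
  obtain ⟨m, hm⟩ : ∃ m, Nat.find hex = m + 1 := by
    refine Nat.exists_eq_succ_of_ne_zero fun h0 => ?_
    have := Nat.find_spec hex
    rw [h0] at this
    exact lt_irrefl _ this
  have h1 : h (m + 1) < h 0 := hm ▸ Nat.find_spec hex
  have h2 : h 0 ≤ h m := not_lt.1 (Nat.find_min hex (by omega))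
  rcases hq.eq_or_lt with h3 | h3
  · have := hs m
    have hq1 : q' = 1 := by linarith
    rw [← h3, hq1] at this
    linarith
  have key : ∀ i, h (m + i + 1) < h 0 ∧ h (m + i + 1) ≤ h (m + i) := by
    intro i
    induction i with
    | zero => exact ⟨h1, h1.le.trans h2⟩
    | succ i ih =>
      suffices h (m + i + 2) ≤ h (m + i + 1) from ⟨this.trans_lt ih.1, this⟩
      have h4 := hs (m + i)
      have h5 := mul_le_mul_of_nonneg_left ih.2 hq'
      have h6 : q * h (m + i + 2) ≤ q * h (m + i + 1) := by
        rw [← eq_sub_iff_add_eq] at hqq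
        rw [hqq] at h4 ⊢
        linarith
      exact le_of_mul_le_mul_left h6 h3
  exact absurd (hR (m + R + 1) (by omega)) (not_le.2 (key R).1)

/-! ## Moving particles away from the origin -/

namespace IsModel

variable {lam : ℝ} {P : ℤ → ℤ → ℝ} {Pr : Measure (ℤ → ℕ → Instr ℤ)}

lemma avoidProb_carry (M : IsModel lam P Pr) (hti : ∀ x y z : ℤ, P (x + z) (y + z) = P x y)
    {V B : Set ℤ} {ε : ℤ} (hε : ε = 1 ∨ ε = -1) {R : ℤ} (hV : ∀ x ∈ V, |x| ≤ R) {S : Finset ℤ}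
    {x y : ℤ} (hy : ∀ z, ε * y < ε * z → z ∉ B ∧ z ∉ S) (hxy : ε * y ≤ ε * x) (c : Multiset ℤ) :
    avoidProb Pr V B (mixCfg S (y ::ₘ c)) ≤ avoidProb Pr V B (mixCfg S (x ::ₘ c)) := by
  have hεε : ε * ε = 1 := by rcases hε with rfl | rfl <;> rfl
  obtain ⟨j, hj⟩ : ∃ j : ℕ, x = y + ε * j := by
    refine ⟨(ε * (x - y)).toNat, ?_⟩
    rw [Int.toNat_of_nonneg (by linarith), ← mul_assoc, hεε]
    ring
  have hq : ∀ z, P z (z + ε) = P 0 ε := fun z => by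
    have := hti 0 ε z
    rwa [zero_add, add_comm] at this
  have hq' : ∀ z, P z (z - ε) = P 0 (-ε) := fun z => by
    have := hti 0 (-ε) z
    rwa [zero_add, neg_add_eq_sub] at this
  have key := le_of_superharmonic
    (h := fun j : ℕ => avoidProb Pr V B (mixCfg S ((y + ε * j) ::ₘ c)))
    (M.nonneg 0 ε) (M.nonneg 0 (-ε)) (R := (R + |y| + 1).toNat) (by
      have := M.sum_neighbours_sign 0 hε
      rwa [zero_add, zero_sub] at this) ?_ ?_ j
  · subst hj
    simpa using key
  · intro j
    have hlt : ε * y < ε * (y + ε * (j + 1 : ℕ)) := by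
      rw [mul_add, ← mul_assoc, hεε]
      push_cast
      linarith
    have := M.avoidProb_superharmonic (V := V) (hy _ hlt).1 (hy _ hlt).2 c hε
    rw [hq, hq'] at this
    convert this using 6 <;> push_cast <;> ring
  · intro j hj
    have hnot : y + ε * (j : ℤ) ∉ V := by
      intro h
      have h1 := hV _ h
      have h2 : |ε * (j : ℤ)| = j := by
        rcases hε with rfl | rfl <;> simp
      have h3 := abs_sub_abs_le_abs_sub (ε * (j : ℤ)) (-y)
      rw [sub_neg_eq_add, abs_neg, h2, add_comm (ε * (j : ℤ))] at h3
      omega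
    simp only [M.avoidProb_cons_of_notMem B S hnot]
    exact M.avoidProb_cons_le _ _ _ _ _

lemma avoidProb_carry_multiset (M : IsModel lam P Pr)
    (hti : ∀ x y z : ℤ, P (x + z) (y + z) = P x y)
    {V B : Set ℤ} {ε : ℤ} (hε : ε = 1 ∨ ε = -1) {R : ℤ} (hV : ∀ x ∈ V, |x| ≤ R) {S : Finset ℤ}
    {X Y : Multiset ℤ} (hcard : X.card = Y.card)
    (hY : ∀ y ∈ Y, ∀ z, ε * y < ε * z → z ∉ B ∧ z ∉ S)
    (hXY : ∀ x ∈ X, ∀ y ∈ Y, ε * y ≤ ε * x) (c : Multiset ℤ) :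
    avoidProb Pr V B (mixCfg S (c + Y)) ≤ avoidProb Pr V B (mixCfg S (c + X)) := by
  induction Y using Multiset.induction_on generalizing X c with
  | empty =>
    rw [Multiset.card_zero, Multiset.card_eq_zero] at hcard
    rw [hcard]
  | cons y Y ih =>
    rw [Multiset.card_cons] at hcard
    obtain ⟨x, X, rfl⟩ : ∃ x X', X = x ::ₘ X' := by
      obtain ⟨x, hx⟩ := Multiset.card_pos_iff_exists_mem.1 (by omega : 0 < X.card)
      exact ⟨x, Multiset.exists_cons_of_mem hx⟩
    rw [Multiset.add_cons, Multiset.add_cons]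
    refine (M.avoidProb_carry hti hε hV (hY y (Multiset.mem_cons_self _ _))
      (hXY x (Multiset.mem_cons_self _ _) y (Multiset.mem_cons_self _ _)) (c + Y)).trans ?_
    rw [← Multiset.cons_add, ← Multiset.cons_add]
    exact ih (by simpa using hcard) (fun z hz => hY z (Multiset.mem_cons_of_mem hz))
      (fun z hz w hw => hXY z (Multiset.mem_cons_of_mem hz) w (Multiset.mem_cons_of_mem hw)) _

/-! ## The coarse-grained model -/

lemma avoidProb_directed (M : IsModel lam P Pr) {V B : Set ℤ} {S : Finset ℤ} {x : ℤ} (hx : x ∈ V)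
    (hxB : x ∉ B) (hxS : x ∉ S) (c : Multiset ℤ) {ε : ℤ} (hε : ε = 1 ∨ ε = -1)
    (hP : P x (x - ε) = 1) :
    avoidProb Pr V B (mixCfg S (x ::ₘ c)) =
      lam / (1 + lam) * (if c.count x = 0 then avoidProb Pr V B (mixCfg (insert x S) c)
        else avoidProb Pr V B (mixCfg S (x ::ₘ c))) +
      (1 - lam / (1 + lam)) * avoidProb Pr V B (mixCfg S ((x - ε) ::ₘ c)) := by
  have h := M.avoidProb_cons_step hx hxB hxS c hε
  have h0 : P x (x + ε) = 0 := by
    have := M.sum_neighbours_sign x hε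
    linarith
  have h1 : 1 / (1 + lam) = 1 - lam / (1 + lam) := by
    have := M.lam_nonneg
    field_simp
    ring
  rwa [h0, hP, zero_div, zero_mul, zero_add, h1] at h

lemma avoidProb_directed_of_mem (M : IsModel lam P Pr) {V B : Set ℤ} {S : Finset ℤ} {x : ℤ}
    (hx : x ∈ V) (hxB : x ∉ B) (hxS : x ∉ S) {c : Multiset ℤ} (hc : x ∈ c) {ε : ℤ}
    (hε : ε = 1 ∨ ε = -1) (hP : P x (x - ε) = 1) :
    avoidProb Pr V B (mixCfg S (x ::ₘ c)) = avoidProb Pr V B (mixCfg S ((x - ε) ::ₘ c)) := by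
  have h := M.avoidProb_directed hx hxB hxS c hε hP
  rw [if_neg (by simpa [Multiset.count_eq_zero] using hc)] at h
  have hlt : lam / (1 + lam) < 1 := by
    have := M.lam_nonneg
    rw [div_lt_one (by linarith)]
    linarith
  have : (1 - lam / (1 + lam)) * (avoidProb Pr V B (mixCfg S (x ::ₘ c)) -
      avoidProb Pr V B (mixCfg S ((x - ε) ::ₘ c))) = 0 := by linarith
  rcases mul_eq_zero.1 this with h1 | h1 <;> linarith

end IsModel

lemma mixCfg_erase {S : Finset ℤ} {x : ℤ} (hx : x ∈ S) {c : Multiset ℤ} (hc : x ∈ c) :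
    mixCfg S c = mixCfg (S.erase x) (x ::ₘ c) := by
  funext z
  rw [mixCfg, mixCfg]
  by_cases hzx : z = x
  · subst hzx
    have : c.count z ≠ 0 := by simpa [Multiset.count_eq_zero] using hc
    simp [hx, mix, this]
  · simp [hzx]

/-! ## Stabilizing a single block -/

lemma particles_sleep (x : ℤ) (u : Config ℤ) (z : ℤ) :
    (applyInstr .sleep x u z).particles = (u z).particles := by
  rw [applyInstr_sleep]
  split_ifs with h1 h2
  · rw [h2, SiteState.particles]
  · rfl
  · rfl

lemma particles_remove {s : SiteState} (hs : 0 < s.activeCount) :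
    s.remove.particles + 1 = s.particles := by
  cases s with
  | sleeping => simp [SiteState.activeCount] at hs
  | act k =>
    simp only [SiteState.activeCount] at hs
    simp only [SiteState.remove, SiteState.particles]
    omega

lemma particles_jump {x y : ℤ} (hxy : y ≠ x) {u : Config ℤ} (hl : 0 < (u x).activeCount) (z : ℤ) :
    (applyInstr (.jump y) x u z).particles + (if z = x then 1 else 0) =
      (u z).particles + (if z = y then 1 else 0) := by
  rw [applyInstr_jump]
  by_cases hzy : z = y
  · subst hzy
    simp [hxy, SiteState.add, SiteState.particles]
  · by_cases hzx : z = x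
    · subst hzx
      simpa [hzy] using particles_remove hl
    · simp [hzy, hzx]

lemma sum_particles_jump {W : Finset ℤ} {x y : ℤ} (hx : x ∈ W) (hy : y ∈ W) (hxy : y ≠ x)
    {u : Config ℤ} (hl : 0 < (u x).activeCount) (f : ℤ → ℕ) :
    ∑ z ∈ W, (applyInstr (.jump y) x u z).particles * f z + f x =
      ∑ z ∈ W, (u z).particles * f z + f y := by
  have h : ∀ a : ℤ, a ∈ W → ∑ z ∈ W, (if z = a then 1 else 0) * f z = f a := fun a ha => by
    simp [ha]
  rw [← h x hx, ← h y hy, ← Finset.sum_add_distrib, ← Finset.sum_add_distrib]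
  exact Finset.sum_congr rfl fun z _ => by rw [← add_mul, ← add_mul, particles_jump hxy hl]

/-- The configuration equal to `s` outside `W + t` and to the translate of `u` inside. -/
def overlay (W : Finset ℤ) (t : ℤ) (s u : Config ℤ) : Config ℤ :=
  fun z => if z - t ∈ W then u (z - t) else s z

lemma overlay_sleep {W : Finset ℤ} (t : ℤ) (s u : Config ℤ) {x : ℤ} (hx : x ∈ W) :
    applyInstr .sleep (x + t) (overlay W t s u) = overlay W t s (applyInstr .sleep x u) := by
  funext z
  by_cases hz : z - t ∈ W
  · simp only [applyInstr_sleep, overlay, if_pos hz, ← sub_eq_iff_eq_add]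
  · have : z ≠ x + t := by rintro rfl; simp [hx] at hz
    simp only [applyInstr_sleep, overlay, if_neg hz, if_neg this]

lemma overlay_jump {W : Finset ℤ} (t : ℤ) (s u : Config ℤ) {x y : ℤ} (hx : x ∈ W) (hy : y ∈ W) :
    applyInstr (.jump (y + t)) (x + t) (overlay W t s u) =
      overlay W t s (applyInstr (.jump y) x u) := by
  funext z
  by_cases hz : z - t ∈ W
  · simp only [applyInstr_jump, overlay, if_pos hz, ← sub_eq_iff_eq_add]
  · have h1 : z ≠ x + t := by rintro rfl; simp [hx] at hz
    have h2 : z ≠ y + t := by rintro rfl; simp [hy] at hz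
    simp only [applyInstr_jump, overlay, if_neg hz, if_neg h1, if_neg h2]

/-- A minimum principle along a potential. -/
lemma nonneg_of_escape {U : Type*} {adm : U → Prop} {d : U → ℝ} {Φ : U → ℕ} {K : ℕ} {w C : ℝ}
    (hw : 0 < w) (hw1 : w ≤ 1) (hC : 0 ≤ C) (hd : ∀ u, adm u → -C ≤ d u)
    (hK : ∀ u, adm u → Φ u ≤ K)
    (hstep : ∀ u, adm u → 0 ≤ d u ∨ ∃ e, (0 ≤ e ∨ ∃ v, adm v ∧ Φ v < Φ u ∧ e = d v) ∧
      ∀ C, 0 ≤ C → (∀ v, adm v → -C ≤ d v) → w * e - (1 - w) * C ≤ d u)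
    {u : U} (hu : adm u) : 0 ≤ d u := by
  have hρ0 : ∀ m, 0 ≤ 1 - w ^ m := fun m => sub_nonneg.2 (pow_le_one₀ hw.le hw1)
  have key : ∀ C, 0 ≤ C → (∀ v, adm v → -C ≤ d v) →
      ∀ m u, adm u → Φ u ≤ m → -((1 - w ^ (m + 1)) * C) ≤ d u := by
    intro C hC hd m
    induction m with
    | zero =>
      intro u hu hm
      rcases hstep u hu with h | ⟨e, he, h⟩
      · exact (neg_nonpos.2 (mul_nonneg (hρ0 _) hC)).trans h
      · rcases he with he | ⟨v, -, hv, -⟩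
        · have := h C hC hd
          rw [zero_add, pow_one]
          nlinarith
        · omega
    | succ m ih =>
      intro u hu hm
      rcases hstep u hu with h | ⟨e, he, h⟩
      · exact (neg_nonpos.2 (mul_nonneg (hρ0 _) hC)).trans h
      · have h1 : -((1 - w ^ (m + 1)) * C) ≤ e := by
          rcases he with he | ⟨v, hv, hlt, rfl⟩
          · exact (neg_nonpos.2 (mul_nonneg (hρ0 _) hC)).trans he
          · exact ih v hv (by omega)
        have h2 := h C hC hd
        have h3 := mul_le_mul_of_nonneg_left h1 hw.le
        calc -((1 - w ^ (m + 1 + 1)) * C) = w * -((1 - w ^ (m + 1)) * C) - (1 - w) * C := by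
              rw [pow_succ w (m + 1)]; ring
          _ ≤ d u := by linarith
  have hρ1 : 1 - w ^ (K + 1) < 1 := sub_lt_self _ (pow_pos hw _)
  have iter : ∀ j : ℕ, ∀ v, adm v → -((1 - w ^ (K + 1)) ^ j * C) ≤ d v := by
    intro j
    induction j with
    | zero => simpa using hd
    | succ j ih =>
      intro v hv
      have := key _ (mul_nonneg (pow_nonneg (hρ0 (K + 1)) j) hC) ih K v hv (hK v hv)
      rwa [← mul_assoc, ← pow_succ'] at this
  have hlim : Filter.Tendsto (fun j : ℕ => -((1 - w ^ (K + 1)) ^ j * C)) Filter.atTop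
      (nhds 0) := by
    simpa using ((tendsto_pow_atTop_nhds_zero_of_lt_one (hρ0 _) hρ1).mul_const C).neg
  exact le_of_tendsto' hlim fun j => iter j u hu

namespace IsModel

variable {lam : ℝ} {P : ℤ → ℤ → ℝ} {Pr : Measure (ℤ → ℕ → Instr ℤ)}

lemma exists_direction (M : IsModel lam P Pr) (hti : ∀ x y z : ℤ, P (x + z) (y + z) = P x y) :
    ∃ δ : ℤ, (δ = 1 ∨ δ = -1) ∧ ∃ w q : ℝ, 0 < w ∧ 0 ≤ q ∧ lam / (1 + lam) + (w + q) = 1 ∧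
      ∀ x, P x (x + δ) / (1 + lam) = w ∧ P x (x - δ) / (1 + lam) = q := by
  have hpos : 0 < 1 + lam := by linarith [M.lam_nonneg]
  have h0 : ∃ δ : ℤ, (δ = 1 ∨ δ = -1) ∧ 0 < P 0 δ := by
    by_contra! H
    have h1 := H 1 (Or.inl rfl)
    have h2 := H (-1) (Or.inr rfl)
    have h3 := M.sum_neighbours 0
    rw [zero_add, zero_sub] at h3
    linarith
  obtain ⟨δ, hδ, hw⟩ := h0
  refine ⟨δ, hδ, P 0 δ / (1 + lam), P 0 (-δ) / (1 + lam), by positivity,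
    div_nonneg (M.nonneg _ _) hpos.le, ?_, fun x => ⟨?_, ?_⟩⟩
  · have := M.sum_neighbours_sign 0 hδ
    rw [zero_add, zero_sub] at this
    rw [← add_div, this, ← add_div, add_comm lam, div_self hpos.ne']
  · have := hti 0 δ x
    rw [zero_add, add_comm δ] at this
    rw [this]
  · have := hti 0 (-δ) x
    rw [zero_add, neg_add_eq_sub] at this
    rw [this]

open Classical in
lemma confineProb_step_sign (M : IsModel lam P Pr) {V : Set ℤ} {c : Config ℤ} {x : ℤ} (hx : x ∈ V)
    (hl : 0 < (c x).activeCount) {ε : ℤ} (hε : ε = 1 ∨ ε = -1) :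
    confineProb Pr V c = lam / (1 + lam) * confineProb Pr V (applyInstr .sleep x c) +
      (P x (x + ε) / (1 + lam) *
        (if x + ε ∈ V then confineProb Pr V (applyInstr (.jump (x + ε)) x c) else 0) +
      P x (x - ε) / (1 + lam) *
        (if x - ε ∈ V then confineProb Pr V (applyInstr (.jump (x - ε)) x c) else 0)) := by
  have h := M.confineProb_step hx hl
  rcases hε with rfl | rfl
  · exact h
  · rw [← sub_eq_add_neg, sub_neg_eq_add, add_comm (P x (x - 1) / (1 + lam) * _)]
    exact h

lemma avoidProb_step_sign (M : IsModel lam P Pr) {V B : Set ℤ} {c : Config ℤ} {x : ℤ} (hx : x ∈ V)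
    (hxB : x ∉ B) (hl : 0 < (c x).activeCount) {ε : ℤ} (hε : ε = 1 ∨ ε = -1) :
    avoidProb Pr V B c = lam / (1 + lam) * avoidProb Pr V B (applyInstr .sleep x c) +
      (P x (x + ε) / (1 + lam) * avoidProb Pr V B (applyInstr (.jump (x + ε)) x c) +
      P x (x - ε) / (1 + lam) * avoidProb Pr V B (applyInstr (.jump (x - ε)) x c)) := by
  have h := M.avoidProb_step hx hxB hl
  rcases hε with rfl | rfl
  · exact h
  · rw [← sub_eq_add_neg, sub_neg_eq_add, add_comm (P x (x - 1) / (1 + lam) * _)]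
    exact h

lemma confineProb_lt_one (M : IsModel lam P Pr)
    (hti : ∀ x y z : ℤ, P (x + z) (y + z) = P x y) {W : Set ℤ} {R : ℤ} (hW : ∀ x ∈ W, |x| ≤ R)
    {u : Config ℤ} {x : ℤ} (hx : x ∈ W) (hl : 0 < (u x).activeCount) :
    confineProb Pr W u < 1 := by
  classical
  obtain ⟨δ, hδ, w, q, hw, hq, hsum, hP⟩ := M.exists_direction hti
  have hlam : 0 ≤ lam / (1 + lam) := div_nonneg M.lam_nonneg (by linarith [M.lam_nonneg])
  obtain ⟨m, hm⟩ : ∃ m : ℕ, R - δ * x ≤ m := ⟨(R - δ * x).toNat, Int.self_le_toNat _⟩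
  induction m generalizing x u with
  | zero =>
    have hnot : x + δ ∉ W := fun h => by
      have h1 := abs_le.1 (hW _ h)
      rcases hδ with rfl | rfl <;> push_cast at hm <;> omega
    rw [M.confineProb_step_sign hx hl hδ, (hP x).1, (hP x).2, if_neg hnot]
    have h1 := M.confineProb_le_one W (applyInstr .sleep x u)
    have h2 : (if x - δ ∈ W then confineProb Pr W (applyInstr (.jump (x - δ)) x u) else 0) ≤ 1 := by
      split_ifs
      · exact M.confineProb_le_one _ _
      · exact zero_le_one
    nlinarith
  | succ m ih =>
    rw [M.confineProb_step_sign hx hl hδ, (hP x).1, (hP x).2]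
    have h1 := M.confineProb_le_one W (applyInstr .sleep x u)
    have h2 : (if x - δ ∈ W then confineProb Pr W (applyInstr (.jump (x - δ)) x u) else 0) ≤ 1 := by
      split_ifs
      · exact M.confineProb_le_one _ _
      · exact zero_le_one
    have h3 : (if x + δ ∈ W then confineProb Pr W (applyInstr (.jump (x + δ)) x u) else 0) < 1 := by
      split_ifs with h
      · refine ih h ?_ ?_
        · rw [applyInstr_jump, if_pos rfl]
          simp [SiteState.add, SiteState.activeCount]
        · rcases hδ with rfl | rfl <;> push_cast at hm <;> omega
      · exact zero_lt_one
    nlinarith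

/-- If `g₁` bounds the avoidance probability once the block `W + t` has been stabilized without
losing a particle and `g₂` bounds it as soon as a particle leaves the block, then the convex
combination given by the confinement probability is a lower bound. -/
lemma le_avoidProb_overlay (M : IsModel lam P Pr)
    (hti : ∀ x y z : ℤ, P (x + z) (y + z) = P x y) {V B : Set ℤ} {W : Finset ℤ} {R : ℤ}
    (hW : ∀ x ∈ W, |x| ≤ R) {t : ℤ} (hV : ∀ x ∈ W, x + t ∈ V) (hB : ∀ x ∈ W, x + t ∉ B)
    (s : Config ℤ) (T : ℕ) {g₁ g₂ : ℝ}
    (h₁ : ∀ u : Config ℤ, ∑ z ∈ W, (u z).particles = T → (∀ x ∈ W, (u x).activeCount = 0) →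
      g₁ ≤ avoidProb Pr V B (overlay W t s u))
    (h₂ : ∀ (u : Config ℤ) (x y : ℤ), ∑ z ∈ W, (u z).particles = T → x ∈ W →
      0 < (u x).activeCount → y ∉ W → (y = x + 1 ∨ y = x - 1) →
      g₂ ≤ avoidProb Pr V B (applyInstr (.jump (y + t)) (x + t) (overlay W t s u)))
    {u : Config ℤ} (hu : ∑ z ∈ W, (u z).particles = T) :
    confineProb Pr W u * g₁ + (1 - confineProb Pr W u) * g₂ ≤ avoidProb Pr V B (overlay W t s u) := by
  classical
  obtain ⟨δ, hδ, w, q, hw, hq, hsum, hP⟩ := M.exists_direction hti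
  have hlam : 0 ≤ lam / (1 + lam) := div_nonneg M.lam_nonneg (by linarith [M.lam_nonneg])
  set d : Config ℤ → ℝ := fun u => avoidProb Pr V B (overlay W t s u) -
    (confineProb Pr W u * g₁ + (1 - confineProb Pr W u) * g₂) with hd
  suffices H : 0 ≤ d u from sub_nonneg.1 H
  refine nonneg_of_escape (adm := fun u => ∑ z ∈ W, (u z).particles = T)
    (Φ := fun u => ∑ z ∈ W, (u z).particles * (R - δ * z).toNat) (K := T * (2 * R).toNat)
    (C := |g₁| + |g₂|) hw (by linarith) (by positivity) ?_ ?_ ?_ hu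
  · intro u _
    have h1 := M.confineProb_le_one W u
    have h2 := confineProb_nonneg Pr W u
    have h3 := avoidProb_nonneg Pr V B (overlay W t s u)
    have h4 := mul_le_mul_of_nonneg_left (le_abs_self g₁) h2
    have h5 := mul_le_mul_of_nonneg_left (le_abs_self g₂) (sub_nonneg.2 h1)
    have h6 := mul_le_of_le_one_left (abs_nonneg g₁) h1
    have h7 := mul_le_of_le_one_left (abs_nonneg g₂) (sub_le_self 1 h2)
    simp only [hd]
    linarith
  · intro u hu
    rw [← hu, Finset.sum_mul]
    refine Finset.sum_le_sum fun z hz => Nat.mul_le_mul_left _ ?_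
    have := abs_le.1 (hW z hz)
    rcases hδ with rfl | rfl <;> omega
  · intro u hu
    by_cases hst : ∀ x ∈ W, (u x).activeCount = 0
    · left
      have h1 := h₁ u hu hst
      have h2 : confineProb Pr W u = 1 := M.confineProb_of_stable hst
      simp only [hd, h2]
      linarith
    push Not at hst
    obtain ⟨x, hx, hne⟩ := hst
    have hl := Nat.pos_of_ne_zero hne
    right
    have hov : overlay W t s u (x + t) = u x := by simp [overlay, hx]
    have hA := M.avoidProb_step_sign (c := overlay W t s u) (hV x hx) (hB x hx) (by rwa [hov]) hδ
    have hQ := M.confineProb_step_sign (V := (W : Set ℤ)) hx hl hδ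
    rw [(hP _).1, (hP _).2, overlay_sleep t s u hx, add_right_comm x t δ,
      add_sub_right_comm x t δ] at hA
    rw [(hP _).1, (hP _).2] at hQ
    set e : ℤ → ℝ := fun y => if y ∈ W then d (applyInstr (.jump y) x u) else
      avoidProb Pr V B (applyInstr (.jump (y + t)) (x + t) (overlay W t s u)) - g₂ with he
    have hdu : d u = lam / (1 + lam) * d (applyInstr .sleep x u) +
        (w * e (x + δ) + q * e (x - δ)) := by
      have hey : ∀ y, e y = avoidProb Pr V B
          (applyInstr (.jump (y + t)) (x + t) (overlay W t s u)) -
          ((if y ∈ (W : Set ℤ) then confineProb Pr W (applyInstr (.jump y) x u) else 0) * (g₁ - g₂)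
            + g₂) := by
        intro y
        simp only [he, hd, Finset.mem_coe]
        split_ifs with hy
        · rw [overlay_jump t s u hx hy]
          ring
        · ring
      rw [hey, hey]
      simp only [hd]
      rw [hA, hQ]
      split_ifs <;> linear_combination g₂ * hsum
    have hsleep : ∑ z ∈ W, (applyInstr .sleep x u z).particles = T := by
      simp only [particles_sleep, hu]
    have hjump : ∀ y ∈ W, y ≠ x → ∑ z ∈ W, (applyInstr (.jump y) x u z).particles = T := by
      intro y hy hyx
      have := sum_particles_jump hx hy hyx hl fun _ => 1
      simp only [mul_one, hu] at this
      omega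
    have hexit : ∀ y, y ∉ W → (y = x + 1 ∨ y = x - 1) → 0 ≤ e y := by
      intro y hy hyx
      simp only [he, if_neg hy]
      exact sub_nonneg.2 (h₂ u x y hu hx hl hy hyx)
    refine ⟨e (x + δ), ?_, fun C hC hdC => ?_⟩
    · by_cases hy : x + δ ∈ W
      · refine Or.inr ⟨_, hjump _ hy (by omega), ?_, by simp only [he, if_pos hy]⟩
        have h1 := sum_particles_jump hx hy (by omega) hl fun z => (R - δ * z).toNat
        have h2 := abs_le.1 (hW x hx)
        have h3 := abs_le.1 (hW _ hy)
        have h4 : (R - δ * (x + δ)).toNat < (R - δ * x).toNat := by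
          rcases hδ with rfl | rfl <;> omega
        show ∑ z ∈ W, _ < ∑ z ∈ W, _
        omega
      · exact Or.inl (hexit _ hy (by omega))
    · have h1 : -C ≤ e (x - δ) := by
        by_cases hy : x - δ ∈ W
        · simp only [he, if_pos hy]
          exact hdC _ (hjump _ hy (by omega))
        · exact (neg_nonpos.2 hC).trans (hexit _ hy (by omega))
      have h2 := mul_le_mul_of_nonneg_left (hdC _ hsleep) hlam
      have h3 := mul_le_mul_of_nonneg_left h1 hq
      have h4 : 1 - w = lam / (1 + lam) + q := by linarith
      rw [hdu, h4]
      linarith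

end IsModel

/-! ## Blocks -/

lemma mem_Vseg {n : ℕ} {x : ℤ} : x ∈ Vseg n ↔ -(n : ℤ) < 2 * x ∧ 2 * x ≤ n := by
  simp only [Vseg, Finset.mem_filter, Finset.mem_Icc]
  omega

lemma blockIdx_eq_iff {n : ℕ} (hn : 1 ≤ n) {x k : ℤ} : blockIdx n x = k ↔ x - k * n ∈ Vseg n := by
  have hpos : (0 : ℤ) < 2 * n := by omega
  rw [mem_Vseg, blockIdx, Int.fdiv_eq_ediv_of_nonneg _ hpos.le, Int.ediv_eq_iff_of_pos hpos]
  have : k * (2 * (n : ℤ)) = 2 * (k * n) := by ring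
  rw [this]
  constructor <;> rintro ⟨h1, h2⟩ <;> constructor <;> linarith

lemma blockIdx_add {n : ℕ} (hn : 1 ≤ n) {x : ℤ} (hx : x ∈ Vseg n) (k : ℤ) :
    blockIdx n (x + k * n) = k := by
  rw [blockIdx_eq_iff hn]
  simpa using hx

lemma blockIdx_mono {n : ℕ} {x y : ℤ} (h : x ≤ y) : blockIdx n x ≤ blockIdx n y := by
  rw [blockIdx, blockIdx, Int.fdiv_eq_ediv_of_nonneg _ (by positivity),
    Int.fdiv_eq_ediv_of_nonneg _ (by positivity)]
  rcases n.eq_zero_or_pos with rfl | hn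
  · simp
  · exact Int.ediv_le_ediv (by omega) (by linarith)

lemma blockIdx_sign_mono {n : ℕ} {ε : ℤ} (hε : ε = 1 ∨ ε = -1) {x y : ℤ} (h : ε * x ≤ ε * y) :
    ε * blockIdx n x ≤ ε * blockIdx n y := by
  rcases hε with rfl | rfl
  · simpa using blockIdx_mono (by simpa using h)
  · simpa using blockIdx_mono (by simpa using h)

lemma lt_of_blockIdx_lt {n : ℕ} {ε : ℤ} (hε : ε = 1 ∨ ε = -1) {x y : ℤ}
    (h : ε * blockIdx n x < ε * blockIdx n y) : ε * x < ε * y :=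
  lt_of_not_ge fun h' => not_le.2 h (blockIdx_sign_mono hε h')

lemma abs_le_of_mem_blockRegion {n N : ℕ} (hn : 1 ≤ n) {x : ℤ} (hx : x ∈ blockRegion n N) :
    |x| ≤ n + N * n := by
  have h1 := mem_Vseg.1 ((blockIdx_eq_iff hn).1 (rfl : blockIdx n x = blockIdx n x))
  have h2 : |blockIdx n x * n| ≤ N * n := by
    rw [abs_mul, Nat.abs_cast]
    exact mul_le_mul_of_nonneg_right hx (by positivity)
  rw [abs_le] at h2 ⊢
  omega

/-- The multiset with `f z` copies of `z + t` for each `z ∈ W`. -/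
def pile (W : Finset ℤ) (f : ℤ → ℕ) (t : ℤ) : Multiset ℤ :=
  ∑ z ∈ W, Multiset.replicate (f z) (z + t)

lemma card_pile (W : Finset ℤ) (f : ℤ → ℕ) (t : ℤ) : (pile W f t).card = ∑ z ∈ W, f z := by
  simp [pile]

lemma count_pile (W : Finset ℤ) (f : ℤ → ℕ) (t x : ℤ) :
    (pile W f t).count x = if x - t ∈ W then f (x - t) else 0 := by
  have : ∀ z, (Multiset.replicate (f z) (z + t)).count x = if x - t = z then f z else 0 := by
    intro z
    rw [Multiset.count_replicate]
    exact if_congr (by omega) rfl rfl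
  simp [pile, Multiset.count_sum', this]

lemma sub_mem_of_mem_pile {W : Finset ℤ} {f : ℤ → ℕ} {t x : ℤ} (hx : x ∈ pile W f t) :
    x - t ∈ W := by
  by_contra h
  have := Multiset.count_pos.2 hx
  rw [count_pile, if_neg h] at this
  exact lt_irrefl _ this

/-- The particles of the blocks with indices in `c`. -/
def blocks (n : ℕ) (η : ℤ → ℕ) (c : Multiset ℤ) : Multiset ℤ :=
  c.bind fun k => pile (Vseg n) η (k * n)

lemma blocks_cons (n : ℕ) (η : ℤ → ℕ) (k : ℤ) (c : Multiset ℤ) :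
    blocks n η (k ::ₘ c) = blocks n η c + pile (Vseg n) η (k * n) := by
  rw [blocks, Multiset.cons_bind, add_comm, blocks]

lemma count_blocks {n : ℕ} (hn : 1 ≤ n) (η : ℤ → ℕ) (c : Multiset ℤ) (x : ℤ) :
    (blocks n η c).count x = c.count (blockIdx n x) * η (x - blockIdx n x * n) := by
  induction c using Multiset.induction_on with
  | empty => simp [blocks]
  | cons k c ih =>
    rw [blocks_cons, Multiset.count_add, ih, count_pile, Multiset.count_cons]
    by_cases h : blockIdx n x = k
    · rw [if_pos ((blockIdx_eq_iff hn).1 h), if_pos h, h]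
      ring
    · rw [if_neg fun h' => h ((blockIdx_eq_iff hn).2 h'), if_neg h]
      ring

/-- `σ` consists of exactly `T` sites in each block with index in `S`. -/
def SleepersIn (n T : ℕ) (σ S : Finset ℤ) : Prop :=
  ∀ k, (σ.filter fun x => blockIdx n x = k).card = if k ∈ S then T else 0

lemma SleepersIn.blockIdx_mem {n T : ℕ} {σ S : Finset ℤ} (h : SleepersIn n T σ S) {x : ℤ}
    (hx : x ∈ σ) : blockIdx n x ∈ S := by
  by_contra hS
  have := h (blockIdx n x)
  rw [if_neg hS, Finset.card_eq_zero] at this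
  exact Finset.notMem_empty x (this ▸ Finset.mem_filter.2 ⟨hx, rfl⟩)

lemma SleepersIn.erase {n T : ℕ} {σ S : Finset ℤ} (h : SleepersIn n T σ S) (k : ℤ) :
    SleepersIn n T (σ.filter fun x => blockIdx n x ≠ k) (S.erase k) := by
  intro j
  rw [Finset.filter_filter]
  by_cases hj : j = k
  · subst hj
    rw [if_neg (Finset.notMem_erase _ _), Finset.card_eq_zero, Finset.filter_eq_empty_iff]
    exact fun x _ hx => hx.1 hx.2
  · have := h j
    simp only [Finset.mem_erase, ne_eq, hj, not_false_eq_true, true_and]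
    rw [← this]
    congr 1
    exact Finset.filter_congr fun x _ => ⟨fun hx => hx.2, fun hx => ⟨hx ▸ hj, hx⟩⟩

lemma SleepersIn.insert {n T : ℕ} {σ S τ : Finset ℤ} (h : SleepersIn n T σ S) {k : ℤ} (hk : k ∉ S)
    (hτ : ∀ x ∈ τ, blockIdx n x = k) (hcard : τ.card = T) :
    SleepersIn n T (σ ∪ τ) (insert k S) := by
  intro j
  rw [Finset.filter_union]
  by_cases hj : j = k
  · subst hj
    have h1 := h j
    rw [if_neg hk, Finset.card_eq_zero] at h1
    rw [h1, Finset.empty_union, Finset.filter_true_of_mem hτ, hcard,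
      if_pos (Finset.mem_insert_self _ _)]
  · have h1 : τ.filter (fun x => blockIdx n x = j) = ∅ :=
      Finset.filter_eq_empty_iff.2 fun x hx hxj => hj (hxj ▸ hτ x hx)
    rw [h1, Finset.union_empty, h j]
    simp [hj]

/-! ## Comparison of the two models -/

/-- The parameters of a block model and of the corresponding coarse-grained model. -/
structure IsCoarseGraining (n : ℕ) (η : ℤ → ℕ) (lam : ℝ) (P : ℤ → ℤ → ℝ)
    (Pr : Measure (ℤ → ℕ → Instr ℤ)) (lam' : ℝ) (D : ℤ → ℤ → ℝ)
    (Pr' : Measure (ℤ → ℕ → Instr ℤ)) : Prop where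
  block : IsModel lam P Pr
  coarse : IsModel lam' D Pr'
  translation : ∀ x y z : ℤ, P (x + z) (y + z) = P x y
  one_le : 1 ≤ n
  directed : ∀ ε : ℤ, (ε = 1 ∨ ε = -1) → ∀ k, 0 < ε * k → D k (k - ε) = 1
  confine : confineProb Pr (Vseg n : Set ℤ) (toCfg η) = lam' / (1 + lam')

/-- The configurations of the coarse-grained model with active particles `c` and sleepers `S`
met when the particles are moved one by one towards the origin, the closest ones first. -/
structure IsOrdered (N : ℕ) (S : Finset ℤ) (c : Multiset ℤ) : Prop where
  abs_le : ∀ k ∈ c, |k| ≤ N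
  ne_zero : ∀ k ∈ c, k ≠ 0
  sleeper_ne_zero : ∀ j ∈ S, j ≠ 0
  lt : ∀ ε : ℤ, (ε = 1 ∨ ε = -1) → ∀ j ∈ S, ∀ k ∈ c, 0 < ε * j → 0 < ε * k → ε * j < ε * k

/-- The distance to the origin left to travel, decreased by one half per sleeper. -/
def travel (S : Finset ℤ) (c : Multiset ℤ) : ℕ :=
  (c.map fun k => 2 * k.natAbs).sum + ∑ j ∈ S, (2 * j.natAbs - 1)

lemma travel_cons (S : Finset ℤ) (k : ℤ) (c : Multiset ℤ) :
    travel S (k ::ₘ c) = 2 * k.natAbs + travel S c := by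
  simp [travel, add_assoc]

lemma travel_insert {S : Finset ℤ} {k : ℤ} (hk : k ∉ S) (c : Multiset ℤ) :
    travel (insert k S) c = (2 * k.natAbs - 1) + travel S c := by
  rw [travel, travel, Finset.sum_insert hk, add_left_comm]

lemma travel_erase {S : Finset ℤ} {k : ℤ} (hk : k ∈ S) (c : Multiset ℤ) :
    (2 * k.natAbs - 1) + travel (S.erase k) c = travel S c := by
  rw [← travel_insert (Finset.notMem_erase k S), Finset.insert_erase hk]

lemma rank_le_rank_act (s : SiteState) : rank s ≤ rank (.act s.particles) := by
  cases s <;> simp [rank, SiteState.particles]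

lemma IsOrdered.of_cons {N : ℕ} {S : Finset ℤ} {k : ℤ} {c : Multiset ℤ}
    (h : IsOrdered N S (k ::ₘ c)) : IsOrdered N S c where
  abs_le j hj := h.abs_le j (Multiset.mem_cons_of_mem hj)
  ne_zero j hj := h.ne_zero j (Multiset.mem_cons_of_mem hj)
  sleeper_ne_zero := h.sleeper_ne_zero
  lt ε hε i hi j hj := h.lt ε hε i hi j (Multiset.mem_cons_of_mem hj)

lemma sign_cases (k : ℤ) (hk : k ≠ 0) : ∃ ε : ℤ, (ε = 1 ∨ ε = -1) ∧ 0 < ε * k := by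
  rcases lt_or_gt_of_ne hk with h | h
  · exact ⟨-1, Or.inr rfl, by omega⟩
  · exact ⟨1, Or.inl rfl, by omega⟩

lemma IsOrdered.exists_closest {N : ℕ} {S : Finset ℤ} {c : Multiset ℤ} (h : IsOrdered N S c)
    (hc : c ≠ 0) : ∃ k c', c = k ::ₘ c' ∧ k ∉ S ∧ ∃ ε : ℤ, (ε = 1 ∨ ε = -1) ∧ 0 < ε * k ∧
      ∀ j ∈ c, 0 < ε * j → ε * k ≤ ε * j := by
  obtain ⟨k, hk, hmin⟩ := Finset.exists_min_image c.toFinset (fun k => |k|)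
    (by simpa using hc)
  rw [Multiset.mem_toFinset] at hk
  obtain ⟨ε, hε, hpos⟩ := sign_cases k (h.ne_zero k hk)
  refine ⟨k, c.erase k, (Multiset.cons_erase hk).symm, fun hkS => ?_, ε, hε, hpos, ?_⟩
  · exact lt_irrefl _ (h.lt ε hε k hkS k hk hpos hpos)
  · intro j hj hpj
    have := hmin j (Multiset.mem_toFinset.2 hj)
    have habs : ∀ i : ℤ, 0 < ε * i → |i| = ε * i := fun i hi => by
      rcases hε with rfl | rfl
      · rw [one_mul] at hi ⊢
        exact abs_of_pos hi
      · rw [neg_one_mul] at hi ⊢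
        exact abs_of_neg (by omega)
    rwa [habs k hpos, habs j hpj] at this

lemma IsOrdered.insert {N : ℕ} {S : Finset ℤ} {k : ℤ} {c : Multiset ℤ}
    (h : IsOrdered N S (k ::ₘ c)) {ε : ℤ} (hε : ε = 1 ∨ ε = -1) (hpos : 0 < ε * k)
    (hmin : ∀ j ∈ c, 0 < ε * j → ε * k ≤ ε * j) (hk : k ∉ c) : IsOrdered N (insert k S) c where
  abs_le := h.of_cons.abs_le
  ne_zero := h.of_cons.ne_zero
  sleeper_ne_zero j hj := by
    rcases Finset.mem_insert.1 hj with rfl | hj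
    · exact h.ne_zero j (Multiset.mem_cons_self _ _)
    · exact h.sleeper_ne_zero j hj
  lt ε' hε' j hj i hi hpj hpi := by
    rcases Finset.mem_insert.1 hj with rfl | hj
    · have hne : i ≠ j := fun hij => hk (hij ▸ hi)
      have := hmin i hi
      rcases hε with rfl | rfl <;> rcases hε' with rfl | rfl <;> omega
    · exact h.of_cons.lt ε' hε' j hj i hi hpj hpi

lemma IsOrdered.cons {N : ℕ} {S : Finset ℤ} {k : ℤ} {c : Multiset ℤ} (h : IsOrdered N S c)
    (hk : |k| ≤ N) {ε : ℤ} (hε : ε = 1 ∨ ε = -1) (hpos : 0 < ε * k)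
    (hS : ∀ j ∈ S, 0 < ε * j → ε * j < ε * k) : IsOrdered N S (k ::ₘ c) where
  abs_le j hj := by
    rcases Multiset.mem_cons.1 hj with rfl | hj
    · exact hk
    · exact h.abs_le j hj
  ne_zero j hj := by
    rcases Multiset.mem_cons.1 hj with rfl | hj
    · rintro rfl
      simp at hpos
    · exact h.ne_zero j hj
  sleeper_ne_zero := h.sleeper_ne_zero
  lt ε' hε' j hj i hi hpj hpi := by
    rcases Multiset.mem_cons.1 hi with rfl | hi
    · have := hS j hj
      rcases hε with rfl | rfl <;> rcases hε' with rfl | rfl <;> omega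
    · exact h.lt ε' hε' j hj i hi hpj hpi

lemma IsOrdered.erase {N : ℕ} {S : Finset ℤ} {c : Multiset ℤ} (h : IsOrdered N S c) (k : ℤ) :
    IsOrdered N (S.erase k) c where
  abs_le := h.abs_le
  ne_zero := h.ne_zero
  sleeper_ne_zero j hj := h.sleeper_ne_zero j (Finset.mem_of_mem_erase hj)
  lt ε hε j hj := h.lt ε hε j (Finset.mem_of_mem_erase hj)

section

variable {n : ℕ} {η : ℤ → ℕ} {lam lam' : ℝ} {P D : ℤ → ℤ → ℝ}
  {Pr Pr' : Measure (ℤ → ℕ → Instr ℤ)}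

/-- The coarse-grained model avoids the origin with at most the probability that the block model
avoids the block of the origin, for well ordered configurations having less than `m` left to
travel. -/
def BlocksDominate (n : ℕ) (η : ℤ → ℕ) (Pr Pr' : Measure (ℤ → ℕ → Instr ℤ)) (N m : ℕ) : Prop :=
  ∀ (S σ : Finset ℤ) (c : Multiset ℤ), IsOrdered N S c →
    SleepersIn n (∑ z ∈ Vseg n, η z) σ S → travel S c < m →
    avoidProb Pr' (coarseRegion N) {0} (mixCfg S c) ≤
      avoidProb Pr (blockRegion n N) (Vseg n : Set ℤ) (mixCfg σ (blocks n η c))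

/-- The same comparison when the particles `X` of a block have travelled towards the origin and
have not yet gone beyond the block `k`. -/
def IncomingDominate (n : ℕ) (η : ℤ → ℕ) (Pr Pr' : Measure (ℤ → ℕ → Instr ℤ)) (N m : ℕ) : Prop :=
  ∀ (S σ : Finset ℤ) (c X : Multiset ℤ) (k ε : ℤ), IsOrdered N S c →
    SleepersIn n (∑ z ∈ Vseg n, η z) σ S → travel S (k ::ₘ c) < m →
    |k| ≤ N → (ε = 1 ∨ ε = -1) → 0 ≤ ε * k → (∀ j ∈ S, 0 < ε * j → ε * j ≤ ε * k) →
    X.card = ∑ z ∈ Vseg n, η z → (∀ x ∈ X, ∀ y, blockIdx n y = k → ε * y ≤ ε * x) →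
    avoidProb Pr' (coarseRegion N) {0} (mixCfg S (k ::ₘ c)) ≤
      avoidProb Pr (blockRegion n N) (Vseg n : Set ℤ) (mixCfg σ (blocks n η c + X))

lemma abs_sub_sign_le {N : ℕ} {k ε : ℤ} (hk : |k| ≤ N) (hε : ε = 1 ∨ ε = -1) (hpos : 0 < ε * k) :
    |k - ε| ≤ N := by
  rw [abs_le] at hk ⊢
  rcases hε with rfl | rfl <;> omega

lemma blockIdx_eq_of_mem_pile (hn : 1 ≤ n) {f : ℤ → ℕ} {k x : ℤ}
    (hx : x ∈ pile (Vseg n) f (k * n)) : blockIdx n x = k :=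
  (blockIdx_eq_iff hn).2 (sub_mem_of_mem_pile hx)

lemma sign_mul_sub {ε : ℤ} (hε : ε = 1 ∨ ε = -1) (k : ℤ) : ε * (k - ε) = ε * k - 1 := by
  rcases hε with rfl | rfl <;> ring

lemma natAbs_sub_sign {k ε : ℤ} (hε : ε = 1 ∨ ε = -1) (hpos : 0 < ε * k) :
    (k - ε).natAbs + 1 = k.natAbs := by
  rcases hε with rfl | rfl <;> omega

lemma IsCoarseGraining.directed_of_mem (C : IsCoarseGraining n η lam P Pr lam' D Pr') {N : ℕ}
    {S : Finset ℤ} {k ε : ℤ} (hk : |k| ≤ N) (hkS : k ∉ S) {c : Multiset ℤ} (hkc : k ∈ c)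
    (hε : ε = 1 ∨ ε = -1) (hpos : 0 < ε * k) :
    avoidProb Pr' (coarseRegion N) {0} (mixCfg S (k ::ₘ c)) =
      avoidProb Pr' (coarseRegion N) {0} (mixCfg S ((k - ε) ::ₘ c)) :=
  C.coarse.avoidProb_directed_of_mem (V := coarseRegion N) (x := k) hk
    (by rintro rfl; simp at hpos) hkS hkc hε (C.directed ε hε k hpos)

lemma notMem_center_of_beyond (hn : 1 ≤ n) {k ε : ℤ} (hε : ε = 1 ∨ ε = -1) (hpos : 0 < ε * k)
    {y z : ℤ} (hy : blockIdx n y = k) (hyz : ε * y < ε * z) : z ∉ (Vseg n : Set ℤ) := by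
  intro hz
  have hz0 : blockIdx n z = 0 := (blockIdx_eq_iff hn).2 (by simpa using hz)
  have := blockIdx_sign_mono (n := n) hε hyz.le
  rw [hy, hz0] at this
  omega

lemma IsCoarseGraining.incoming (C : IsCoarseGraining n η lam P Pr lam' D Pr') {N m : ℕ}
    (hblocks : BlocksDominate n η Pr Pr' N (m + 1)) (hincoming : IncomingDominate n η Pr Pr' N m) :
    IncomingDominate n η Pr Pr' N (m + 1) := by
  intro S σ c X k ε hord hσ hm hk hε hpos hS hX hXk
  have hn := C.one_le
  rcases hpos.eq_or_lt with h0 | hpos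
  · have hk0 : k = 0 := by rcases hε with rfl | rfl <;> omega
    subst hk0
    have hS0 : (0 : ℤ) ∉ S := fun h => hord.sleeper_ne_zero 0 h rfl
    rw [avoidProb_eq_zero Pr' (x := 0) (by simp [coarseRegion]) (by simp)
      (by simp [mixCfg_of_notMem hS0, SiteState.activeCount])]
    exact avoidProb_nonneg _ _ _ _
  have hcarry : ∀ (σ' : Finset ℤ) (c' X' : Multiset ℤ), X'.card = ∑ z ∈ Vseg n, η z →
      (∀ x ∈ X', ∀ y, blockIdx n y = k → ε * y ≤ ε * x) →
      (∀ z ∈ σ', blockIdx n z ∈ S.erase k) →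
      avoidProb Pr (blockRegion n N) (Vseg n : Set ℤ)
        (mixCfg σ' (c' + pile (Vseg n) η (k * n))) ≤
      avoidProb Pr (blockRegion n N) (Vseg n : Set ℤ) (mixCfg σ' (c' + X')) := by
    intro σ' c' X' hX' hX'k hσ'
    refine C.block.avoidProb_carry_multiset C.translation hε
      (fun x hx => abs_le_of_mem_blockRegion hn hx) (by rw [hX', card_pile]) ?_ ?_ c'
    · intro y hy z hyz
      have hyk := blockIdx_eq_of_mem_pile hn hy
      refine ⟨notMem_center_of_beyond hn hε hpos hyk hyz, fun hz => ?_⟩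
      have hzS := Finset.mem_erase.1 (hσ' z hz)
      have h1 := blockIdx_sign_mono (n := n) hε hyz.le
      rw [hyk] at h1
      have h2 := hS _ hzS.2 (by omega)
      refine hzS.1 ?_
      rcases hε with rfl | rfl <;> omega
    · exact fun x hx y hy => hX'k x hx y (blockIdx_eq_of_mem_pile hn hy)
  by_cases hkS : k ∈ S
  · have hσk := hσ k
    rw [if_pos hkS] at hσk
    have hσ' := hσ.erase k
    have hunion : σ.filter (fun x => blockIdx n x ≠ k) ∪ σ.filter (fun x => blockIdx n x = k) =
        σ := by
      rw [Finset.union_comm, Finset.filter_union_filter_not_eq]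
    set τ := σ.filter fun x => blockIdx n x = k with hτ
    have hτk : ∀ x ∈ τ, blockIdx n x = k := fun x hx => (Finset.mem_filter.1 hx).2
    have hord' : IsOrdered N (S.erase k) (k ::ₘ c) := by
      refine (hord.erase k).cons hk hε hpos fun j hj hpj => ?_
      have h1 := Finset.mem_erase.1 hj
      have := hS j h1.2 hpj
      have := h1.1
      rcases hε with rfl | rfl <;> omega
    calc avoidProb Pr' (coarseRegion N) {0} (mixCfg S (k ::ₘ c))
        = avoidProb Pr' (coarseRegion N) {0} (mixCfg (S.erase k) ((k - ε) ::ₘ k ::ₘ c)) := by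
          rw [mixCfg_erase hkS (Multiset.mem_cons_self k c)]
          exact C.directed_of_mem hk (Finset.notMem_erase k S) (Multiset.mem_cons_self k c) hε hpos
      _ ≤ avoidProb Pr (blockRegion n N) (Vseg n : Set ℤ)
            (mixCfg (σ.filter fun x => blockIdx n x ≠ k) (blocks n η (k ::ₘ c) + τ.val)) := by
          refine hincoming _ _ _ _ (k - ε) ε hord' hσ' ?_ (abs_sub_sign_le hk hε hpos) hε ?_ ?_ hσk ?_
          · have h1 := travel_erase hkS c
            have h2 := natAbs_sub_sign hε hpos
            rw [travel_cons] at hm ⊢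
            rw [travel_cons]
            omega
          · rw [sign_mul_sub hε]
            omega
          · intro j hj hpj
            have := hord'.lt ε hε j hj k (Multiset.mem_cons_self k c) hpj hpos
            rw [sign_mul_sub hε]
            omega
          · intro x hx y hy
            refine (lt_of_blockIdx_lt hε (n := n) ?_).le
            rw [hy, hτk x hx, sign_mul_sub hε]
            omega
      _ ≤ avoidProb Pr (blockRegion n N) (Vseg n : Set ℤ)
            (mixCfg (σ.filter fun x => blockIdx n x ≠ k) (blocks n η c + X + τ.val)) := by
          rw [blocks_cons, add_right_comm, add_right_comm _ X]
          exact hcarry _ _ X hX hXk fun z hz => hσ'.blockIdx_mem hz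
      _ ≤ avoidProb Pr (blockRegion n N) (Vseg n : Set ℤ) (mixCfg σ (blocks n η c + X)) := by
          refine (C.block.avoidProb_add_le_union _ _ _ _ _).trans_eq ?_
          rw [hunion]
  · calc avoidProb Pr' (coarseRegion N) {0} (mixCfg S (k ::ₘ c))
        ≤ avoidProb Pr (blockRegion n N) (Vseg n : Set ℤ) (mixCfg σ (blocks n η (k ::ₘ c))) := by
          refine hblocks S σ _ (hord.cons hk hε hpos fun j hj hpj => ?_) hσ hm
          have := hS j hj hpj
          have : j ≠ k := fun h => hkS (h ▸ hj)
          rcases hε with rfl | rfl <;> omega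
      _ ≤ _ := by
          rw [blocks_cons]
          refine hcarry _ _ X hX hXk fun z hz => ?_
          rw [Finset.erase_eq_of_notMem hkS]
          exact hσ.blockIdx_mem hz

end

/-! ## Toppling the closest block -/

section

variable {n : ℕ} {η : ℤ → ℕ} {lam lam' : ℝ} {P D : ℤ → ℤ → ℝ}
  {Pr Pr' : Measure (ℤ → ℕ → Instr ℤ)}

lemma blocks_count_eq_zero (hn : 1 ≤ n) {k : ℤ} {c : Multiset ℤ} (hk : k ∉ c) {z : ℤ}
    (hz : blockIdx n z = k) : (blocks n η c).count z = 0 := by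
  rw [count_blocks hn, hz, Multiset.count_eq_zero_of_notMem hk, zero_mul]

lemma overlay_toCfg (hn : 1 ≤ n) {σ : Finset ℤ} {k : ℤ} {c : Multiset ℤ} (hk : k ∉ c)
    (hσ : ∀ z ∈ σ, blockIdx n z ≠ k) :
    overlay (Vseg n) (k * n) (mixCfg σ (blocks n η c)) (toCfg η) =
      mixCfg σ (blocks n η (k ::ₘ c)) := by
  funext z
  rw [overlay, blocks_cons]
  split_ifs with hz
  · have hzk := (blockIdx_eq_iff hn).2 hz
    rw [mixCfg_of_notMem fun h => hσ z h hzk, Multiset.count_add, count_pile,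
      blocks_count_eq_zero hn hk hzk, if_pos hz, zero_add, toCfg]
  · rw [mixCfg, mixCfg, Multiset.count_add, count_pile, if_neg hz, add_zero]

/-- The occupied sites of `u` in `Vseg n`, translated to the block `k`. -/
def sleepersOf (n : ℕ) (k : ℤ) (u : Config ℤ) : Finset ℤ :=
  ((Vseg n).filter fun z => (u z).particles ≠ 0).image (· + k * n)

lemma mem_sleepersOf {k : ℤ} {u : Config ℤ} {z : ℤ} :
    z ∈ sleepersOf n k u ↔ z - k * n ∈ Vseg n ∧ (u (z - k * n)).particles ≠ 0 := by
  simp only [sleepersOf, Finset.mem_image, Finset.mem_filter]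
  constructor
  · rintro ⟨x, hx, rfl⟩
    simpa using hx
  · exact fun h => ⟨_, h, by ring⟩

lemma card_sleepersOf {k : ℤ} {u : Config ℤ} (hu : ∀ x ∈ Vseg n, (u x).activeCount = 0) :
    (sleepersOf n k u).card = ∑ z ∈ Vseg n, (u z).particles := by
  rw [sleepersOf, Finset.card_image_of_injective _ (add_left_injective _), Finset.card_filter]
  refine Finset.sum_congr rfl fun z hz => ?_
  have := hu z hz
  cases h : u z <;> simp_all [SiteState.particles, SiteState.activeCount]

lemma overlay_stable (hn : 1 ≤ n) {σ : Finset ℤ} {k : ℤ} {c : Multiset ℤ} (hk : k ∉ c)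
    (hσ : ∀ z ∈ σ, blockIdx n z ≠ k) {u : Config ℤ} (hu : ∀ x ∈ Vseg n, (u x).activeCount = 0) :
    overlay (Vseg n) (k * n) (mixCfg σ (blocks n η c)) u =
      mixCfg (σ ∪ sleepersOf n k u) (blocks n η c) := by
  funext z
  rw [overlay, mixCfg, mixCfg]
  simp only [Finset.mem_union, mem_sleepersOf]
  by_cases hz : z - k * n ∈ Vseg n
  · have hzk := (blockIdx_eq_iff hn).2 hz
    have h1 : z ∉ σ := fun h => hσ z h hzk
    have h2 := hu _ hz
    rw [blocks_count_eq_zero hn hk hzk]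
    cases h : u (z - k * n) <;>
      simp_all [SiteState.particles, SiteState.activeCount, mix]
  · simp [hz]

lemma rank_exit_le (hn : 1 ≤ n) {σ : Finset ℤ} {k : ℤ} {c : Multiset ℤ} (hk : k ∉ c)
    (hσ : ∀ z ∈ σ, blockIdx n z ≠ k) (u : Config ℤ) {x y : ℤ} (hx : x ∈ Vseg n)
    (hy : y ∉ Vseg n) (z : ℤ) :
    rank (applyInstr (.jump (y + k * n)) (x + k * n)
        (overlay (Vseg n) (k * n) (mixCfg σ (blocks n η c)) u) z) ≤
      rank (mixCfg σ (blocks n η c + (y + k * n) ::ₘ pile (Vseg n)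
        (fun w => (if w = x then (u x).remove else u w).particles) (k * n)) z) := by
  have hxy : y ≠ x := fun h => hy (h ▸ hx)
  rw [applyInstr_jump, overlay, Multiset.add_cons]
  by_cases hzy : z = y + k * n
  · subst hzy
    rw [if_pos rfl, if_neg (by omega), add_sub_cancel_right, if_neg hy, mixCfg, mixCfg,
      mix_add (by split_ifs <;> simp), Multiset.count_cons_self, Multiset.count_add, count_pile,
      add_sub_cancel_right, if_neg hy, add_zero]
  · rw [if_neg hzy, mixCfg, mixCfg, Multiset.count_cons_of_ne hzy, Multiset.count_add, count_pile]
    by_cases hz : z - k * n ∈ Vseg n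
    · have hzk := (blockIdx_eq_iff hn).2 hz
      rw [if_neg fun h => hσ z h hzk, blocks_count_eq_zero hn hk hzk, if_pos hz, if_pos hz,
        zero_add, mix_zero]
      by_cases hzx : z = x + k * n
      · subst hzx
        simpa using rank_le_rank_act _
      · rw [if_neg hzx, if_neg (by omega)]
        exact rank_le_rank_act _
    · rw [if_neg hz, if_neg hz, add_zero, if_neg]
      rintro rfl
      simp [hx] at hz

lemma sum_remove {W : Finset ℤ} {u : Config ℤ} {x : ℤ} (hx : x ∈ W)
    (hl : 0 < (u x).activeCount) :
    ∑ z ∈ W, (if z = x then (u x).remove else u z).particles + 1 = ∑ z ∈ W, (u z).particles := by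
  rw [← Finset.add_sum_erase W _ hx, ← Finset.add_sum_erase W _ hx, if_pos rfl, add_right_comm,
    particles_remove hl]
  congr 1
  exact Finset.sum_congr rfl fun z hz => by rw [if_neg (Finset.ne_of_mem_erase hz)]

lemma IsCoarseGraining.blocks_step (C : IsCoarseGraining n η lam P Pr lam' D Pr') {N m : ℕ}
    (hblocks : BlocksDominate n η Pr Pr' N m) (hincoming : IncomingDominate n η Pr Pr' N m) :
    BlocksDominate n η Pr Pr' N (m + 1) := by
  intro S σ c hord hσ hm
  have hn := C.one_le
  rcases eq_or_ne c 0 with rfl | hc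
  · rw [C.block.avoidProb_of_stable]
    · exact C.coarse.avoidProb_le_one _ _ _
    · intro x _
      simp only [blocks, Multiset.zero_bind, mixCfg, Multiset.count_zero, mix]
      split_ifs <;> rfl
  obtain ⟨k, c, rfl, hkS, ε, hε, hpos, hmin⟩ := hord.exists_closest hc
  have hk : |k| ≤ N := hord.abs_le k (Multiset.mem_cons_self k c)
  have hmove : ∀ X : Multiset ℤ, X.card = ∑ z ∈ Vseg n, η z →
      (∀ x ∈ X, ∀ y, blockIdx n y = k - ε → ε * y ≤ ε * x) →
      avoidProb Pr' (coarseRegion N) {0} (mixCfg S ((k - ε) ::ₘ c)) ≤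
        avoidProb Pr (blockRegion n N) (Vseg n : Set ℤ) (mixCfg σ (blocks n η c + X)) := by
    intro X hX hXk
    refine hincoming S σ c X (k - ε) ε hord.of_cons hσ ?_ (abs_sub_sign_le hk hε hpos) hε ?_ ?_
      hX hXk
    · have := natAbs_sub_sign hε hpos
      rw [travel_cons] at hm ⊢
      omega
    · rw [sign_mul_sub hε]
      omega
    · intro j hj hpj
      have := hord.lt ε hε j hj k (Multiset.mem_cons_self k c) hpj hpos
      rw [sign_mul_sub hε]
      omega
  have hbehind : ∀ x y, blockIdx n x = k → blockIdx n y = k - ε → ε * y < ε * x := by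
    intro x y hx hy
    refine lt_of_blockIdx_lt hε (n := n) ?_
    rw [hx, hy, sign_mul_sub hε]
    omega
  by_cases hkc : k ∈ c
  · rw [C.directed_of_mem hk hkS hkc hε hpos, blocks_cons]
    exact hmove _ (card_pile _ _ _) fun x hx y hy =>
      (hbehind x y (blockIdx_eq_of_mem_pile hn hx) hy).le
  have hσk : ∀ z ∈ σ, blockIdx n z ≠ k := fun z hz h => hkS (h ▸ hσ.blockIdx_mem hz)
  rw [C.coarse.avoidProb_directed (V := coarseRegion N) (x := k) hk (by rintro rfl; simp at hpos)
    hkS c hε (C.directed ε hε k hpos), if_pos (Multiset.count_eq_zero_of_notMem hkc), ← C.confine,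
    ← overlay_toCfg hn hkc hσk]
  refine C.block.le_avoidProb_overlay C.translation (R := n) ?_ ?_ ?_ _ (∑ z ∈ Vseg n, η z)
    ?_ ?_ rfl
  · intro x hx
    rw [mem_Vseg] at hx
    rw [abs_le]
    omega
  · intro x hx
    change |blockIdx n (x + k * n)| ≤ N
    rwa [blockIdx_add hn hx]
  · intro x hx h
    have h0 : blockIdx n (x + k * n) = 0 := (blockIdx_eq_iff hn).2 (by simpa using h)
    rw [blockIdx_add hn hx] at h0
    rw [h0] at hpos
    simp at hpos
  · intro u hu hstable
    rw [overlay_stable hn hkc hσk hstable]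
    refine hblocks _ _ c (hord.insert hε hpos (fun j hj =>
      hmin j (Multiset.mem_cons_of_mem hj)) hkc) (hσ.insert hkS ?_ ?_) ?_
    · exact fun z hz => (blockIdx_eq_iff hn).2 (mem_sleepersOf.1 hz).1
    · rw [card_sleepersOf hstable, hu]
    · have : k ≠ 0 := hord.ne_zero k (Multiset.mem_cons_self k c)
      rw [travel_cons] at hm
      rw [travel_insert hkS]
      omega
  · intro u x y hu hx hl hy hxy
    refine (hmove _ ?_ ?_).trans (C.block.avoidProb_mono fun z _ =>
      rank_exit_le hn hkc hσk u hx hy z)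
    · rw [Multiset.card_cons, card_pile, sum_remove hx hl, hu]
    · intro w hw z hz
      rcases Multiset.mem_cons.1 hw with rfl | hw
      · have := hbehind (x + k * n) z (blockIdx_add hn hx k) hz
        rcases hε with rfl | rfl <;> rcases hxy with rfl | rfl <;> linarith
      · exact (hbehind w z (blockIdx_eq_of_mem_pile hn hw) hz).le

lemma IsCoarseGraining.dominate (C : IsCoarseGraining n η lam P Pr lam' D Pr') (N m : ℕ) :
    BlocksDominate n η Pr Pr' N m ∧ IncomingDominate n η Pr Pr' N m := by
  induction m with
  | zero => exact ⟨fun _ _ _ _ _ h => absurd h (Nat.not_lt_zero _),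
      fun _ _ _ _ _ _ _ _ h => absurd h (Nat.not_lt_zero _)⟩
  | succ m ih =>
    have h := C.blocks_step ih.1 ih.2
    exact ⟨h, C.incoming h ih.2⟩

lemma IsCoarseGraining.avoidProb_le (C : IsCoarseGraining n η lam P Pr lam' D Pr') (N : ℕ)
    (ξ : ℤ → ℕ) : avoidProb Pr' (coarseRegion N) {0} (toCfg ξ) ≤
      avoidProb Pr (blockRegion n N) (Vseg n : Set ℤ) (toCfg (phiEta n η ξ)) := by
  have hn := C.one_le
  by_cases h0 : ξ 0 = 0
  swap
  · rw [avoidProb_eq_zero Pr' (x := 0) (by simp [coarseRegion]) (by simp)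
      (by simpa [toCfg, SiteState.activeCount] using Nat.pos_of_ne_zero h0)]
    exact avoidProb_nonneg _ _ _ _
  set c := pile (Finset.Icc (-(N : ℤ)) N) ξ 0 with hc
  have hcount : ∀ k : ℤ, |k| ≤ N → c.count k = ξ k := fun k hk => by
    rw [hc, count_pile, sub_zero, if_pos (Finset.mem_Icc.2 (abs_le.1 hk))]
  have hord : IsOrdered N ∅ c := by
    refine ⟨fun k hk => ?_, ?_, by simp, by simp⟩
    · simpa [abs_le] using sub_mem_of_mem_pile hk
    · rintro k hk rfl
      have := Multiset.count_pos.2 hk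
      rw [hcount 0 (by simp), h0] at this
      exact lt_irrefl _ this
  calc avoidProb Pr' (coarseRegion N) {0} (toCfg ξ)
      = avoidProb Pr' (coarseRegion N) {0} (mixCfg ∅ c) := C.coarse.avoidProb_congr fun k hk => by
        rw [mixCfg_of_notMem (Finset.notMem_empty k), hcount k hk, toCfg]
    _ ≤ avoidProb Pr (blockRegion n N) (Vseg n : Set ℤ) (mixCfg ∅ (blocks n η c)) :=
        (C.dominate N (travel ∅ c + 1)).1 ∅ ∅ c hord (by simp [SleepersIn]) (Nat.lt_succ_self _)
    _ = _ := C.block.avoidProb_congr fun x hx => by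
        rw [mixCfg_of_notMem (Finset.notMem_empty x), count_blocks hn, hcount _ hx, toCfg, phiEta]

end

end ARW

/-- **The coarse-graining coupling** (Proposition `prop_coupling`).  Let `λ > 0`, let `P` be a
translation-invariant nearest-neighbour jump distribution on `ℤ`, let `n ≥ 1`, let
`η : V_n → ℕ` with `η ≠ 0`, and let `p = P_η(M_n = 0)`.  Let `λ' = p/(1−p)` and let `D` be a
nearest-neighbour jump distribution with directed jumps towards the origin.  Then, for every
probability distribution `ν` on `ℕ^ℤ`, there exists a coupling `κ` between `ν_η ⊗ 𝒫_{λ,P}`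
(the block model) and `ν ⊗ 𝒫_{λ',D}` (the coarse-grained model) such that, almost surely, if
the origin is never visited in the coarse-grained model then the block of the origin `B₀ = V_n`
is never visited in the block model. -/
theorem statement4 (lam : ℝ) (hlam : 0 < lam) (P : ℤ → ℤ → ℝ)
    (hPnonneg : ∀ x y, 0 ≤ P x y) (hProwsum : ∀ x, ∑' y, P x y = 1)
    (hPti : ∀ x y z : ℤ, P (x + z) (y + z) = P x y)
    (hPnn : ∀ x y, P x y ≠ 0 → y = x + 1 ∨ y = x - 1)
    (n : ℕ) (hn : 1 ≤ n) (η : ℤ → ℕ) (hηsupp : ∀ x, x ∉ Vseg n → η x = 0)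
    (hη : η ≠ fun _ => 0)
    (Pr : Measure (ℤ → ℕ → Instr ℤ)) (hPr : IsInstrLaw lam P Pr)
    (p : ℝ) (hp : p = (Pr {τ | Mval τ n η = 0}).toReal)
    (lam' : ℝ) (hlam' : lam' = p / (1 - p))
    (D : ℤ → ℤ → ℝ) (hDnonneg : ∀ x y, 0 ≤ D x y) (hDrowsum : ∀ x, ∑' y, D x y = 1)
    (hDnn : ∀ x y, D x y ≠ 0 → y = x + 1 ∨ y = x - 1)
    (hDdir : ∀ x : ℤ, 1 ≤ x → D x (x - 1) = 1 ∧ D (-x) (-x + 1) = 1)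
    (Pr' : Measure (ℤ → ℕ → Instr ℤ)) (hPr' : IsInstrLaw lam' D Pr')
    (ν : Measure (ℤ → ℕ)) (hν : IsProbabilityMeasure ν) :
    ∃ κ : Measure (((ℤ → ℕ) × (ℤ → ℕ → Instr ℤ)) × ((ℤ → ℕ) × (ℤ → ℕ → Instr ℤ))),
      IsProbabilityMeasure κ ∧
      κ.map Prod.fst = (ν.map (phiEta n η)).prod Pr ∧
      κ.map Prod.snd = ν.prod Pr' ∧
      ∀ᵐ ω ∂κ, mTot ω.2.2 (toCfg ω.2.1) 0 = 0 →
        ∀ x ∈ Vseg n, mTot ω.1.2 (toCfg ω.1.1) x = 0 := by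
  have hpconf : p = ARW.confineProb Pr (Vseg n : Set ℤ) (toCfg η) := by
    simp only [hp, ARW.mval_eq_zero_iff hηsupp]
    rfl
  have block : ARW.IsModel lam P Pr := ⟨hlam.le, hPnonneg, hProwsum, hPnn, hPr⟩
  obtain ⟨x, hx⟩ : ∃ x, η x ≠ 0 := by
    by_contra! h
    exact hη (funext h)
  have hp1 : p < 1 := by
    rw [hpconf]
    refine block.confineProb_lt_one hPti (R := n) (fun z hz => ?_) (x := x) ?_
      (by simpa [toCfg, SiteState.activeCount] using Nat.pos_of_ne_zero hx)
    · have := ARW.mem_Vseg.1 (Finset.mem_coe.1 hz)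
      rw [abs_le]
      omega
    · exact Finset.mem_coe.2 (not_imp_comm.1 (hηsupp x) hx)
  have hp0 : 0 ≤ p := hp ▸ ENNReal.toReal_nonneg
  have hq : 0 < 1 - p := sub_pos.2 hp1
  have coarse : ARW.IsModel lam' D Pr' :=
    ⟨hlam' ▸ div_nonneg hp0 hq.le, hDnonneg, hDrowsum, hDnn, hPr'⟩
  have C : ARW.IsCoarseGraining n η lam P Pr lam' D Pr' :=
    { block := block
      coarse := coarse
      translation := hPti
      one_le := hn
      directed := by
        rintro ε (rfl | rfl) k hk
        · exact (hDdir k (by omega)).1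
        · simpa using (hDdir (-k) (by omega)).2
      confine := by
        rw [← hpconf, hlam']
        field_simp
        ring }
  have := hPr.1
  have := hPr'.1
  exact ARW.exists_coupling_of_avoidProb_le n η ν C.avoidProb_le

end
end

section
/- Let λ > 0 and let P be a nearest-neighbour jump distribution on ℤ. Let n ≥ 1, let η : V_n → ℕ be a fixed deterministic initial configuration on V_n with only active particles, and let a, b ∈ ℤ be such that W = {a, …, b} ⊇ V_n. Starting from η and performing legal topplings in V_n and acceptable topplings in W ∖ V_n until the resulting configuration is stable in V_n and empty in W ∖ V_n, let M_n^W denote the number of particles which jump out of W. Then M_n stochastically dominates M_n^W. -/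
open MeasureTheory

noncomputable section

open scoped ENNReal

/-- The law of a single jump instruction above `x` (no sleep instructions): a jump to `y` with
probability `P(x,y)`. -/
def jumpLaw (P : ℤ → ℤ → ℝ) (x : ℤ) : Measure (Instr ℤ) :=
  Measure.sum fun y : ℤ => ENNReal.ofReal (P x y) • Measure.dirac (Instr.jump y)

/-- `Pr` is the law of the array of independent instructions in which the sites of `V` carry
the usual instructions of `𝒫_{λ,P}` while the sleep instructions have been removed above the
sites outside of `V` (so that particles are not allowed to sleep outside of `V`). -/
def IsInstrLawNoSleepOutside (lam : ℝ) (P : ℤ → ℤ → ℝ) (V : Finset ℤ)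
    (Pr : Measure (ℤ → ℕ → Instr ℤ)) : Prop :=
  IsProbabilityMeasure Pr ∧
    ∀ s : Finset (ℤ × ℕ),
      Pr.map (fun τ (q : s) => τ q.1.1 q.1.2) =
        Measure.pi fun q : s =>
          if q.1.1 ∈ V then instrLaw lam P q.1.1 else jumpLaw P q.1.1

section NoMansLand

open scoped Classical

/-! ### Counting used instructions -/

lemma sum_count_update_of_mem {W : Finset ℤ} {x : ℤ} (hx : x ∈ W) (f : ℤ → ℕ → Prop)
    (u : ℤ → ℕ) :
    ∑ y ∈ W, Nat.count (f y) (Function.update u x (u x + 1) y) =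
      ∑ y ∈ W, Nat.count (f y) (u y) + if f x (u x) then 1 else 0 := by
  rw [← Finset.add_sum_erase _ _ hx, ← Finset.add_sum_erase _ _ hx]
  have : ∑ y ∈ W.erase x, Nat.count (f y) (Function.update u x (u x + 1) y) =
      ∑ y ∈ W.erase x, Nat.count (f y) (u y) := by
    refine Finset.sum_congr rfl fun y hy => ?_
    rw [Function.update_of_ne (Finset.ne_of_mem_erase hy)]
  rw [this, Function.update_self, Nat.count_succ]
  ring

/-- The number of jumps to `z` among the instructions of the sites of `W` below `u`. -/
def jumpsTo (τ : ℤ → ℕ → Instr ℤ) (W : Finset ℤ) (u : ℤ → ℕ) (z : ℤ) : ℕ :=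
  ∑ y ∈ W, Nat.count (fun i => τ y i = Instr.jump z) (u y)

/-- The number of jumps among the instructions at `z` below `u`. -/
def jumpsFrom (τ : ℤ → ℕ → Instr ℤ) (u : ℤ → ℕ) (z : ℤ) : ℕ :=
  Nat.count (fun i => ∃ y, τ z i = Instr.jump y) (u z)

/-- The number of jumps out of `V` among the instructions of the sites of `V` below `u`. -/
def exits (τ : ℤ → ℕ → Instr ℤ) (V : Finset ℤ) (u : ℤ → ℕ) : ℕ :=
  ∑ x ∈ V, Nat.count (fun i => ∃ y, y ∉ V ∧ τ x i = Instr.jump y) (u x)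

lemma jumpsTo_update (τ : ℤ → ℕ → Instr ℤ) {W : Finset ℤ} (u : ℤ → ℕ) {x : ℤ} (hx : x ∈ W)
    (z : ℤ) :
    jumpsTo τ W (Function.update u x (u x + 1)) z =
      jumpsTo τ W u z + if τ x (u x) = Instr.jump z then 1 else 0 :=
  sum_count_update_of_mem hx (fun y i => τ y i = Instr.jump z) u

lemma exits_update (τ : ℤ → ℕ → Instr ℤ) {V : Finset ℤ} (u : ℤ → ℕ) {x : ℤ} (hx : x ∈ V) :
    exits τ V (Function.update u x (u x + 1)) =
      exits τ V u + if ∃ y, y ∉ V ∧ τ x (u x) = Instr.jump y then 1 else 0 :=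
  sum_count_update_of_mem hx (fun x i => ∃ y, y ∉ V ∧ τ x i = Instr.jump y) u

lemma jumpsFrom_update (τ : ℤ → ℕ → Instr ℤ) (u : ℤ → ℕ) (x z : ℤ) :
    jumpsFrom τ (Function.update u x (u x + 1)) z =
      jumpsFrom τ u z + if z = x ∧ ∃ y, τ x (u x) = Instr.jump y then 1 else 0 := by
  by_cases h : z = x
  · subst h
    simp [jumpsFrom, Nat.count_succ]
  · simp [jumpsFrom, h]

lemma jumpsTo_mono (τ : ℤ → ℕ → Instr ℤ) (W : Finset ℤ) {u v : ℤ → ℕ} (huv : ∀ x, u x ≤ v x)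
    (z : ℤ) : jumpsTo τ W u z ≤ jumpsTo τ W v z :=
  Finset.sum_le_sum fun y _ => Nat.count_monotone _ (huv y)

lemma sum_jumpsTo_add_exits (τ : ℤ → ℕ → Instr ℤ) (V : Finset ℤ) (u : ℤ → ℕ) :
    ∑ z ∈ V, jumpsTo τ V u z + exits τ V u = ∑ z ∈ V, jumpsFrom τ u z := by
  unfold jumpsTo exits jumpsFrom
  rw [Finset.sum_comm, ← Finset.sum_add_distrib]
  refine Finset.sum_congr rfl fun x _ => ?_
  induction u x with
  | zero => simp
  | succ k ih =>
    simp only [Nat.count_succ, Finset.sum_add_distrib]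
    rw [← ih]
    have : (∑ z ∈ V, if τ x k = Instr.jump z then 1 else 0) +
        (if ∃ y, y ∉ V ∧ τ x k = Instr.jump y then 1 else 0) =
        if ∃ y, τ x k = Instr.jump y then 1 else 0 := by
      cases hτ : τ x k with
      | sleep => simp
      | jump y => by_cases hy : y ∈ V <;> simp [hy]
    omega

/-! ### Particles and odometers along toppling sequences -/

lemma toppleSeq_concat (τ : ℤ → ℕ → Instr ℤ) (α : List ℤ) (x : ℤ) (s : SWState ℤ) :
    toppleSeq τ (α ++ [x]) s = topple τ x (toppleSeq τ α s) := by
  simp [toppleSeq]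

lemma legalSeq_concat (τ : ℤ → ℕ → Instr ℤ) (α : List ℤ) (x : ℤ) (s : SWState ℤ) :
    LegalSeq τ (α ++ [x]) s ↔ LegalSeq τ α s ∧ IsLegal (toppleSeq τ α s) x := by
  induction α generalizing s with
  | nil => simp [LegalSeq, toppleSeq]
  | cons y α ih => simp [LegalSeq, toppleSeq, ih, and_assoc]

lemma toppleSeq_snd (τ : ℤ → ℕ → Instr ℤ) (α : List ℤ) (ξ : Config ℤ) :
    (toppleSeq τ α (init ξ)).2 = fun x => α.count x := by
  induction α using List.reverseRecOn with
  | nil => rfl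
  | append_singleton α x ih =>
    rw [toppleSeq_concat, topple]
    ext z
    by_cases h : z = x
    · subst h; simp [ih]
    · simp [ih, h, Ne.symm h]

lemma SiteState.particles_pos_of_activeCount_pos {s : SiteState} (h : 0 < s.activeCount) :
    0 < s.particles := by
  cases s <;> simp_all [SiteState.activeCount, SiteState.particles]

lemma SiteState.ne_sleeping_of_activeCount_pos {s : SiteState} (h : 0 < s.activeCount) :
    s ≠ sleeping := by
  rintro rfl; simp [SiteState.activeCount] at h

lemma SiteState.particles_remove (s : SiteState) : s.remove.particles = s.particles - 1 := by
  cases s <;> rfl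

lemma SiteState.particles_add (s : SiteState) : s.add.particles = s.particles + 1 := rfl

lemma SiteState.remove_ne_sleeping (s : SiteState) : s.remove ≠ sleeping := by
  cases s <;> simp [SiteState.remove]

lemma SiteState.add_ne_sleeping (s : SiteState) : s.add ≠ sleeping := by
  simp [SiteState.add]

lemma particles_applyInstr {ζ : Config ℤ} {x : ℤ} (hx : 0 < (ζ x).particles) (ι : Instr ℤ)
    (z : ℤ) :
    (applyInstr ι x ζ z).particles + (if z = x ∧ ∃ y, ι = Instr.jump y then 1 else 0) =
      (ζ z).particles + if ι = Instr.jump z then 1 else 0 := by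
  cases ι with
  | sleep =>
    by_cases h : z = x
    · subst h
      by_cases h1 : (ζ z).particles = 1 <;> simp [applyInstr, h1]
      rfl
    · simp [applyInstr, h]
  | jump y =>
    by_cases h : z = x <;> by_cases h' : z = y
    · subst h; subst h'
      simp [applyInstr, SiteState.particles_add, SiteState.particles_remove]; omega
    · subst h
      simp [applyInstr, h', SiteState.particles_remove, Ne.symm h']; omega
    · subst h'
      simp [applyInstr, h, SiteState.particles_add]
    · simp [applyInstr, h, h', Ne.symm h']

lemma particles_toppleSeq {τ : ℤ → ℕ → Instr ℤ} {W : Finset ℤ} {h : ℤ → ℕ} {α : List ℤ}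
    (hα : ∀ x ∈ α, x ∈ W) (hl : LegalSeq τ α (init (toCfg h))) (z : ℤ) :
    h z + jumpsTo τ W (fun x => α.count x) z =
      jumpsFrom τ (fun x => α.count x) z +
        ((toppleSeq τ α (init (toCfg h))).1 z).particles := by
  rw [← toppleSeq_snd τ α (toCfg h)]
  induction α using List.reverseRecOn with
  | nil => simp [toppleSeq, init, jumpsTo, jumpsFrom, toCfg, SiteState.particles]
  | append_singleton α x ih =>
    rw [legalSeq_concat] at hl
    have ih := ih (fun y hy => hα y (by simp [hy])) hl.1
    have hx : x ∈ W := hα x (by simp)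
    rw [toppleSeq_concat]
    have hp := particles_applyInstr (SiteState.particles_pos_of_activeCount_pos hl.2)
      (τ x ((toppleSeq τ α (init (toCfg h))).2 x)) z
    simp only [topple]
    rw [jumpsTo_update _ _ hx, jumpsFrom_update]
    omega

lemma exits_le_sum_of_legalSeq {τ : ℤ → ℕ → Instr ℤ} {V : Finset ℤ} {h : ℤ → ℕ} {α : List ℤ}
    (hα : ∀ x ∈ α, x ∈ V) (hl : LegalSeq τ α (init (toCfg h))) :
    exits τ V (fun x => α.count x) ≤ ∑ z ∈ V, h z := by
  have h1 := Finset.sum_congr (rfl : V = V) fun z _ => particles_toppleSeq hα hl z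
  have h2 := sum_jumpsTo_add_exits τ V (fun x => α.count x)
  simp only [Finset.sum_add_distrib] at h1
  omega

lemma sleeping_or_two_le_particles {τ : ℤ → ℕ → Instr ℤ} {h : ℤ → ℕ} {α : List ℤ}
    (hl : LegalSeq τ α (init (toCfg h))) (z : ℤ) (hz : 0 < α.count z)
    (hs : τ z (α.count z - 1) = Instr.sleep) :
    (toppleSeq τ α (init (toCfg h))).1 z = SiteState.sleeping ∨
      2 ≤ ((toppleSeq τ α (init (toCfg h))).1 z).particles := by
  induction α using List.reverseRecOn with
  | nil => simp at hz
  | append_singleton α x ih =>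
    rw [legalSeq_concat] at hl
    have hpos := SiteState.particles_pos_of_activeCount_pos hl.2
    rw [toppleSeq_concat, topple, toppleSeq_snd]
    by_cases h' : z = x
    · subst h'
      simp only [List.count_append, List.count_singleton_self, Nat.add_sub_cancel] at hs
      simp only [hs, applyInstr, Function.update_self]
      split_ifs with h1
      · simp
      · right; omega
    · simp only [List.count_append, List.count_singleton, beq_iff_eq, Ne.symm h', if_false,
        Nat.add_zero] at hz hs
      have ih := ih hl.1 hz hs
      cases hι : τ x (α.count x) with
      | sleep => simpa [applyInstr, h'] using ih
      | jump y =>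
        by_cases hy : z = y
        · subst hy
          right
          simp only [applyInstr, Function.update_self, Function.update_of_ne h',
            SiteState.particles_add]
          rcases ih with ih | ih
          · simp [ih, SiteState.particles]
          · omega
        · simpa [applyInstr, h', hy] using ih

/-- Least action principle, for an odometer `u` which is only required to be stable at the sites
where it does not exceed the length `K` of the legal sequences considered. -/
lemma count_le_of_stable {τ : ℤ → ℕ → Instr ℤ} {W : Finset ℤ} {h u : ℤ → ℕ} {K : ℕ}
    (hu : ∀ z ∈ W, u z ≤ K → h z + jumpsTo τ W u z ≤ jumpsFrom τ u z ∨
      (h z + jumpsTo τ W u z ≤ jumpsFrom τ u z + 1 ∧ 0 < u z ∧ τ z (u z - 1) = Instr.sleep))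
    {α : List ℤ} (hα : ∀ x ∈ α, x ∈ W) (hl : LegalSeq τ α (init (toCfg h)))
    (hK : α.length ≤ K) (x : ℤ) : α.count x ≤ u x := by
  induction α using List.reverseRecOn generalizing x with
  | nil => simp
  | append_singleton α y ih =>
    rw [legalSeq_concat] at hl
    have hα' : ∀ x ∈ α, x ∈ W := fun z hz => hα z (by simp [hz])
    have ih := ih hα' hl.1 (by simp at hK; omega)
    by_cases hxy : x = y
    swap
    · simpa [List.count_singleton, Ne.symm hxy] using ih x
    subst hxy
    simp only [List.count_append, List.count_singleton_self]
    by_contra hlt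
    have hcu : α.count x = u x := le_antisymm (ih x) (by omega)
    have hxK : u x ≤ K := by
      have := List.count_le_length (a := x) (l := α)
      simp at hK; omega
    have hpos := SiteState.particles_pos_of_activeCount_pos hl.2
    have hp := particles_toppleSeq hα' hl.1 x
    have hto := jumpsTo_mono τ W ih x
    have hfrom : jumpsFrom τ (fun x => α.count x) x = jumpsFrom τ u x := by
      simp [jumpsFrom, hcu]
    rcases hu x (hα x (by simp)) hxK with h1 | ⟨h1, h2, h3⟩
    · omega
    · rcases sleeping_or_two_le_particles hl.1 x (by omega) (by rw [hcu]; exact h3) with h4 | h4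
      · exact SiteState.ne_sleeping_of_activeCount_pos hl.2 h4
      · omega

/-! ### The number of exiting particles -/

lemma count_lt_mV {τ : ℤ → ℕ → Instr ℤ} {V : Finset ℤ} {ξ : Config ℤ} {α : List ℤ}
    (hα : ∀ x ∈ α, x ∈ V) (hl : LegalSeq τ α (init ξ)) {x : ℤ} {i : ℕ} (hi : i < α.count x) :
    (i : ℕ∞) < mV τ (V : Set ℤ) ξ x :=
  lt_of_lt_of_le (Nat.cast_lt.2 hi)
    (le_iSup (fun α : {α : List ℤ // (∀ y ∈ α, y ∈ (V : Set ℤ)) ∧ LegalSeq τ α (init ξ)} =>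
      (seqOdometer α.1 x : ℕ∞)) ⟨α, hα, hl⟩)

lemma enat_hasSum (f : ℕ → ℕ∞) : HasSum f (∑' i, f i) :=
  (hasSum_of_isLUB _ isLUB_iSup).summable.hasSum

lemma natCast_count_eq_sum (p : ℕ → Prop) (n : ℕ) :
    (Nat.count p n : ℕ∞) = ∑ i ∈ Finset.range n, if p i then 1 else 0 := by
  rw [Nat.count_eq_card_filter_range, Finset.card_filter]
  push_cast
  rfl

lemma natCast_exits_le_exitCount {τ : ℤ → ℕ → Instr ℤ} {V : Finset ℤ} {ξ : Config ℤ}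
    {α : List ℤ} (hα : ∀ x ∈ α, x ∈ V) (hl : LegalSeq τ α (init ξ)) :
    (exits τ V (fun x => α.count x) : ℕ∞) ≤ exitCount τ V ξ := by
  unfold exits exitCount
  push_cast
  rw [tsum_fintype, ← Finset.sum_coe_sort V]
  refine Finset.sum_le_sum fun x _ => ?_
  rw [natCast_count_eq_sum]
  refine le_trans (Finset.sum_le_sum fun i hi => ?_)
    (sum_le_hasSum (Finset.range (α.count x.1)) (fun _ _ => zero_le) (enat_hasSum _))
  simp only [count_lt_mV hα hl (Finset.mem_range.1 hi), true_and]
  exact le_rfl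

/-- The event that at least `t` instructions pointing out of `W` are used by the legal sequences
of length at most `K`. -/
def exitEvent (W : Finset ℤ) (ξ : Config ℤ) (K t : ℕ) : Set (ℤ → ℕ → Instr ℤ) :=
  {τ | ∀ u : ℤ → ℕ, (∀ α : List ℤ, (∀ x ∈ α, x ∈ W) → LegalSeq τ α (init ξ) → α.length ≤ K →
    ∀ x, α.count x ≤ u x) → t ≤ exits τ W u}

lemma exitEvent_mono (W : Finset ℤ) (ξ : Config ℤ) (t : ℕ) :
    Monotone fun K => exitEvent W ξ K t :=
  fun _ _ hK _ hτ u hu => hτ u fun α hα hl hlen => hu α hα hl (hlen.trans hK)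

lemma exists_legalSeq_of_lt_mV {τ : ℤ → ℕ → Instr ℤ} {W : Finset ℤ} {ξ : Config ℤ} {x : ℤ}
    {i : ℕ} (hi : (i : ℕ∞) < mV τ (W : Set ℤ) ξ x) :
    ∃ α : List ℤ, (∀ y ∈ α, y ∈ W) ∧ LegalSeq τ α (init ξ) ∧ i < α.count x := by
  obtain ⟨⟨α, h1, h2⟩, h3⟩ := lt_iSup_iff.1 hi
  exact ⟨α, h1, h2, Nat.cast_lt.1 h3⟩

lemma subset_iUnion_exitEvent (W : Finset ℤ) (ξ : Config ℤ) (t : ℕ) :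
    {τ | (t : ℕ∞) ≤ exitCount τ W ξ} ⊆ ⋃ K, exitEvent W ξ K t := by
  intro τ hτ
  have hI : ∃ I : ℕ, (t : ℕ∞) ≤ ∑ x : W, ∑ i ∈ Finset.range I,
      if (i : ℕ∞) < mV τ (W : Set ℤ) ξ x ∧ ∃ y, y ∉ W ∧ τ x i = Instr.jump y
        then (1 : ℕ∞) else 0 := by
    rcases Nat.eq_zero_or_pos t with rfl | ht
    · exact ⟨0, by simp⟩
    have hτ' : (t : ℕ∞) ≤ ∑ x : W, ∑' i : ℕ,
        if (i : ℕ∞) < mV τ (W : Set ℤ) ξ x ∧ ∃ y, y ∉ W ∧ τ x i = Instr.jump y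
          then (1 : ℕ∞) else 0 := by
      simpa only [exitCount, tsum_fintype, Set.mem_ofPred_eq] using hτ
    have hlim := tendsto_finsetSum (Finset.univ : Finset W) fun x _ =>
      (enat_hasSum fun i : ℕ =>
        if (i : ℕ∞) < mV τ (W : Set ℤ) ξ x ∧ ∃ y, y ∉ W ∧ τ x i = Instr.jump y
          then (1 : ℕ∞) else 0).tendsto_sum_nat
    have ht1 : ((t - 1 : ℕ) : ℕ∞) < t := Nat.cast_lt.2 (Nat.sub_lt ht one_pos)
    obtain ⟨I, hI⟩ := (hlim.eventually (lt_mem_nhds (ht1.trans_le hτ'))).exists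
    have ht2 : ((t - 1 : ℕ) : ℕ∞) + 1 = t := by exact_mod_cast Nat.sub_add_cancel ht
    exact ⟨I, ht2 ▸ Order.add_one_le_of_lt hI⟩
  obtain ⟨I, hI⟩ := hI
  have hex : ∀ q : ℤ × ℕ, ∃ α : List ℤ, (q.2 : ℕ∞) < mV τ (W : Set ℤ) ξ q.1 →
      (∀ y ∈ α, y ∈ W) ∧ LegalSeq τ α (init ξ) ∧ q.2 < α.count q.1 := by
    intro q
    by_cases hq : (q.2 : ℕ∞) < mV τ (W : Set ℤ) ξ q.1
    · obtain ⟨α, hα⟩ := exists_legalSeq_of_lt_mV hq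
      exact ⟨α, fun _ => hα⟩
    · exact ⟨[], fun h => absurd h hq⟩
  choose α hα using hex
  refine Set.mem_iUnion.2 ⟨(W ×ˢ Finset.range I).sup fun q => (α q).length, fun u hu => ?_⟩
  rw [← Nat.cast_le (α := ℕ∞)]
  refine hI.trans ?_
  unfold exits
  push_cast
  rw [← Finset.sum_coe_sort W]
  refine Finset.sum_le_sum fun x _ => ?_
  have hcount : ∀ i ∈ Finset.range I, (i : ℕ∞) < mV τ (W : Set ℤ) ξ x → i < u x := by
    intro i hi hm
    obtain ⟨h1, h2, h3⟩ := hα (x, i) hm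
    exact lt_of_lt_of_le h3 (hu _ h1 h2
      (Finset.le_sup (f := fun q => (α q).length) (Finset.mem_product.2 ⟨x.2, hi⟩)) x)
  rw [Nat.count_eq_card_filter_range, ← Finset.sum_filter, Finset.sum_const, nsmul_one]
  refine Nat.cast_le.2 (Finset.card_le_card fun i hi => ?_)
  rw [Finset.mem_filter] at hi ⊢
  exact ⟨Finset.mem_range.2 (hcount i hi.1 hi.2.1), hi.2.2⟩

/-! ### Independence of unused instructions -/

instance : Countable (Instr ℤ) :=
  Function.Surjective.countable (f := fun o : Option ℤ => o.elim Instr.sleep Instr.jump) fun ι =>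
    match ι with
    | .sleep => ⟨none, rfl⟩
    | .jump y => ⟨some y, rfl⟩

instance : MeasurableSingletonClass (Instr ℤ) := ⟨fun _ => trivial⟩

/-- The event that the instructions with index in `F` are those of `σ`. -/
def instrCylinder (F : Finset (ℤ × ℕ)) (σ : ℤ × ℕ → Instr ℤ) : Set (ℤ → ℕ → Instr ℤ) :=
  {τ | ∀ q ∈ F, τ q.1 q.2 = σ q}

/-- The instructions are independent, the instructions above `z` being equal to `ι` with
probability `p z ι`. -/
def HasCylinderLaw (p : ℤ → Instr ℤ → ℝ≥0∞) (Pr : Measure (ℤ → ℕ → Instr ℤ)) : Prop :=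
  ∀ F σ, Pr (instrCylinder F σ) = ∏ q ∈ F, p q.1 (σ q)

/-- `A` fixes the values of finitely many instructions, all of them below `u`. -/
def IsHistory (A : Set (ℤ → ℕ → Instr ℤ)) (u : ℤ → ℕ) : Prop :=
  ∃ F σ, A = instrCylinder F σ ∧ ∀ q ∈ F, q.2 < u q.1

lemma isHistory_univ : IsHistory Set.univ fun _ => 0 :=
  ⟨∅, fun _ => Instr.sleep, by simp [instrCylinder], by simp⟩

lemma instrCylinder_insert {F : Finset (ℤ × ℕ)} {q : ℤ × ℕ} (hq : q ∉ F)
    (σ : ℤ × ℕ → Instr ℤ) (ι : Instr ℤ) :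
    instrCylinder F σ ∩ {τ | τ q.1 q.2 = ι} =
      instrCylinder (insert q F) (Function.update σ q ι) := by
  ext τ
  simp only [instrCylinder, Set.mem_inter_iff, Set.mem_ofPred_eq, Finset.forall_mem_insert,
    Function.update_self]
  rw [and_comm]
  refine and_congr_right fun _ => forall₂_congr fun r hr => ?_
  rw [Function.update_of_ne (ne_of_mem_of_not_mem hr hq)]

lemma IsHistory.inter {A : Set (ℤ → ℕ → Instr ℤ)} {u : ℤ → ℕ} (hA : IsHistory A u) (z : ℤ)
    (ι : Instr ℤ) :
    IsHistory (A ∩ {τ | τ z (u z) = ι}) (Function.update u z (u z + 1)) := by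
  obtain ⟨F, σ, rfl, hF⟩ := hA
  have hz : (z, u z) ∉ F := fun h => lt_irrefl _ (hF _ h)
  refine ⟨_, _, instrCylinder_insert hz σ ι, ?_⟩
  rw [Finset.forall_mem_insert]
  refine ⟨by simp, fun q hq => (hF q hq).trans_le ?_⟩
  by_cases h : q.1 = z
  · rw [h]; simp
  · simp [h]

lemma HasCylinderLaw.measure_inter {p : ℤ → Instr ℤ → ℝ≥0∞} {Pr : Measure (ℤ → ℕ → Instr ℤ)}
    (hPr : HasCylinderLaw p Pr) {A : Set (ℤ → ℕ → Instr ℤ)} {u : ℤ → ℕ} (hA : IsHistory A u)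
    (z : ℤ) (ι : Instr ℤ) : Pr (A ∩ {τ | τ z (u z) = ι}) = Pr A * p z ι := by
  obtain ⟨F, σ, rfl, hF⟩ := hA
  have hz : (z, u z) ∉ F := fun h => lt_irrefl _ (hF _ h)
  rw [instrCylinder_insert hz σ ι, hPr, hPr, Finset.prod_insert hz, mul_comm,
    Function.update_self]
  congr 1
  refine Finset.prod_congr rfl fun q hq => ?_
  rw [Function.update_of_ne (ne_of_mem_of_not_mem hq hz)]

lemma HasCylinderLaw.isProbabilityMeasure {p : ℤ → Instr ℤ → ℝ≥0∞}
    {Pr : Measure (ℤ → ℕ → Instr ℤ)} (hPr : HasCylinderLaw p Pr) : IsProbabilityMeasure Pr := by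
  constructor
  simpa [instrCylinder] using hPr ∅ fun _ => Instr.sleep

lemma HasCylinderLaw.le_one {p : ℤ → Instr ℤ → ℝ≥0∞} {Pr : Measure (ℤ → ℕ → Instr ℤ)}
    (hPr : HasCylinderLaw p Pr) (z : ℤ) (ι : Instr ℤ) : p z ι ≤ 1 := by
  have := hPr.isProbabilityMeasure
  have h := hPr.measure_inter isHistory_univ z ι
  rw [measure_univ, one_mul] at h
  exact h ▸ prob_le_one

/-- Decomposition of an arbitrary event according to the value of an instruction. -/
lemma tsum_measure_instr (Pr : Measure (ℤ → ℕ → Instr ℤ)) (A : Set (ℤ → ℕ → Instr ℤ)) (z : ℤ)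
    (i : ℕ) : ∑' ι : Instr ℤ, Pr (A ∩ {τ | τ z i = ι}) = Pr A := by
  have hm : Measurable fun τ : ℤ → ℕ → Instr ℤ => τ z i := by fun_prop
  have h := measure_iUnion (μ := Pr.restrict A) (f := fun ι : Instr ℤ => {τ | τ z i = ι})
    (fun a b hab => Set.disjoint_left.2 fun τ ha hb => hab (ha.symm.trans hb))
    (fun ι => hm (measurableSet_singleton ι))
  have hU : ⋃ ι : Instr ℤ, {τ : ℤ → ℕ → Instr ℤ | τ z i = ι} = Set.univ := by
    ext τ; simp
  rw [hU, Measure.restrict_apply_univ] at h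
  rw [h]
  refine tsum_congr fun ι => ?_
  have hs : MeasurableSet {τ : ℤ → ℕ → Instr ℤ | τ z i = ι} := hm (measurableSet_singleton ι)
  rw [Measure.restrict_apply hs, Set.inter_comm]

/-! ### Coupling the stabilization in `V` with a stabilization in `W` -/

/-- A joint state of two partial stabilizations of `h`, reading independent arrays. The events `A`
and `B` record the instructions read in `W` and in `V`, and `u` and `m` count them. The sequence
`α` is a legal sequence in `V` leading to the configuration `ζ`, with `e` exits. The run in `W` has
the same configuration in `V`, except for at most one additional particle, located at `w`. -/
structure Coupled (V W : Finset ℤ) (κ : ℤ → ℤ) (h : ℤ → ℕ) (K : ℕ)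
    (A : Set (ℤ → ℕ → Instr ℤ)) (u : ℤ → ℕ) (B : Set (ℤ → ℕ → Instr ℤ)) (m : ℤ → ℕ)
    (α : List ℤ) (ζ : Config ℤ) (e : ℕ) (w : Option ℤ) : Prop where
  freshW : IsHistory A u
  freshV : IsHistory B m
  subset : ∀ x ∈ α, x ∈ V
  run : ∀ τ ∈ B, LegalSeq τ α (init (toCfg h)) ∧
    toppleSeq τ α (init (toCfg h)) = (ζ, m) ∧ exits τ V m = e
  count : ∀ τ ∈ A, ∀ z ∈ W, u z ≤ K → h z + jumpsTo τ W u z ≤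
    jumpsFrom τ u z + (if z ∈ V then (ζ z).particles else 0) + if w = some z then 1 else 0
  asleep : ∀ τ ∈ A, ∀ z ∈ V, ζ z = .sleeping → 0 < u z ∧ τ z (u z - 1) = Instr.sleep
  exits_le : ∀ τ ∈ A, exits τ W u + (if w = none then 0 else 1) ≤ e
  ordered : ∀ x ∈ V, ∀ z ∈ V, ζ x = .sleeping → 0 < (ζ z).activeCount → u z ≤ K → κ z < κ x
  walker : ∀ y, w = some y → y ∈ W ∧ ∀ x ∈ V, ζ x ≠ .sleeping

namespace Coupled

variable {V W : Finset ℤ} {κ : ℤ → ℤ} {h : ℤ → ℕ} {K : ℕ} {A B : Set (ℤ → ℕ → Instr ℤ)}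
  {u m : ℤ → ℕ} {α : List ℤ} {ζ : Config ℤ} {e : ℕ} {w : Option ℤ}

lemma start (hh : ∀ z ∉ V, h z = 0) :
    Coupled V W κ h K Set.univ (fun _ => 0) Set.univ (fun _ => 0) [] (toCfg h) 0 none where
  freshW := isHistory_univ
  freshV := isHistory_univ
  subset := by simp
  run := by simp [LegalSeq, toppleSeq, init, exits]
  count τ _ z _ _ := by
    by_cases hz : z ∈ V <;>
      simp [jumpsTo, jumpsFrom, toCfg, SiteState.particles, hz, hh]
  asleep := by simp [toCfg]
  exits_le := by simp [exits]
  ordered := by simp [toCfg]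
  walker := by simp

/-- The additional particle may be ignored once its site has used more than `K` instructions. -/
lemma drop {y : ℤ} (H : Coupled V W κ h K A u B m α ζ e (some y)) (hy : K < u y) :
    Coupled V W κ h K A u B m α ζ e none where
  freshW := H.freshW
  freshV := H.freshV
  subset := H.subset
  run := H.run
  count τ hτ z hz hK := by
    have hzy : y ≠ z := by rintro rfl; omega
    simpa [hzy] using H.count τ hτ z hz hK
  asleep := H.asleep
  exits_le τ hτ := by have := H.exits_le τ hτ; simp at this ⊢; omega
  ordered := H.ordered
  walker := by simp

/-- The additional particle reads an instruction in `W` only. -/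
lemma walk {y : ℤ} (H : Coupled V W κ h K A u B m α ζ e (some y)) (ι : Instr ℤ) :
    ∃ w', Coupled V W κ h K (A ∩ {τ | τ y (u y) = ι}) (Function.update u y (u y + 1))
      B m α ζ e w' := by
  obtain ⟨hy, hns⟩ := H.walker y rfl
  have hle : ∀ z, u z ≤ Function.update u y (u y + 1) z := fun z => by
    by_cases hz : z = y
    · subst hz; simp
    · simp [hz]
  refine ⟨match ι with
    | .sleep => some y
    | .jump x => if x ∈ W then some x else none, H.freshW.inter y ι, H.freshV, H.subset, H.run,
    ?_, fun _ _ z hz hs => absurd hs (hns z hz), ?_, fun x hx _ _ hs => absurd hs (hns x hx), ?_⟩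
  · rintro τ ⟨hτ, hι⟩ z hz hK
    have hι : τ y (u y) = ι := hι
    have := H.count τ hτ z hz ((hle z).trans hK)
    rw [jumpsTo_update _ _ hy, jumpsFrom_update, hι]
    cases ι with
    | sleep => simpa using this
    | jump x =>
      by_cases hx : x ∈ W
      · simp only [Option.some.injEq, Instr.jump.injEq, hx, if_true, exists_eq', and_true,
          eq_comm (a := y)] at this ⊢
        omega
      · have hxz : x ≠ z := fun h => hx (h ▸ hz)
        simp only [Option.some.injEq, Instr.jump.injEq, hx, hxz, if_false, exists_eq', and_true,
          eq_comm (a := y), reduceCtorEq] at this ⊢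
        omega
  · rintro τ ⟨hτ, hι⟩
    have hι : τ y (u y) = ι := hι
    have := H.exits_le τ hτ
    rw [exits_update _ _ hy, hι]
    cases ι with
    | sleep => simpa using this
    | jump x =>
      by_cases hx : x ∈ W
      · have : ¬ ∃ y, y ∉ W ∧ x = y := by rintro ⟨_, h1, rfl⟩; exact h1 hx
        simp_all
      · have : ∃ y, y ∉ W ∧ x = y := ⟨x, hx, rfl⟩
        simp_all
  · intro x hx
    refine ⟨?_, hns⟩
    cases ι with
    | sleep => simp at hx; exact hx ▸ hy
    | jump x' =>
      by_cases hx' : x' ∈ W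
      · simp [hx'] at hx; exact hx ▸ hx'
      · simp [hx'] at hx

lemma applyInstr_sleeping {z x : ℤ} {ι : Instr ℤ} (hx : applyInstr ι z ζ x = .sleeping)
    (hz : ζ z ≠ .sleeping) :
    (x = z ∧ ι = Instr.sleep) ∨ (x ≠ z ∧ ζ x = .sleeping) := by
  cases ι with
  | sleep =>
    by_cases h1 : x = z
    · simp [h1]
    · simpa [applyInstr, h1] using hx
  | jump y =>
    by_cases h1 : x = y
    · subst h1; simp [applyInstr, SiteState.add_ne_sleeping] at hx
    · by_cases h2 : x = z
      · subst h2; simp [applyInstr, h1, SiteState.remove_ne_sleeping] at hx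
      · simpa [applyInstr, h1, h2] using hx

lemma applyInstr_active {z x : ℤ} {ι : Instr ℤ} (hx : 0 < (applyInstr ι z ζ x).activeCount) :
    ι = Instr.jump x ∨ 0 < (ζ x).activeCount := by
  cases ι with
  | sleep =>
    right
    by_cases h1 : x = z
    · subst h1
      by_cases h2 : (ζ x).particles = 1
      · simp [applyInstr, h2, SiteState.activeCount] at hx
      · simpa [applyInstr, h2] using hx
    · simpa [applyInstr, h1] using hx
  | jump y =>
    by_cases h1 : x = y
    · simp [h1]
    · right
      by_cases h2 : x = z
      · subst h2
        simp only [applyInstr, ne_eq, h1, not_false_eq_true, Function.update_of_ne,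
          Function.update_self] at hx
        revert hx
        cases ζ x <;> simp [SiteState.remove, SiteState.activeCount]
        omega
      · simpa [applyInstr, h1, h2] using hx

/-- The same instruction `ι` is read in `V` and in `W`, at the largest active site. -/
lemma step (H : Coupled V W κ h K A u B m α ζ e none) (hVW : V ⊆ W)
    (hκ : Function.Injective κ) {z : ℤ} (hz : z ∈ V) (hact : 0 < (ζ z).activeCount)
    (huz : u z ≤ K) (hmax : ∀ x ∈ V, 0 < (ζ x).activeCount → u x ≤ K → κ x ≤ κ z) {ι : Instr ℤ}
    (hnn : ∀ y, ι = Instr.jump y → κ y ≤ κ z + 1)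
    (hb : ∀ y ∈ W, y ∉ V → ι = Instr.jump y → ∀ v ∈ V, κ v ≤ κ z) :
    ∃ e' w', Coupled V W κ h K (A ∩ {τ | τ z (u z) = ι}) (Function.update u z (u z + 1))
      (B ∩ {τ | τ z (m z) = ι}) (Function.update m z (m z + 1)) (α ++ [z])
      (applyInstr ι z ζ) e' w' := by
  have hns := SiteState.ne_sleeping_of_activeCount_pos hact
  have hle : ∀ x, u x ≤ Function.update u z (u z + 1) x := fun x => by
    by_cases hx : x = z
    · subst hx; simp
    · simp [hx]
  refine ⟨e + if ∃ y, y ∉ V ∧ ι = Instr.jump y then 1 else 0, match ι with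
    | .sleep => none
    | .jump y => if y ∈ W ∧ y ∉ V then some y else none, H.freshW.inter z ι, H.freshV.inter z ι,
    ?_, ?_, ?_, ?_, ?_, ?_, ?_⟩
  · intro x hx
    rcases List.mem_append.1 hx with hx | hx
    · exact H.subset x hx
    · rw [List.mem_singleton.1 hx]; exact hz
  · rintro τ ⟨hτ, hι⟩
    have hι : τ z (m z) = ι := hι
    obtain ⟨h1, h2, h3⟩ := H.run τ hτ
    rw [legalSeq_concat, toppleSeq_concat, h2, exits_update _ _ hz, h3, hι]
    exact ⟨⟨h1, hact⟩, by simp [topple, hι], rfl⟩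
  · rintro τ ⟨hτ, hι⟩ x hx hK
    have hι : τ z (u z) = ι := hι
    have := H.count τ hτ x hx ((hle x).trans hK)
    rw [jumpsTo_update _ _ (hVW hz), jumpsFrom_update, hι]
    have hp := particles_applyInstr (SiteState.particles_pos_of_activeCount_pos hact) ι x
    by_cases hxV : x ∈ V
    · simp only [hxV, if_true, reduceCtorEq, if_false] at this ⊢
      omega
    · have hxz : x ≠ z := fun h => hxV (h ▸ hz)
      cases ι with
      | sleep => simpa [hxV] using this
      | jump y =>
        by_cases hxy : y = x
        · subst hxy
          simp [hx, hxV, hxz] at this ⊢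
          omega
        · by_cases hy : y ∈ W ∧ y ∉ V <;> simpa [hxV, hxz, hxy, hy] using this
  · rintro τ ⟨hτ, hι⟩ x hx hs
    have hι : τ z (u z) = ι := hι
    rcases applyInstr_sleeping hs hns with ⟨rfl, rfl⟩ | ⟨hxz, hs⟩
    · simpa using hι
    · simpa [hxz] using H.asleep τ hτ x hx hs
  · rintro τ ⟨hτ, hι⟩
    have hι : τ z (u z) = ι := hι
    have := H.exits_le τ hτ
    rw [exits_update _ _ (hVW hz), hι]
    cases ι with
    | sleep => simpa using this
    | jump y =>
      have e1 : (∃ x, x ∉ W ∧ Instr.jump y = Instr.jump x) ↔ y ∉ W := by simp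
      have e2 : (∃ x, x ∉ V ∧ Instr.jump y = Instr.jump x) ↔ y ∉ V := by simp
      simp only [e1, e2]
      by_cases hyV : y ∈ V
      · simpa [hyV, hVW hyV] using this
      · by_cases hyW : y ∈ W <;> simp [hyV, hyW] at this ⊢ <;> omega
  · intro x hx x' hx' hs ha hK
    have hxx : x' ≠ x := by
      rintro rfl
      exact SiteState.ne_sleeping_of_activeCount_pos ha hs
    have hs := applyInstr_sleeping hs hns
    have hKx := (hle x').trans hK
    refine lt_of_le_of_ne ?_ (hκ.ne hxx)
    rcases applyInstr_active ha with rfl | ha'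
    · rcases hs with ⟨_, hs⟩ | ⟨_, hs⟩
      · cases hs
      · have := H.ordered x hx z hz hs hact huz
        have := hnn x' rfl
        omega
    · rcases hs with ⟨rfl, _⟩ | ⟨_, hs⟩
      · exact hmax x' hx' ha' hKx
      · exact (H.ordered x hx x' hx' hs ha' hKx).le
  · intro y hy
    cases ι with
    | sleep => simp at hy
    | jump x =>
      by_cases hx : x ∈ W ∧ x ∉ V
      · simp only [hx, not_false_eq_true, and_self, if_true, Option.some.injEq] at hy
        subst hy
        refine ⟨hx.1, fun v hv hs => ?_⟩
        rcases applyInstr_sleeping hs hns with ⟨_, hs⟩ | ⟨_, hs⟩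
        · cases hs
        · exact absurd (hb x hx.1 hx.2 rfl v hv) (H.ordered v hv z hz hs hact huz).not_ge
      · simp [hx] at hy

end Coupled

/-- The event that some legal sequence in `V` uses at least `t` instructions pointing out of
`V`. -/
def legalExitEvent (V : Finset ℤ) (ξ : Config ℤ) (t : ℕ) : Set (ℤ → ℕ → Instr ℤ) :=
  {τ | ∃ α : List ℤ, (∀ x ∈ α, x ∈ V) ∧ LegalSeq τ α (init ξ) ∧
    t ≤ exits τ V fun x => α.count x}

lemma sum_remaining_update_lt {W : Finset ℤ} {u : ℤ → ℕ} {K : ℕ} {z : ℤ} (hz : z ∈ W)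
    (huz : u z ≤ K) :
    ∑ x ∈ W, (K + 1 - Function.update u z (u z + 1) x) < ∑ x ∈ W, (K + 1 - u x) := by
  refine Finset.sum_lt_sum (fun x _ => ?_) ⟨z, hz, ?_⟩
  · by_cases hx : x = z
    · subst hx; simp; omega
    · simp [hx]
  · simp; omega

namespace Coupled

variable {V W : Finset ℤ} {κ : ℤ → ℤ} {h : ℤ → ℕ} {K t : ℕ} {A B : Set (ℤ → ℕ → Instr ℤ)}
  {u m : ℤ → ℕ} {α : List ℤ} {ζ : Config ℤ} {e : ℕ} {w : Option ℤ}
  {PrW PrV : Measure (ℤ → ℕ → Instr ℤ)}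

lemma measure_le_of_stable (H : Coupled V W κ h K A u B m α ζ e none)
    (hstable : ∀ z ∈ V, u z ≤ K → (ζ z).activeCount = 0) :
    PrW (A ∩ exitEvent W (toCfg h) K t) * PrV B ≤
      PrV (B ∩ legalExitEvent V (toCfg h) t) * PrW A := by
  by_cases ht : t ≤ e
  · have hB : B ⊆ legalExitEvent V (toCfg h) t := fun τ hτ => by
      obtain ⟨h1, h2, h3⟩ := H.run τ hτ
      refine ⟨α, H.subset, h1, ?_⟩
      rw [← toppleSeq_snd τ α (toCfg h), h2, h3]
      exact ht
    rw [Set.inter_eq_left.2 hB, mul_comm]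
    gcongr
    exact Set.inter_subset_left
  · have hA : A ∩ exitEvent W (toCfg h) K t = ∅ := by
      rw [Set.eq_empty_iff_forall_notMem]
      rintro τ ⟨hτ, hE⟩
      have h1 := hE u fun β hβ hl hlen => count_le_of_stable (fun z hz huz => by
        have hc := H.count τ hτ z hz huz
        by_cases hzV : z ∈ V
        · have ha := hstable z hzV huz
          have hs := H.asleep τ hτ z hzV
          cases hζ : ζ z with
          | sleeping =>
            right
            refine ⟨?_, hs hζ⟩
            simpa [hzV, hζ, SiteState.particles] using hc
          | act k =>
            rw [hζ] at ha
            have hk : k = 0 := ha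
            left
            simpa [hzV, hζ, SiteState.particles, hk] using hc
        · left
          simpa [hzV] using hc) hβ hl hlen
      have h2 := H.exits_le τ hτ
      simp only [if_true, add_zero] at h2
      omega
    rw [hA, measure_empty, zero_mul]
    exact zero_le

/-- The stabilization in `V` has at least `t` exits with larger conditional probability, given the
past, than the stabilization in `W`. -/
theorem measure_le {pW pV : ℤ → Instr ℤ → ℝ≥0∞} (hPrW : HasCylinderLaw pW PrW)
    (hPrV : HasCylinderLaw pV PrV) (hp : ∀ z ∈ V, pW z = pV z) (hVW : V ⊆ W)
    (hκ : Function.Injective κ)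
    (hnn : ∀ z ∈ V, ∀ y, pW z (Instr.jump y) ≠ 0 → κ y ≤ κ z + 1)
    (hb : ∀ z ∈ V, ∀ y ∈ W, y ∉ V → pW z (Instr.jump y) ≠ 0 → ∀ v ∈ V, κ v ≤ κ z)
    (H : Coupled V W κ h K A u B m α ζ e w) :
    PrW (A ∩ exitEvent W (toCfg h) K t) * PrV B ≤
      PrV (B ∩ legalExitEvent V (toCfg h) t) * PrW A := by
  induction hN : ∑ x ∈ W, (K + 1 - u x) using Nat.strong_induction_on
    generalizing A B u m α ζ e w with
  | _ N ih =>
  subst hN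
  have hnone : ∀ {w}, w = none → Coupled V W κ h K A u B m α ζ e w →
      PrW (A ∩ exitEvent W (toCfg h) K t) * PrV B ≤
        PrV (B ∩ legalExitEvent V (toCfg h) t) * PrW A := by
    rintro _ rfl H
    by_cases hex : ∃ z ∈ V, 0 < (ζ z).activeCount ∧ u z ≤ K
    swap
    · refine H.measure_le_of_stable fun z hz huz => ?_
      by_contra hne
      exact hex ⟨z, hz, Nat.pos_of_ne_zero hne, huz⟩
    obtain ⟨z, hz, hmax⟩ := Finset.exists_max_image
      (V.filter fun z => 0 < (ζ z).activeCount ∧ u z ≤ K) κ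
      (by obtain ⟨z, hz⟩ := hex; exact ⟨z, by simpa using hz⟩)
    simp only [Finset.mem_filter, and_imp] at hz hmax
    obtain ⟨hzV, hact, huz⟩ := hz
    rw [← tsum_measure_instr PrW (A ∩ exitEvent W (toCfg h) K t) z (u z),
      ← tsum_measure_instr PrV (B ∩ legalExitEvent V (toCfg h) t) z (m z),
      ← ENNReal.tsum_mul_right, ← ENNReal.tsum_mul_right]
    refine ENNReal.tsum_le_tsum fun ι => ?_
    rw [Set.inter_right_comm A, Set.inter_right_comm B]
    by_cases h0 : pW z ι = 0
    · have : PrW (A ∩ {τ | τ z (u z) = ι}) = 0 := by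
        rw [hPrW.measure_inter H.freshW, h0, mul_zero]
      rw [measure_mono_null Set.inter_subset_left this, zero_mul]
      exact zero_le
    obtain ⟨e', w', H'⟩ := H.step hVW hκ hzV hact huz hmax (ι := ι)
      (fun y hy => hnn z hzV y (hy ▸ h0)) (fun y hyW hyV hy => hb z hzV y hyW hyV (hy ▸ h0))
    have := ih _ (sum_remaining_update_lt (hVW hzV) huz) H' rfl
    rw [hPrW.measure_inter H.freshW, hPrV.measure_inter H.freshV, ← hp z hzV, ← mul_assoc,
      ← mul_assoc] at this
    exact (ENNReal.mul_le_mul_iff_left h0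
      (ne_top_of_le_ne_top ENNReal.one_ne_top (hPrW.le_one z ι))).1 this
  rcases hw : w with _ | y
  · exact hnone hw H
  subst hw
  by_cases huy : u y ≤ K
  swap
  · exact hnone rfl (H.drop (not_le.1 huy))
  rw [← tsum_measure_instr PrW (A ∩ exitEvent W (toCfg h) K t) y (u y),
    ← tsum_measure_instr PrW A y (u y), ← ENNReal.tsum_mul_right, ← ENNReal.tsum_mul_left]
  refine ENNReal.tsum_le_tsum fun ι => ?_
  rw [Set.inter_right_comm A]
  obtain ⟨w', H'⟩ := H.walk ι
  exact ih _ (sum_remaining_update_lt (H.walker y rfl).1 huy) H' rfl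

end Coupled

lemma legalExitEvent_eq_empty (V : Finset ℤ) (h : ℤ → ℕ) :
    legalExitEvent V (toCfg h) (∑ z ∈ V, h z + 1) = ∅ := by
  rw [Set.eq_empty_iff_forall_notMem]
  rintro τ ⟨α, hα, hl, ht⟩
  have := exits_le_sum_of_legalSeq hα hl
  omega

/-- Enlarging a domain `V` into `W` on the side where `κ` is maximal does not increase, in the
sense of stochastic domination, the number of exiting particles. -/
theorem measure_exitCount_le {V W : Finset ℤ} {κ : ℤ → ℤ} {h : ℤ → ℕ}
    {PrW PrV : Measure (ℤ → ℕ → Instr ℤ)} {pW pV : ℤ → Instr ℤ → ℝ≥0∞}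
    (hPrW : HasCylinderLaw pW PrW) (hPrV : HasCylinderLaw pV PrV)
    (hp : ∀ z ∈ V, pW z = pV z) (hVW : V ⊆ W) (hh : ∀ z ∉ V, h z = 0)
    (hκ : Function.Injective κ)
    (hnn : ∀ z ∈ V, ∀ y, pW z (Instr.jump y) ≠ 0 → κ y ≤ κ z + 1)
    (hb : ∀ z ∈ V, ∀ y ∈ W, y ∉ V → pW z (Instr.jump y) ≠ 0 → ∀ v ∈ V, κ v ≤ κ z) (t : ℕ∞) :
    PrW {τ | t ≤ exitCount τ W (toCfg h)} ≤ PrV {τ | t ≤ exitCount τ V (toCfg h)} := by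
  have := hPrW.isProbabilityMeasure
  have := hPrV.isProbabilityMeasure
  have key : ∀ s : ℕ, PrW {τ | (s : ℕ∞) ≤ exitCount τ W (toCfg h)} ≤
      PrV (legalExitEvent V (toCfg h) s) := fun s => by
    refine (measure_mono (subset_iUnion_exitEvent W (toCfg h) s)).trans ?_
    rw [(exitEvent_mono W (toCfg h) s).measure_iUnion]
    refine iSup_le fun K => ?_
    simpa using Coupled.measure_le (t := s) (K := K) hPrW hPrV hp hVW hκ hnn hb (Coupled.start hh)
  cases t with
  | top =>
    have h0 := key (∑ z ∈ V, h z + 1)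
    rw [legalExitEvent_eq_empty, measure_empty] at h0
    refine le_trans (measure_mono ?_) (h0.trans zero_le)
    exact fun τ (hτ : ⊤ ≤ exitCount τ W (toCfg h)) => le_trans le_top hτ
  | coe s =>
    refine (key s).trans (measure_mono ?_)
    rintro τ ⟨α, hα, hl, ht⟩
    exact (Nat.cast_le.2 ht).trans (natCast_exits_le_exitCount hα hl)

/-! ### The laws of the instructions -/

lemma sum_ofReal_ne_top {P : ℤ → ℝ} (h1 : ∑' y, P y = 1) :
    ∑' y, ENNReal.ofReal (P y) ≠ ⊤ := by
  have hs : Summable P := by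
    by_contra hs
    rw [tsum_eq_zero_of_not_summable hs] at h1
    exact zero_ne_one h1
  exact hs.tsum_ofReal_ne_top

lemma isFiniteMeasure_jumpLaw {P : ℤ → ℤ → ℝ} {x : ℤ} (h1 : ∑' y, P x y = 1) :
    IsFiniteMeasure (jumpLaw P x) := by
  constructor
  rw [jumpLaw, Measure.sum_apply _ MeasurableSet.univ]
  simpa using (sum_ofReal_ne_top h1).lt_top

lemma isFiniteMeasure_instrLaw {lam : ℝ} (hlam : 0 < lam) {P : ℤ → ℤ → ℝ} {x : ℤ}
    (h0 : ∀ y, 0 ≤ P x y) (h1 : ∑' y, P x y = 1) : IsFiniteMeasure (instrLaw lam P x) := by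
  have hj := isFiniteMeasure_jumpLaw h1
  have hle : ∀ s, instrLaw lam P x s ≤
      ENNReal.ofReal (lam / (1 + lam)) * Measure.dirac Instr.sleep s + jumpLaw P x s := by
    intro s
    have hs : MeasurableSet s := trivial
    simp only [instrLaw, jumpLaw, Measure.add_apply, Measure.smul_apply, Measure.sum_apply _ hs,
      smul_eq_mul]
    gcongr
    exact div_le_self (h0 _) (by linarith)
  exact ⟨(hle _).trans_lt (ENNReal.add_lt_top.2
    ⟨ENNReal.mul_lt_top ENNReal.ofReal_lt_top (measure_lt_top _ _), measure_lt_top _ _⟩)⟩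

lemma hasCylinderLaw_of_map_eq_pi {l : ℤ → Measure (Instr ℤ)} [∀ z, IsFiniteMeasure (l z)]
    {Pr : Measure (ℤ → ℕ → Instr ℤ)}
    (hPr : ∀ s : Finset (ℤ × ℕ),
      Pr.map (fun τ (q : s) => τ q.1.1 q.1.2) = Measure.pi fun q : s => l q.1.1) :
    HasCylinderLaw (fun z ι => l z {ι}) Pr := by
  intro F σ
  have hm : Measurable fun (τ : ℤ → ℕ → Instr ℤ) (q : F) => τ q.1.1 q.1.2 := by fun_prop
  have hpre : instrCylinder F σ =
      (fun (τ : ℤ → ℕ → Instr ℤ) (q : F) => τ q.1.1 q.1.2) ⁻¹' {fun q => σ q.1} := by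
    ext τ
    simp [instrCylinder, funext_iff]
  rw [hpre, ← Measure.map_apply hm (measurableSet_singleton _), hPr, Measure.pi_singleton,
    ← Finset.prod_coe_sort F]

lemma jumpLaw_singleton_ne_zero {P : ℤ → ℤ → ℝ} {x y : ℤ}
    (h : jumpLaw P x {Instr.jump y} ≠ 0) : P x y ≠ 0 := by
  refine fun h0 => h ?_
  rw [jumpLaw, Measure.sum_apply _ (measurableSet_singleton _), ENNReal.tsum_eq_zero]
  intro z
  by_cases hz : z = y <;> simp [hz, h0]

lemma instrLaw_singleton_ne_zero {lam : ℝ} {P : ℤ → ℤ → ℝ} {x y : ℤ}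
    (h : instrLaw lam P x {Instr.jump y} ≠ 0) : P x y ≠ 0 := by
  refine fun h0 => h ?_
  rw [instrLaw, Measure.add_apply, Measure.sum_apply _ (measurableSet_singleton _), add_eq_zero,
    ENNReal.tsum_eq_zero]
  refine ⟨by simp, fun z => ?_⟩
  by_cases hz : z = y <;> simp [hz, h0]

end NoMansLand

/-- **A no man's land around a segment does not increase the number of exiting particles**
(Lemma `lemma_NML`).  Let `λ > 0`, let `P` be a nearest-neighbour jump distribution on `ℤ`,
let `n ≥ 1`, let `η : V_n → ℕ` be a deterministic initial configuration with only active
particles, and let `W = {a, …, b} ⊇ V_n`.  Starting from `η` and performing legal topplings in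
`V_n` and acceptable topplings in `W ∖ V_n` (i.e. using an array with no sleep instructions
outside of `V_n`) until the resulting configuration is stable in `V_n` and empty in
`W ∖ V_n`, the number `M_n^W` of particles which jump out of `W` is stochastically dominated
by `M_n`:  `P(M_n^W ≥ t) ≤ P(M_n ≥ t)` for every `t`. -/
theorem statement6 (lam : ℝ) (hlam : 0 < lam) (P : ℤ → ℤ → ℝ)
    (hPnonneg : ∀ x y, 0 ≤ P x y) (hProwsum : ∀ x, ∑' y, P x y = 1)
    (hPnn : ∀ x y, P x y ≠ 0 → y = x + 1 ∨ y = x - 1)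
    (n : ℕ) (hn : 1 ≤ n) (η : ℤ → ℕ)
    (a b : ℤ) (W : Finset ℤ) (hW : W = Finset.Icc a b) (hVW : Vseg n ⊆ W)
    (Pr : Measure (ℤ → ℕ → Instr ℤ)) (hPr : IsInstrLaw lam P Pr)
    (Pr' : Measure (ℤ → ℕ → Instr ℤ)) (hPr' : IsInstrLawNoSleepOutside lam P (Vseg n) Pr') :
    ∀ t : ℕ∞,
      Pr' {τ | t ≤ exitCount τ W (restrictCfg (Vseg n) η)} ≤
        Pr {τ | t ≤ exitCount τ (Vseg n) (restrictCfg (Vseg n) η)} := by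
  have hfin : ∀ z, IsFiniteMeasure (instrLaw lam P z) := fun z =>
    isFiniteMeasure_instrLaw hlam (hPnonneg z) (hProwsum z)
  have hfin' : ∀ z, IsFiniteMeasure (if z ∈ Vseg n then instrLaw lam P z else jumpLaw P z) :=
    fun z => by
      split_ifs
      exacts [hfin z, isFiniteMeasure_jumpLaw (hProwsum z)]
  have hlaw := hasCylinderLaw_of_map_eq_pi (l := fun z => instrLaw lam P z) hPr.2
  have hlaw' := hasCylinderLaw_of_map_eq_pi
    (l := fun z => if z ∈ Vseg n then instrLaw lam P z else jumpLaw P z) hPr'.2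
  have hnn : ∀ z y, (if z ∈ Vseg n then instrLaw lam P z else jumpLaw P z) {Instr.jump y} ≠ 0 →
      y = z + 1 ∨ y = z - 1 := fun z y hzy => by
    refine hPnn z y ?_
    split_ifs at hzy
    exacts [instrLaw_singleton_ne_zero hzy, jumpLaw_singleton_ne_zero hzy]
  set h : ℤ → ℕ := fun x => if x ∈ Vseg n then η x else 0
  have hcfg : restrictCfg (Vseg n) η = toCfg h := rfl
  rw [hcfg]
  intro t
  set V₁ := W.filter fun z => ∃ v ∈ Vseg n, z ≤ v
  have hV₁W : V₁ ⊆ W := Finset.filter_subset _ _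
  have hVV₁ : Vseg n ⊆ V₁ := fun z hz => Finset.mem_filter.2 ⟨hVW hz, z, hz, le_rfl⟩
  have hright : Pr' {τ | t ≤ exitCount τ W (toCfg h)} ≤ Pr' {τ | t ≤ exitCount τ V₁ (toCfg h)} := by
    refine measure_exitCount_le (κ := id) hlaw' hlaw' (fun _ _ => rfl) hV₁W
      (fun z hz => if_neg fun hz' => hz (hVV₁ hz')) Function.injective_id ?_ ?_ t
    · intro z _ y hzy
      have := hnn z y hzy
      simp only [id]
      omega
    · intro z _ y hyW hyV hzy v hv
      obtain ⟨_, x, hx, hvx⟩ := Finset.mem_filter.1 hv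
      have : ¬ y ≤ x := fun hyx => hyV (Finset.mem_filter.2 ⟨hyW, x, hx, hyx⟩)
      have := hnn z y hzy
      simp only [id]
      omega
  have hleft : Pr' {τ | t ≤ exitCount τ V₁ (toCfg h)} ≤
      Pr {τ | t ≤ exitCount τ (Vseg n) (toCfg h)} := by
    refine measure_exitCount_le (κ := Neg.neg) hlaw' hlaw (fun z hz => by simp [hz]) hVV₁
      (fun z hz => if_neg hz) neg_injective ?_ ?_ t
    · intro z _ y hzy
      have := hnn z y hzy
      omega
    · intro z hz y hyV₁ hyV hzy v hv
      obtain ⟨_, x, hx, hyx⟩ := Finset.mem_filter.1 hyV₁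
      have := hnn z y hzy
      simp only [Vseg, Finset.mem_filter, Finset.mem_Icc] at hz hyV hv hx
      omega
  exact hright.trans hleft

end
end
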